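/- arXiv:math/0511316 — 11 statements merged into one kernel-verified Lean document; each statement's English description precedes it below -/
import Mathlib

section
/- Let T be a tree that has a perfect matching. Then [Pm(P_3 × T)]² = Pm(C_4 × T), i.e., the square of the number of perfect matchings of P_3 × T equals the number of perfect matchings of C_4 × T. -/
open SimpleGraph

/-- The number of perfect matchings of a graph `G`. -/
noncomputable def Pm {V : Type*} (G : SimpleGraph V) : ℕ :=
  Set.ncard {M : G.Subgraph | M.IsPerfectMatching}

/-- Perfect matchings of the part of `G` induced on `X`, as involutions. -/
def PMs {α : Type*} (G : SimpleGraph α) (X : Set α) : Set (α → α) :=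
  {f | (∀ x ∈ X, f x ∈ X ∧ G.Adj x (f x) ∧ f (f x) = x) ∧ ∀ x, x ∉ X → f x = x}

/-- Rooted trees inside `T`. -/
inductive RT {V : Type*} (T : SimpleGraph V) : Set V → V → Prop
  | single (v : V) : RT T {v} v
  | join (U₁ U₂ : Set V) (r c : V) : RT T U₁ r → RT T U₂ c → Disjoint U₁ U₂ → T.Adj r c →
      (∀ x ∈ U₁, ∀ y ∈ U₂, T.Adj x y → x = r ∧ y = c) → RT T (U₁ ∪ U₂) r

theorem RT.root_mem {V : Type*} {T : SimpleGraph V} {U : Set V} {r : V} (h : RT T U r) : r ∈ U := by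
  induction h with
  | single v => simp
  | join U₁ U₂ r c _ _ _ _ _ h1 _ => exact Or.inl h1

theorem RT.add_leaf {V : Type*} {T : SimpleGraph V} {U : Set V} {r : V} (h : RT T U r)
    (u v : V) (hu : u ∈ U) (hv : v ∉ U) (huv : T.Adj u v) (hun : ∀ w ∈ U, T.Adj w v → w = u) :
    RT T (U ∪ {v}) r := by
  induction h with
  | single w =>
    obtain rfl : u = w := hu
    refine RT.join _ _ _ _ (RT.single _) (RT.single v) ?_ huv ?_
    · simpa [eq_comm] using hv
    · rintro x rfl y rfl _; exact ⟨rfl, rfl⟩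
  | join U₁ U₂ r c h1 h2 hd ha hc i1 i2 =>
    simp only [Set.mem_union, not_or] at hv
    rcases hu with hu | hu
    · have := i1 hu hv.1 (fun w hw => hun w (Or.inl hw))
      have e : U₁ ∪ U₂ ∪ {v} = (U₁ ∪ {v}) ∪ U₂ := by ext; simp; tauto
      rw [e]
      refine RT.join _ _ _ _ this h2 ?_ ha ?_
      · rw [Set.disjoint_union_left]; exact ⟨hd, by simpa using hv.2⟩
      · rintro x (hx | rfl) y hy hxy
        · exact hc x hx y hy hxy
        · have := hun y (Or.inr hy) hxy.symm
          subst this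
          exact absurd hu (fun h => Set.disjoint_left.1 hd h hy)
    · have := i2 hu hv.2 (fun w hw => hun w (Or.inr hw))
      rw [Set.union_assoc]
      refine RT.join _ _ _ _ h1 this ?_ ha ?_
      · rw [Set.disjoint_union_right]; exact ⟨hd, by simpa using hv.1⟩
      · rintro x hx y (hy | rfl) hxy
        · exact hc x hx y hy hxy
        · have := hun x (Or.inl hx) hxy
          subst this
          exact absurd hu (fun h => Set.disjoint_left.1 hd hx h)

theorem RT.walk {V : Type*} {T : SimpleGraph V} {U : Set V} {r : V} (h : RT T U r) :
    ∀ u ∈ U, ∃ p : T.Walk r u, ∀ x ∈ p.support, x ∈ U := by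
  induction h with
  | single w => rintro u rfl; exact ⟨Walk.nil, by simp⟩
  | join U₁ U₂ r c h1 h2 hd ha hc i1 i2 =>
    rintro u (hu | hu)
    · obtain ⟨p, hp⟩ := i1 u hu
      exact ⟨p, fun x hx => Or.inl (hp x hx)⟩
    · obtain ⟨p, hp⟩ := i2 u hu
      refine ⟨Walk.cons ha p, ?_⟩
      intro x hx
      rw [Walk.support_cons, List.mem_cons] at hx
      rcases hx with rfl | hx
      · exact Or.inl h1.root_mem
      · exact Or.inr (hp x hx)

theorem RT.of_tree {V : Type*} [Fintype V] {T : SimpleGraph V} (hT : T.IsTree) (r : V) :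
    RT T Set.univ r := by
  classical
  by_contra hne
  have key : ∀ n : ℕ, ∃ U : Set V, RT T U r ∧ n ≤ U.ncard := by
    intro n
    induction n with
    | zero => exact ⟨{r}, RT.single r, Nat.zero_le _⟩
    | succ n ih =>
      obtain ⟨U, hU, hn⟩ := ih
      have hU' : U ≠ Set.univ := by rintro rfl; exact hne hU
      obtain ⟨w, hw⟩ := (Set.ne_univ_iff_exists_notMem U).1 hU'
      obtain ⟨p⟩ := hT.connected.preconnected r w
      obtain ⟨d, -, hd1, hd2⟩ := p.exists_boundary_dart U hU.root_mem hw
      refine ⟨U ∪ {d.snd}, hU.add_leaf d.fst d.snd hd1 hd2 d.adj ?_, ?_⟩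
      · intro x hx hxd
        obtain ⟨p1, hp1⟩ := hU.walk x hx
        obtain ⟨p2, hp2⟩ := hU.walk d.fst hd1
        let q : T.Walk d.fst x := p2.reverse.append p1
        have hq : ∀ y ∈ q.bypass.support, y ∈ U := by
          intro y hy
          have := q.support_bypass_subset_support hy
          simp only [q, Walk.mem_support_append_iff, Walk.support_reverse, List.mem_reverse] at this
          rcases this with h | h
          · exact hp2 y h
          · exact hp1 y h
        have hP : (Walk.cons d.adj.symm q.bypass).IsPath := by
          rw [Walk.cons_isPath_iff]
          exact ⟨q.bypass_isPath, fun h => hd2 (hq _ h)⟩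
        have hP' : (Walk.cons hxd.symm (Walk.nil : T.Walk x x)).IsPath := by
          rw [Walk.cons_isPath_iff]
          exact ⟨Walk.IsPath.nil, by simpa using hxd.ne.symm⟩
        have := (hT.isAcyclic.subsingleton_path _ _).elim (⟨_, hP⟩ : T.Path _ _) ⟨_, hP'⟩
        have h2 : (Walk.cons d.adj.symm q.bypass) = Walk.cons hxd.symm (Walk.nil : T.Walk x x) :=
          congrArg Subtype.val this
        have h3 := congrArg Walk.support h2
        have h4 : d.fst ∈ (Walk.cons d.adj.symm q.bypass).support := by simp
        rw [h3] at h4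
        simp at h4
        exact h4.symm
      · rw [Set.union_singleton, Set.ncard_insert_of_notMem hd2]
        omega
  obtain ⟨U, _, h⟩ := key (Fintype.card V + 1)
  have := Set.ncard_le_card U
  rw [Nat.card_eq_fintype_card] at this
  omega

theorem Pm_eq {α : Type*} (G : SimpleGraph α) : Pm G = (PMs G Set.univ).ncard := by
  classical
  unfold Pm
  symm
  refine Set.ncard_congr (fun f _ => if h : f ∈ PMs G Set.univ then
    { verts := Set.univ, Adj := fun x y => f x = y, 
      adj_sub := by rintro x y rfl; exact (h.1 x trivial).2.1
      edge_vert := fun _ => trivial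
      symm := ⟨by rintro x y rfl; exact (h.1 x trivial).2.2⟩ } else ⊥) ?_ ?_ ?_
  · intro f hf
    rw [dif_pos hf]
    refine ⟨?_, fun v => trivial⟩
    intro v _
    exact ⟨f v, rfl, fun y hy => Eq.symm hy⟩
  · intro f g hf hg h
    rw [dif_pos hf, dif_pos hg] at h
    have := congrArg Subgraph.Adj h
    funext x
    have h2 := congrFun (congrFun this x) (f x)
    simp at h2
    exact h2.symm
  · intro M hM
    have hM' := Subgraph.isPerfectMatching_iff.1 hM
    choose f hf hf' using hM'
    simp only at hf hf'
    have h : f ∈ PMs G Set.univ := by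
      refine ⟨fun x _ => ⟨trivial, (hf x).adj_sub, ?_⟩, fun x hx => absurd trivial hx⟩
      exact (hf' (f x) x (hf x).symm).symm
    refine ⟨f, h, ?_⟩
    rw [dif_pos h]
    ext x y
    · simp; exact hM.2 x
    · constructor
      · rintro rfl; exact hf x
      · intro h; exact (hf' x y h).symm

/-- Number of perfect matchings of the part of `H □ T` over `U`, with fibre over `r` cut to `A`. -/
noncomputable def ZZ {L V : Type*} (H : SimpleGraph L) (T : SimpleGraph V) (U : Set V) (r : V)
    (A : Finset L) : ℕ :=
  (PMs (H □ T) {p | p.2 ∈ U ∧ (p.2 = r → p.1 ∈ A)}).ncard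

theorem ZZ_single {L V : Type*} (H : SimpleGraph L) (T : SimpleGraph V) (r : V) (A : Finset L) :
    ZZ H T {r} r A = (PMs H (A : Set L)).ncard := by
  classical
  unfold ZZ
  refine Set.ncard_congr (fun f _ i => (f (i, r)).1) ?_ ?_ ?_
  · rintro f ⟨h1, h2⟩
    refine ⟨fun i hi => ?_, fun i hi => ?_⟩
    · obtain ⟨⟨e1, e2⟩, e3, e4⟩ := h1 (i, r) ⟨rfl, fun _ => hi⟩
      have e1' : (f (i,r)).2 = r := e1
      have e5 : f (i, r) = ((f (i,r)).1, r) := Prod.ext rfl e1'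
      refine ⟨e2 e1, ?_, ?_⟩
      · rw [boxProd_adj] at e3
        rcases e3 with e3 | e3
        · exact e3.1
        · exact absurd e1'.symm e3.1.ne
      · simp only [← e5, e4]
    · have := h2 (i, r) (fun h => hi (h.2 rfl))
      simp only [this]
  · rintro f g ⟨h1, h2⟩ ⟨h3, h4⟩ h
    funext ⟨i, v⟩
    by_cases hx : (i, v) ∈ {p : L × V | p.2 ∈ ({r} : Set V) ∧ (p.2 = r → p.1 ∈ A)}
    · obtain rfl : v = r := hx.1
      have e1 : (f (i, v)).2 = v := (h1 _ hx).1.1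
      have e2 : (g (i, v)).2 = v := (h3 _ hx).1.1
      exact Prod.ext (congrFun h i) (e1.trans e2.symm)
    · rw [h2 _ hx, h4 _ hx]
  · rintro g ⟨h1, h2⟩
    refine ⟨fun p => if p.2 = r then (g p.1, r) else p, ⟨?_, ?_⟩, ?_⟩
    · rintro ⟨i, v⟩ ⟨hv, hi⟩
      obtain rfl : v = r := hv
      obtain ⟨e1, e2, e3⟩ := h1 i (hi rfl)
      simp [e3, e2]
      exact e1
    · rintro ⟨i, v⟩ hp
      by_cases hv : v = r
      · subst hv
        have : i ∉ A := fun h => hp ⟨rfl, fun _ => h⟩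
        simp [h2 i this]
      · simp [hv]
    · funext i; simp

/-- The crossing set. -/
theorem PMs_fiber {L V : Type*} [Fintype L] [DecidableEq L] [DecidableEq V] (H : SimpleGraph L) (T : SimpleGraph V)
    (U₁ U₂ : Set V) (r c : V) (hr : r ∈ U₁) (hc : c ∈ U₂) (hd : Disjoint U₁ U₂) (ha : T.Adj r c)
    (hx : ∀ x ∈ U₁, ∀ y ∈ U₂, T.Adj x y → x = r ∧ y = c) (A S : Finset L) (hS : S ⊆ A) :
    ({f ∈ PMs (H □ T) {p | p.2 ∈ U₁ ∪ U₂ ∧ (p.2 = r → p.1 ∈ A)} |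
      Finset.univ.filter (fun i => f (i, r) = (i, c)) = S}).ncard =
    ZZ H T U₁ r (A \ S) * ZZ H T U₂ c (Finset.univ \ S) := by
  classical
  have hrc : r ≠ c := ha.ne
  have hr2 : r ∉ U₂ := fun h => Set.disjoint_left.1 hd hr h
  have hc1 : c ∉ U₁ := fun h => Set.disjoint_left.1 hd h hc
  have hd' : ∀ x, x ∈ U₁ → x ∉ U₂ := fun x h h' => Set.disjoint_left.1 hd h h'
  unfold ZZ
  rw [← Set.ncard_prod]
  set X : Set (L × V) := {p | p.2 ∈ U₁ ∪ U₂ ∧ (p.2 = r → p.1 ∈ A)} with hX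
  set Y₁ : Set (L × V) := {p | p.2 ∈ U₁ ∧ (p.2 = r → p.1 ∈ A \ S)} with hY₁
  set Y₂ : Set (L × V) := {p | p.2 ∈ U₂ ∧ (p.2 = c → p.1 ∈ Finset.univ \ S)} with hY₂
  have hYX1 : ∀ p ∈ Y₁, p ∈ X := fun p hp =>
    ⟨Or.inl hp.1, fun h => (Finset.mem_sdiff.1 (hp.2 h)).1⟩
  have hYX2 : ∀ p ∈ Y₂, p ∈ X := fun p hp =>
    ⟨Or.inr hp.1, fun h => absurd (h ▸ hp.1) hr2⟩
  have hY12 : ∀ p, p ∈ Y₁ → p ∉ Y₂ := fun p h h' => hd' _ h.1 h'.1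
  have hrY1 : ∀ i ∈ S, (i, r) ∉ Y₁ := fun i hi h => (Finset.mem_sdiff.1 (h.2 rfl)).2 hi
  have hcY2 : ∀ i ∈ S, (i, c) ∉ Y₂ := fun i hi h => (Finset.mem_sdiff.1 (h.2 rfl)).2 hi
  have hrY2 : ∀ i, (i, r) ∉ Y₂ := fun i h => hr2 h.1
  have hcY1 : ∀ i, (i, c) ∉ Y₁ := fun i h => hc1 h.1
  have hcX : ∀ i, (i, c) ∈ X := fun i => ⟨Or.inr hc, fun h => absurd h.symm hrc⟩
  have hrX : ∀ i ∈ S, (i, r) ∈ X := fun i hi => ⟨Or.inl hr, fun _ => hS hi⟩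
  -- classification of `X`
  have hcls : ∀ p ∈ X, p ∈ Y₁ ∨ p ∈ Y₂ ∨ (∃ i ∈ S, p = (i, r)) ∨ (∃ i ∈ S, p = (i, c)) := by
    rintro ⟨i, v⟩ ⟨hv | hv, hA⟩
    · by_cases h : v = r ∧ i ∈ S
      · exact Or.inr (Or.inr (Or.inl ⟨i, h.2, by rw [h.1]⟩))
      · left
        refine ⟨hv, fun h1 => Finset.mem_sdiff.2 ⟨hA h1, fun h2 => h ⟨h1, h2⟩⟩⟩
    · by_cases h : v = c ∧ i ∈ S
      · exact Or.inr (Or.inr (Or.inr ⟨i, h.2, by rw [h.1]⟩))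
      · right; left
        refine ⟨hv, fun h1 => Finset.mem_sdiff.2 ⟨Finset.mem_univ _, fun h2 => h ⟨h1, h2⟩⟩⟩
  -- crossing edges
  have hcross : ∀ p q : L × V, p.2 ∈ U₁ → q.2 ∈ U₂ → (H □ T).Adj p q →
      p.2 = r ∧ q = (p.1, c) := by
    rintro ⟨i, v⟩ ⟨j, w⟩ hv hw h
    rw [boxProd_adj] at h
    rcases h with ⟨-, h⟩ | ⟨h, h'⟩
    · simp only at h hv hw; subst h; exact absurd hw (hd' _ hv)
    · obtain ⟨e1, e2⟩ := hx v hv w hw h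
      simp only at h'
      subst h' e1 e2
      exact ⟨rfl, rfl⟩
  let glue : (L × V → L × V) → (L × V → L × V) → L × V → L × V := fun g h p =>
    if p ∈ Y₁ then g p else if p ∈ Y₂ then h p else
      if p.2 = r ∧ p.1 ∈ S then (p.1, c) else if p.2 = c ∧ p.1 ∈ S then (p.1, r) else p
  have gl1 : ∀ g h p, p ∈ Y₁ → glue g h p = g p := fun g h p hp => by simp only [glue, if_pos hp]
  have gl2 : ∀ g h p, p ∈ Y₂ → glue g h p = h p := fun g h p hp => by
    simp only [glue, if_pos hp, if_neg (fun h' => hY12 p h' hp)]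
  have gl3 : ∀ g h, ∀ i ∈ S, glue g h (i, r) = (i, c) := fun g h i hi => by
    simp only [glue, if_neg (hrY1 i hi), if_neg (hrY2 i), hi, and_self, if_true]
  have gl4 : ∀ g h, ∀ i ∈ S, glue g h (i, c) = (i, r) := fun g h i hi => by
    simp only [glue, if_neg (hcY2 i hi), if_neg (hcY1 i), hi, hrc.symm, and_self, if_true, false_and, if_false]
  have gl5 : ∀ g h p, p ∉ X → glue g h p = p := fun g h p hp => by
    have h3 : ¬ (p.2 = r ∧ p.1 ∈ S) := fun h => hp (by
      have := hrX _ h.2; rw [← h.1] at this; exact this)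
    have h4 : ¬ (p.2 = c ∧ p.1 ∈ S) := fun h => hp (by
      have := hcX p.1; rw [← h.1] at this; exact this)
    simp only [glue, if_neg (fun h => hp (hYX1 p h)), if_neg (fun h => hp (hYX2 p h)), if_neg h3, if_neg h4]
  -- closure
  have key : ∀ f ∈ PMs (H □ T) X, Finset.univ.filter (fun i => f (i, r) = (i, c)) = S →
      (∀ i ∈ S, f (i, r) = (i, c)) ∧ (∀ i ∈ S, f (i, c) = (i, r)) ∧ (∀ p ∈ Y₁, f p ∈ Y₁) ∧
      (∀ p ∈ Y₂, f p ∈ Y₂) := by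
    rintro f ⟨h1, h2⟩ hfS
    have hf : ∀ i, f (i, r) = (i, c) ↔ i ∈ S := fun i => by rw [← hfS]; simp
    have k1 : ∀ i ∈ S, f (i, r) = (i, c) := fun i hi => (hf i).2 hi
    have k2 : ∀ i ∈ S, f (i, c) = (i, r) := fun i hi => by
      rw [← k1 i hi]; exact (h1 _ (hrX i hi)).2.2
    refine ⟨k1, k2, fun p hp => ?_, fun p hp => ?_⟩
    · obtain ⟨e1, e2, e3⟩ := h1 p (hYX1 p hp)
      have notcross : (f p).2 ∉ U₂ := by
        intro hh
        obtain ⟨e4, e5⟩ := hcross p (f p) hp.1 hh e2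
        have e6 : p = (p.1, r) := Prod.ext rfl e4
        have : p.1 ∈ S := (hf p.1).1 (by rw [← e6]; exact e5)
        exact (Finset.mem_sdiff.1 (hp.2 e4)).2 this
      rcases hcls _ e1 with h | h | ⟨i, hi, h⟩ | ⟨i, hi, h⟩
      · exact h
      · exact absurd h.1 notcross
      · rw [h, k1 i hi] at e3
        exact absurd (e3 ▸ hp) (hcY1 i)
      · exact absurd (by rw [h]; exact hc) notcross
    · obtain ⟨e1, e2, e3⟩ := h1 p (hYX2 p hp)
      have notcross : (f p).2 ∉ U₁ := by
        intro hh
        obtain ⟨e4, e5⟩ := hcross (f p) p hh hp.1 e2.symm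
        have e6 : f p = ((f p).1, r) := Prod.ext rfl e4
        have : (f p).1 ∈ S := (hf _).1 (by rw [← e6, e3]; exact e5)
        rw [e5] at hp
        exact hcY2 _ this hp
      rcases hcls _ e1 with h | h | ⟨i, hi, h⟩ | ⟨i, hi, h⟩
      · exact absurd h.1 notcross
      · exact h
      · exact absurd (by rw [h]; exact hr) notcross
      · rw [h, k2 i hi] at e3
        exact absurd (e3 ▸ hp) (hrY2 i)
  refine Set.ncard_congr (fun f _ => ((fun p => if p ∈ Y₁ then f p else p), 
    (fun p => if p ∈ Y₂ then f p else p))) ?_ ?_ ?_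
  · rintro f ⟨hf, hfS⟩
    obtain ⟨k1, k2, k3, k4⟩ := key f hf hfS
    obtain ⟨h1, h2⟩ := hf
    refine ⟨⟨fun p hp => ?_, fun p hp => ?_⟩, ⟨fun p hp => ?_, fun p hp => ?_⟩⟩
    · obtain ⟨e1, e2, e3⟩ := h1 p (hYX1 p hp)
      simp only [if_pos hp, if_pos (k3 p hp)]
      exact ⟨k3 p hp, e2, e3⟩
    · simp only [if_neg hp]
    · obtain ⟨e1, e2, e3⟩ := h1 p (hYX2 p hp)
      simp only [if_pos hp, if_pos (k4 p hp)]
      exact ⟨k4 p hp, e2, e3⟩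
    · simp only [if_neg hp]
  · rintro f g ⟨hf, hfS⟩ ⟨hg, hgS⟩ h
    obtain ⟨k1, k2, k3, k4⟩ := key f hf hfS
    obtain ⟨l1, l2, l3, l4⟩ := key g hg hgS
    rw [Prod.mk.injEq] at h
    funext p
    by_cases hp : p ∈ X
    · rcases hcls p hp with h' | h' | ⟨i, hi, h'⟩ | ⟨i, hi, h'⟩
      · simpa only [if_pos h'] using congrFun h.1 p
      · simpa only [if_pos h'] using congrFun h.2 p
      · rw [h', k1 i hi, l1 i hi]
      · rw [h', k2 i hi, l2 i hi]
    · rw [hf.2 p hp, hg.2 p hp]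
  · rintro ⟨g, h⟩ ⟨⟨g1, g2⟩, ⟨h1, h2⟩⟩
    simp only at g1 g2 h1 h2
    refine ⟨glue g h, ⟨⟨fun p hp => ?_, fun p hp => gl5 g h p hp⟩, ?_⟩, ?_⟩
    · rcases hcls p hp with h' | h' | ⟨i, hi, rfl⟩ | ⟨i, hi, rfl⟩
      · obtain ⟨e1, e2, e3⟩ := g1 p h'
        rw [gl1 g h p h', gl1 g h _ e1]
        exact ⟨hYX1 _ e1, e2, e3⟩
      · obtain ⟨e1, e2, e3⟩ := h1 p h'
        rw [gl2 g h p h', gl2 g h _ e1]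
        exact ⟨hYX2 _ e1, e2, e3⟩
      · rw [gl3 g h i hi, gl4 g h i hi]
        exact ⟨hcX i, by rw [boxProd_adj]; exact Or.inr ⟨ha, rfl⟩, rfl⟩
      · rw [gl4 g h i hi, gl3 g h i hi]
        exact ⟨hrX i hi, by rw [boxProd_adj]; exact Or.inr ⟨ha.symm, rfl⟩, rfl⟩
    · ext i
      rw [Finset.mem_filter]
      constructor
      · rintro ⟨-, hi⟩
        by_contra hiS
        by_cases hp : (i, r) ∈ Y₁
        · rw [gl1 g h _ hp] at hi
          have := (g1 _ hp).1
          rw [hi] at this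
          exact hcY1 i this
        · have : (i, r) ∉ X := by
            intro hX'
            rcases hcls _ hX' with h' | h' | ⟨j, hj, h'⟩ | ⟨j, hj, h'⟩
            · exact hp h'
            · exact hrY2 i h'
            · rw [Prod.mk.injEq] at h'; rw [h'.1] at hiS; exact hiS hj
            · rw [Prod.mk.injEq] at h'; exact hrc h'.2
          rw [gl5 g h _ this, Prod.mk.injEq] at hi
          exact hrc hi.2
      · intro hi; exact ⟨Finset.mem_univ _, gl3 g h i hi⟩
    · rw [Prod.mk.injEq]
      constructor
      · funext p
        by_cases hp : p ∈ Y₁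
        · simp only [if_pos hp, gl1 g h p hp]
        · simp only [if_neg hp, g2 p hp]
      · funext p
        by_cases hp : p ∈ Y₂
        · simp only [if_pos hp, gl2 g h p hp]
        · simp only [if_neg hp, h2 p hp]

theorem ZZ_join {L V : Type*} [Fintype L] [DecidableEq L] [Fintype V] (H : SimpleGraph L) (T : SimpleGraph V)
    (U₁ U₂ : Set V) (r c : V) (hr : r ∈ U₁) (hc : c ∈ U₂) (hd : Disjoint U₁ U₂) (ha : T.Adj r c)
    (hx : ∀ x ∈ U₁, ∀ y ∈ U₂, T.Adj x y → x = r ∧ y = c) (A : Finset L) :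
    ZZ H T (U₁ ∪ U₂) r A =
      ∑ S ∈ A.powerset, ZZ H T U₁ r (A \ S) * ZZ H T U₂ c (Finset.univ \ S) := by
  classical
  rw [Finset.sum_congr rfl (fun S hS => (PMs_fiber H T U₁ U₂ r c hr hc hd ha hx A S
    (Finset.mem_powerset.1 hS)).symm)]
  unfold ZZ
  set P := PMs (H □ T) {p | p.2 ∈ U₁ ∪ U₂ ∧ (p.2 = r → p.1 ∈ A)} with hP
  have hmap : ∀ f ∈ P.toFinset, Finset.univ.filter (fun i => f (i, r) = (i, c)) ∈ A.powerset := by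
    intro f hf
    rw [Set.mem_toFinset] at hf
    rw [Finset.mem_powerset]
    intro i hi
    rw [Finset.mem_filter] at hi
    by_contra hiA
    have := hf.2 (i, r) (fun h => hiA (h.2 rfl))
    rw [hi.2, Prod.mk.injEq] at this
    exact ha.ne this.2.symm
  rw [Set.ncard_eq_toFinset_card' P, Finset.card_eq_sum_card_fiberwise hmap]
  refine Finset.sum_congr rfl fun S _ => ?_
  rw [← Set.ncard_coe_finset]
  congr 1
  ext f
  simp

def chk {n : ℕ} (G : SimpleGraph (Fin n)) [DecidableRel G.Adj] (A : Finset (Fin n)) :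
    Finset (Fin n → Fin n) :=
  Finset.univ.filter (fun f => (∀ x ∈ A, f x ∈ A ∧ G.Adj x (f x) ∧ f (f x) = x) ∧
    ∀ x, x ∉ A → f x = x)

theorem PMs_chk {n : ℕ} (G : SimpleGraph (Fin n)) [DecidableRel G.Adj] (A : Finset (Fin n)) :
    (PMs G (A : Set (Fin n))).ncard = (chk G A).card := by
  rw [← Set.ncard_coe_finset]; congr 1; ext f; simp [chk, PMs]

instance decP3 : DecidableRel (pathGraph 3).Adj := fun _ _ => decidable_of_iff _ (pathGraph_adj).symm

instance decC4 : DecidableRel (cycleGraph 4).Adj := fun x y =>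
  decidable_of_iff (x - y = 1 ∨ y - x = 1) (by rw [cycleGraph_adj])

/-- State class for `C₄`: full, adjacent pair, empty, other. -/
def k4 (A : Finset (Fin 4)) : Fin 4 :=
  if A = Finset.univ then 0 else
  if A = {0,1} ∨ A = {1,2} ∨ A = {2,3} ∨ A = {3,0} then 1 else if A = ∅ then 2 else 3

/-- State class for `P₃`, even type: full, end vertex, other. -/
def kE (A : Finset (Fin 3)) : Fin 3 :=
  if A = Finset.univ then 0 else if A = {0} ∨ A = {2} then 1 else 2

/-- State class for `P₃`, odd type: edge, empty, other. -/
def kO (A : Finset (Fin 3)) : Fin 3 :=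
  if A = {0,1} ∨ A = {1,2} then 0 else if A = ∅ then 1 else 2

theorem base4 : ∀ A, (chk (cycleGraph 4) A).card = ![2, 1, 1, 0] (k4 A) := by decide +kernel
theorem base3 : ∀ A, (chk (pathGraph 3) A).card = ![1, 1, 0] (kO A) := by decide +kernel

def cf {L : Type*} [Fintype L] [DecidableEq L] {m n : ℕ} (k : Finset L → Fin m)
    (k' : Finset L → Fin n) (A : Finset L) (x : Fin m) (y : Fin n) : ℕ :=
  (A.powerset.filter (fun S => (k (A \ S), k' (Finset.univ \ S)) = (x, y))).card

theorem sum_cf {L : Type*} [Fintype L] [DecidableEq L] {m n : ℕ} (k : Finset L → Fin m)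
    (k' : Finset L → Fin n) (v : Fin m → ℕ) (w : Fin n → ℕ) (A : Finset L) :
    ∑ S ∈ A.powerset, v (k (A \ S)) * w (k' (Finset.univ \ S)) =
      ∑ x, ∑ y, cf k k' A x y * (v x * w y) := by
  rw [← Finset.sum_fiberwise A.powerset (fun S => (k (A \ S), k' (Finset.univ \ S))),
    Fintype.sum_prod_type]
  refine Finset.sum_congr rfl fun x _ => Finset.sum_congr rfl fun y _ => ?_
  rw [cf, ← smul_eq_mul, ← Finset.sum_const]
  refine Finset.sum_congr rfl fun S hS => ?_
  have := (Finset.mem_filter.1 hS).2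
  rw [Prod.mk.injEq] at this
  rw [this.1, this.2]

theorem cf4 : ∀ A, cf k4 k4 A 0 0 = (if k4 A = 0 then 1 else 0) ∧ cf k4 k4 A 0 1 = 0 ∧
    cf k4 k4 A 0 2 = 0 ∧ cf k4 k4 A 1 0 = (if k4 A = 1 then 1 else 0) ∧
    cf k4 k4 A 1 1 = (if k4 A = 0 then 4 else 0) ∧ cf k4 k4 A 1 2 = 0 ∧
    cf k4 k4 A 2 0 = (if k4 A = 2 then 1 else 0) ∧ cf k4 k4 A 2 1 = (if k4 A = 1 then 1 else 0) ∧
    cf k4 k4 A 2 2 = (if k4 A = 0 then 1 else 0) := by decide +kernel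

theorem cfOO : ∀ A, cf kO kO A 0 0 = (if kE A = 0 then 2 else 0) ∧ cf kO kO A 0 1 = 0 ∧
    cf kO kO A 1 0 = (if kE A = 1 then 1 else 0) ∧
    cf kO kO A 1 1 = (if kE A = 0 then 1 else 0) := by decide +kernel

theorem cfEE : ∀ A, cf kE kE A 0 0 = (if kE A = 0 then 1 else 0) ∧ cf kE kE A 0 1 = 0 ∧
    cf kE kE A 1 0 = (if kE A = 1 then 1 else 0) ∧
    cf kE kE A 1 1 = (if kE A = 0 then 2 else 0) := by decide +kernel

theorem cfOE : ∀ A, cf kO kE A 0 0 = (if kO A = 0 then 1 else 0) ∧ cf kO kE A 0 1 = 0 ∧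
    cf kO kE A 1 0 = (if kO A = 1 then 1 else 0) ∧
    cf kO kE A 1 1 = (if kO A = 0 then 1 else 0) := by decide +kernel

theorem sum4 (p q s p' q' s' : ℕ) (A : Finset (Fin 4)) :
    ∑ S ∈ A.powerset, ![p, q, s, 0] (k4 (A \ S)) * ![p', q', s', 0] (k4 (Finset.univ \ S)) =
      ![p * p' + 4 * (q * q') + s * s', q * p' + s * q', s * p', 0] (k4 A) := by
  rw [sum_cf]
  obtain ⟨h1, h2, h3, h4, h5, h6, h7, h8, h9⟩ := cf4 A
  simp only [Fin.sum_univ_four, h1, h2, h3, h4, h5, h6, h7, h8, h9]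
  generalize k4 A = z
  fin_cases z <;> simp

theorem sumOO (a b a' b' : ℕ) (A : Finset (Fin 3)) :
    ∑ S ∈ A.powerset, ![a, b, 0] (kO (A \ S)) * ![a', b', 0] (kO (Finset.univ \ S)) =
      ![2 * (a * a') + b * b', b * a', 0] (kE A) := by
  rw [sum_cf]
  obtain ⟨h1, h2, h3, h4⟩ := cfOO A
  simp only [Fin.sum_univ_three, h1, h2, h3, h4]
  generalize kE A = z
  fin_cases z <;> simp

theorem sumEE (a b a' b' : ℕ) (A : Finset (Fin 3)) :
    ∑ S ∈ A.powerset, ![a, b, 0] (kE (A \ S)) * ![a', b', 0] (kE (Finset.univ \ S)) =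
      ![a * a' + 2 * (b * b'), b * a', 0] (kE A) := by
  rw [sum_cf]
  obtain ⟨h1, h2, h3, h4⟩ := cfEE A
  simp only [Fin.sum_univ_three, h1, h2, h3, h4]
  generalize kE A = z
  fin_cases z <;> simp

theorem sumOE (a b a' b' : ℕ) (A : Finset (Fin 3)) :
    ∑ S ∈ A.powerset, ![a, b, 0] (kO (A \ S)) * ![a', b', 0] (kE (Finset.univ \ S)) =
      ![a * a' + b * b', b * a', 0] (kO A) := by
  rw [sum_cf]
  obtain ⟨h1, h2, h3, h4⟩ := cfOE A
  simp only [Fin.sum_univ_three, h1, h2, h3, h4]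
  generalize kO A = z
  fin_cases z <;> simp

theorem vec4 {p q s p' q' s' : ℕ} (z : Fin 4) (h1 : p = p') (h2 : q = q') (h3 : s = s') :
    ![p, q, s, 0] z = ![p', q', s', 0] z := by
  subst h1 h2 h3; rfl

def isE {V : Type*} (T : SimpleGraph V) (U : Set V) (r : V) : Prop :=
  ∃ a b : ℕ, (∀ A, ZZ (pathGraph 3) T U r A = ![a, b, 0] (kE A)) ∧
    ∀ A, ZZ (cycleGraph 4) T U r A = ![a ^ 2, a * b, 2 * b ^ 2, 0] (k4 A)

def isO {V : Type*} (T : SimpleGraph V) (U : Set V) (r : V) : Prop :=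
  ∃ a b : ℕ, (∀ A, ZZ (pathGraph 3) T U r A = ![a, b, 0] (kO A)) ∧
    ∀ A, ZZ (cycleGraph 4) T U r A = ![2 * a ^ 2, a * b, b ^ 2, 0] (k4 A)

theorem RT.main {V : Type*} [Fintype V] {T : SimpleGraph V} {U : Set V} {r : V} (h : RT T U r) :
    (ZZ (⊥ : SimpleGraph (Fin 1)) T U r Finset.univ ≠ 0 → isE T U r) ∧
    (ZZ (⊥ : SimpleGraph (Fin 1)) T U r ∅ ≠ 0 → isO T U r) := by
  induction h with
  | single v =>
    constructor
    · intro h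
      exfalso
      apply h
      rw [ZZ_single, Set.ncard_eq_zero]
      ext f
      simp [PMs]
    · intro _
      refine ⟨1, 1, fun A => ?_, fun A => ?_⟩
      · rw [ZZ_single, PMs_chk, base3]
      · rw [ZZ_single, PMs_chk, base4]; rfl
  | join U₁ U₂ r c h1 h2 hd ha hc i1 i2 =>
    have J3 := ZZ_join (pathGraph 3) T U₁ U₂ r c h1.root_mem h2.root_mem hd ha hc
    have J4 := ZZ_join (cycleGraph 4) T U₁ U₂ r c h1.root_mem h2.root_mem hd ha hc
    have J1 := ZZ_join (⊥ : SimpleGraph (Fin 1)) T U₁ U₂ r c h1.root_mem h2.root_mem hd ha hc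
    constructor
    · intro h
      rw [J1, show (Finset.univ : Finset (Fin 1)).powerset = {∅, Finset.univ} by decide,
        Finset.sum_pair (by decide)] at h
      simp only [Finset.sdiff_empty, sdiff_self, Finset.bot_eq_empty] at h
      by_cases hz : ZZ (⊥ : SimpleGraph (Fin 1)) T U₁ r Finset.univ *
          ZZ (⊥ : SimpleGraph (Fin 1)) T U₂ c Finset.univ = 0
      · rw [hz, zero_add] at h
        obtain ⟨a, b, e1, e2⟩ := i1.2 (left_ne_zero_of_mul h)
        obtain ⟨a', b', e3, e4⟩ := i2.2 (right_ne_zero_of_mul h)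
        refine ⟨2 * (a * a') + b * b', b * a', fun A => ?_, fun A => ?_⟩
        · rw [J3]; simp only [e1, e3]; rw [sumOO]
        · rw [J4]; simp only [e2, e4]; rw [sum4]
          refine vec4 _ ?_ ?_ ?_ <;> ring
      · obtain ⟨a, b, e1, e2⟩ := i1.1 (left_ne_zero_of_mul hz)
        obtain ⟨a', b', e3, e4⟩ := i2.1 (right_ne_zero_of_mul hz)
        refine ⟨a * a' + 2 * (b * b'), b * a', fun A => ?_, fun A => ?_⟩
        · rw [J3]; simp only [e1, e3]; rw [sumEE]
        · rw [J4]; simp only [e2, e4]; rw [sum4]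
          refine vec4 _ ?_ ?_ ?_ <;> ring
    · intro h
      rw [J1, Finset.powerset_empty, Finset.sum_singleton, Finset.sdiff_empty,
        Finset.sdiff_empty] at h
      obtain ⟨a, b, e1, e2⟩ := i1.2 (left_ne_zero_of_mul h)
      obtain ⟨a', b', e3, e4⟩ := i2.1 (right_ne_zero_of_mul h)
      refine ⟨a * a' + b * b', b * a', fun A => ?_, fun A => ?_⟩
      · rw [J3]; simp only [e1, e3]; rw [sumOE]
      · rw [J4]; simp only [e2, e4]; rw [sum4]
        refine vec4 _ ?_ ?_ ?_ <;> ring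

theorem ZZ_univ {L V : Type*} [Fintype L] (H : SimpleGraph L) (T : SimpleGraph V) (r : V) :
    ZZ H T Set.univ r Finset.univ = Pm (H □ T) := by
  rw [Pm_eq, ZZ]; congr 2; ext; simp

/-- For a tree `T` with a perfect matching, `[Pm(P_3 × T)]² = Pm(C_4 × T)`. -/
theorem pm_p3_sq_eq_pm_c4 {V : Type*} [Fintype V]
    (T : SimpleGraph V) (hT : T.IsTree)
    (hM : ∃ M : T.Subgraph, M.IsPerfectMatching) :
    (Pm (pathGraph 3 □ T)) ^ 2 = Pm (cycleGraph 4 □ T) := by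
  classical
  obtain ⟨r⟩ := hT.connected.nonempty
  have hne : ZZ (⊥ : SimpleGraph (Fin 1)) T Set.univ r Finset.univ ≠ 0 := by
    obtain ⟨M, hM⟩ := hM
    have hM' := Subgraph.isPerfectMatching_iff.1 hM
    choose f hf hf' using hM'
    simp only at hf hf'
    rw [ZZ]
    refine Set.ncard_ne_zero_of_mem (a := fun p => (p.1, f p.2)) ?_
    refine ⟨fun p _ => ⟨⟨trivial, fun _ => Finset.mem_univ _⟩, ?_, ?_⟩,
      fun p hp => absurd ⟨trivial, fun _ => Finset.mem_univ _⟩ hp⟩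
    · rw [boxProd_adj]; exact Or.inr ⟨(hf p.2).adj_sub, rfl⟩
    · exact Prod.ext rfl (hf' _ _ (hf p.2).symm).symm
  obtain ⟨a, b, h3, h4⟩ := (RT.of_tree hT r).main.1 hne
  rw [← ZZ_univ _ _ r, ← ZZ_univ _ _ r, h3, h4]
  rfl
end

section
/- Let T be a tree. Then every cycle C of the Cartesian product P_2 × T is a nice cycle; that is, the induced subgraph of P_2 × T obtained by deleting the vertices of C has a perfect matching (where the empty graph is regarded as having a perfect matching). -/
open SimpleGraph

/-- Projection to `T` of a walk in the product that avoids the fibre over `t`. -/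
theorem exists_proj_walk {V : Type*} (T : SimpleGraph V) (t : V) {a b : Fin 2 × V}
    (q : (pathGraph 2 □ T).Walk a b) (h : ∀ x ∈ q.support, x.2 ≠ t) :
    ∃ w : T.Walk a.2 b.2, t ∉ w.support := by
  induction q with
  | nil => exact ⟨Walk.nil, by simpa using (h _ (by simp)).symm⟩
  | @cons a b c hab q ih =>
    obtain ⟨w, hw⟩ := ih (fun x hx => h x (by simp [hx]))
    rw [boxProd_adj] at hab
    rcases hab with ⟨_, he⟩ | ⟨ha, _⟩
    · rw [he]; exact ⟨w, hw⟩
    · refine ⟨Walk.cons ha w, ?_⟩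
      have := h a (by simp)
      simp only [Walk.support_cons, List.mem_cons, not_or]
      exact ⟨this.symm, hw⟩

theorem fin_two_eq_add_one : ∀ i j : Fin 2, i ≠ j → j = i + 1 := by decide

theorem fin_two_ne_add_one : ∀ i : Fin 2, i ≠ i + 1 := by decide

theorem pathGraph_two_adj_add_one : ∀ i : Fin 2, (pathGraph 2).Adj i (i + 1) := by
  intro i
  rw [pathGraph_two_eq_top, top_adj]
  exact fin_two_ne_add_one i

/-- If a cycle starts at `v`, then it also visits the other vertex of the fibre of `v`. -/
theorem other_mem_support {V : Type*} (T : SimpleGraph V) (hT : T.IsAcyclic)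
    (v : Fin 2 × V) (c : (pathGraph 2 □ T).Walk v v) (hc : c.IsCycle) :
    (v.1 + 1, v.2) ∈ c.support := by
  classical
  by_contra hn
  -- neighbours of `v` on the cycle lie in the same layer
  have key : ∀ u ∈ c.support, (pathGraph 2 □ T).Adj v u → T.Adj v.2 u.2 ∧ v.1 = u.1 := by
    intro u hu ha
    rw [boxProd_adj] at ha
    rcases ha with ⟨h1, h2⟩ | h
    · exfalso
      apply hn
      have := fin_two_eq_add_one _ _ h1.ne
      rw [← this, h2]
      exact hu
    · exact h
  cases c with
  | nil => exact hc.not_nil Walk.Nil.nil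
  | @cons _ w _ hvw p =>
    rw [Walk.cons_isCycle_iff] at hc
    obtain ⟨hp, he⟩ := hc
    obtain ⟨r, hr⟩ : ∃ r, r = p.reverse := ⟨_, rfl⟩
    have hrp : r.IsPath := hr ▸ hp.reverse
    have hre : s(v, w) ∉ r.edges := by rw [hr, Walk.edges_reverse]; simpa using he
    have hrs : ∀ x, x ∈ r.support → x ∈ p.support := by intro x; rw [hr]; simp
    clear hr
    cases r with
    | nil => exact hvw.ne rfl
    | @cons _ u _ hvu q =>
      rw [Walk.cons_isPath_iff] at hrp
      have huw : u ≠ w := by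
        rintro rfl
        simp at hre
      have hq : ∀ x ∈ q.support, x.2 ≠ v.2 := by
        intro x hx hxv
        have hx' : x ∈ p.support := hrs x (by simp [hx])
        by_cases h1 : v.1 = x.1
        · exact hrp.2 ((Prod.ext h1.symm hxv : x = v) ▸ hx)
        · apply hn
          rw [← fin_two_eq_add_one _ _ h1, ← hxv]
          simp [hx']
      obtain ⟨z, hz⟩ := exists_proj_walk T v.2 q hq
      obtain ⟨hu1, hu2⟩ := key u (by simp [hrs u (by simp)]) hvu
      obtain ⟨hw1, hw2⟩ := key w (by simp) hvw
      have hne : u.2 ≠ w.2 := fun h => huw (Prod.ext (hu2.symm.trans hw2) h)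
      have hP : (Walk.cons hu1.symm (Walk.cons hw1 Walk.nil)).IsPath := by
        simp [Walk.cons_isPath_iff, hu1.ne', hw1.ne, hne]
      have := hT.path_unique ⟨_, hP⟩ z.toPath
      have hs : v.2 ∈ (z.toPath : T.Walk u.2 w.2).support := by
        rw [← this]; simp
      exact hz (Walk.support_toPath_subset z hs)

theorem other_mem_support' {V : Type*} (T : SimpleGraph V) (hT : T.IsAcyclic)
    (v : Fin 2 × V) (c : (pathGraph 2 □ T).Walk v v) (hc : c.IsCycle)
    (x : Fin 2 × V) (hx : x ∈ c.support) : (x.1 + 1, x.2) ∈ c.support := by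
  classical
  have := other_mem_support T hT x (c.rotate x hx) (hc.rotate hx)
  simpa using this

/-- For a tree `T`, every cycle `C` of `P_2 × T` is nice: the induced subgraph
of `P_2 × T` on the vertices not in `C` has a perfect matching (vacuously, if it
is empty). -/
theorem cycle_of_p2_boxProd_tree_isNice {V : Type*} [Fintype V]
    (T : SimpleGraph V) (hT : T.IsTree)
    (v : Fin 2 × V) (c : (pathGraph 2 □ T).Walk v v) (hc : c.IsCycle) :
    ∃ M : ((pathGraph 2 □ T).induce {x | x ∉ c.support}).Subgraph,
      M.IsPerfectMatching := by
  have two : ∀ i : Fin 2, i + 1 + 1 = i := by decide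
  refine ⟨{ verts := Set.univ
            Adj := fun x y => y.1 = (x.1.1 + 1, x.1.2)
            adj_sub := ?_
            edge_vert := fun _ => Set.mem_univ _
            symm := ?_ }, ?_, fun _ => Set.mem_univ _⟩
  · rintro ⟨x, hx⟩ ⟨y, hy⟩ h
    simp only at h
    subst h
    rw [induce_adj, boxProd_adj]
    exact Or.inl ⟨pathGraph_two_adj_add_one _, rfl⟩
  · constructor
    rintro ⟨x, hx⟩ ⟨y, hy⟩ h
    simp only at h
    subst h
    simp [two]
  · rintro ⟨x, hx⟩ -
    refine ⟨⟨(x.1 + 1, x.2), ?_⟩, rfl, ?_⟩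
    · intro h
      have := other_mem_support' T hT.isAcyclic v c hc _ h
      simp only [two] at this
      exact hx this
    · rintro ⟨y, hy⟩ h
      exact Subtype.ext h
end

section
/- Let T be a tree and let M be the set of edges of P_2 × T joining the two copies of T, i.e., the edges of the form {(u, v), (u', v)} where {u, u'} is the edge of P_2 and v is a vertex of T. Then every cycle C of P_2 × T contains exactly two edges of M; consequently C consists of a path in one copy of T, the corresponding reversed path in the other copy, and two edges of M joining their endpoints. -/
open SimpleGraph

/-- Project a walk of the box product to the second factor. -/
theorem proj_walk_exists {V : Type*} (T : SimpleGraph V) {u v : Fin 2 × V}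
    (q : (pathGraph 2 □ T).Walk u v) :
    ∃ p : T.Walk u.2 v.2,
      (∀ x y, s(x, y) ∈ p.edges ↔ ∃ i : Fin 2, s((i, x), (i, y)) ∈ q.edges) ∧
      (∀ x, x ∈ p.support ↔ ∃ i : Fin 2, (i, x) ∈ q.support) := by
  induction q with
  | nil =>
    rename_i u
    refine ⟨Walk.nil, by simp, ?_⟩
    intro x
    simp only [Walk.support_nil, List.mem_singleton]
    constructor
    · rintro rfl
      exact ⟨u.1, rfl⟩
    · rintro ⟨i, h⟩
      rw [← h]
  | cons h q ih =>
    rename_i a b d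
    obtain ⟨a1, a2⟩ := a
    obtain ⟨b1, b2⟩ := b
    obtain ⟨p, hp1, hp2⟩ := ih
    rw [boxProd_adj] at h
    rcases h with ⟨h1, h2⟩ | ⟨h1, h2⟩
    · dsimp only at h1 h2
      subst h2
      refine ⟨p, ?_, ?_⟩
      · intro x y
        rw [hp1]
        have := h1.ne
        simp only [Walk.edges_cons, List.mem_cons, Sym2.eq_iff, Prod.mk.injEq]
        constructor
        · rintro ⟨i, hi⟩
          exact ⟨i, Or.inr hi⟩
        · rintro ⟨i, hi | hi⟩
          · grind
          · exact ⟨i, hi⟩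
      · intro x
        rw [hp2]
        simp only [Walk.support_cons, List.mem_cons, Prod.mk.injEq]
        constructor
        · rintro ⟨i, hi⟩
          exact ⟨i, Or.inr hi⟩
        · rintro ⟨i, ⟨rfl, rfl⟩ | hi⟩
          · exact ⟨b1, q.start_mem_support⟩
          · exact ⟨i, hi⟩
    · dsimp only at h1 h2
      subst h2
      refine ⟨Walk.cons h1 p, ?_, ?_⟩
      · intro x y
        simp only [Walk.edges_cons, List.mem_cons, hp1, Sym2.eq_iff, Prod.mk.injEq]
        constructor
        · rintro (hh | ⟨i, hi⟩)
          · refine ⟨a1, Or.inl ?_⟩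
            tauto
          · exact ⟨i, Or.inr hi⟩
        · rintro ⟨i, hi | hi⟩
          · left; tauto
          · right; exact ⟨i, hi⟩
      · intro x
        simp only [Walk.support_cons, List.mem_cons, hp2, Prod.mk.injEq]
        constructor
        · rintro (rfl | ⟨i, hi⟩)
          · exact ⟨a1, Or.inl ⟨rfl, rfl⟩⟩
          · exact ⟨i, Or.inr hi⟩
        · rintro ⟨i, ⟨rfl, rfl⟩ | hi⟩
          · left; rfl
          · right; exact ⟨i, hi⟩

/-- If a cycle uses one copy of an edge of the tree, it uses both copies. -/
theorem both_copies {V : Type*} (T : SimpleGraph V) (hT : T.IsTree)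
    (v : Fin 2 × V) (c : (pathGraph 2 □ T).Walk v v) (hc : c.IsCycle) (x y : V) (i : Fin 2)
    (h : s((i, x), (i, y)) ∈ c.edges) (j : Fin 2) : s((j, x), (j, y)) ∈ c.edges := by
  by_cases hij : j = i
  · rwa [hij]
  have hadj : (pathGraph 2 □ T).Adj (i, x) (i, y) := c.adj_of_mem_edges h
  have hTadj : T.Adj x y := by simpa using hadj
  let G' : SimpleGraph (Fin 2 × V) := fromEdgeSet {e | e ∈ c.edges}
  have hG' : ∀ e, e ∈ G'.edgeSet ↔ e ∈ c.edges := by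
    intro e
    simp only [G', edgeSet_fromEdgeSet, Set.mem_sdiff, Set.mem_ofPred_eq]
    constructor
    · exact fun h => h.1
    · exact fun h => ⟨h, (pathGraph 2 □ T).not_isDiag_of_mem_edgeSet (c.edges_subset_edgeSet h)⟩
  have hcyc := hc.transfer (H := G') (fun e he => (hG' e).2 he)
  have hnb : ¬ G'.IsBridge s((i, x), (i, y)) := fun hb =>
    hb.notMem_edges_of_isCycle hcyc (by rwa [Walk.edges_transfer])
  rw [isBridge_iff_forall_walk_mem_edges] at hnb
  push Not at hnb
  obtain ⟨q, hq⟩ := hnb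
  have hqc : ∀ e ∈ q.edges, e ∈ c.edges := fun e he => (hG' e).1 (q.edges_subset_edgeSet he)
  let q' := q.transfer (pathGraph 2 □ T) (fun e he => c.edges_subset_edgeSet (hqc e he))
  obtain ⟨p, hp, -⟩ := proj_walk_exists T q'
  have hbr := isAcyclic_iff_forall_adj_isBridge.1 hT.isAcyclic hTadj
  rw [isBridge_iff_forall_walk_mem_edges] at hbr
  obtain ⟨k, hk⟩ := (hp x y).1 (hbr p)
  rw [Walk.edges_transfer] at hk
  have hki : k ≠ i := by
    rintro rfl
    exact hq hk
  have : k = j := by omega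
  subst this
  exact hqc _ hk

/-- For a tree `T`, every cycle of `P_2 × T` contains exactly two of the edges
joining the two copies of `T`, i.e. edges of the form `{(0, w), (1, w)}`. -/
theorem cycle_of_p2_boxProd_tree_two_crossing_edges {V : Type*} [Fintype V]
    (T : SimpleGraph V) (hT : T.IsTree)
    (v : Fin 2 × V) (c : (pathGraph 2 □ T).Walk v v) (hc : c.IsCycle) :
    {e : Sym2 (Fin 2 × V) | e ∈ c.edges ∧
      ∃ w : V, e = s(((0 : Fin 2), w), ((1 : Fin 2), w))}.ncard = 2 := by
  classical
  obtain ⟨p, hp1, hp2⟩ := proj_walk_exists T c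
  have both := both_copies T hT v c hc
  -- classification of the edges of the cycle
  have cls : ∀ a b : Fin 2 × V, s(a, b) ∈ c.edges →
      (a.1 = b.1 ∧ T.Adj a.2 b.2) ∨ (a.1 ≠ b.1 ∧ a.2 = b.2) := by
    intro a b h
    have := c.adj_of_mem_edges h
    rw [boxProd_adj] at this
    rcases this with h | h
    · exact Or.inr ⟨h.1.ne, h.2⟩
    · exact Or.inl ⟨h.2, h.1⟩
  -- the support is closed under switching copies
  have supp : ∀ (i : Fin 2) (x : V), (i, x) ∈ c.support → ∀ j, (j, x) ∈ c.support := by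
    intro i x h j
    by_cases hij : j = i
    · rwa [hij]
    obtain ⟨e, he, hxe⟩ := (Walk.mem_support_iff_exists_mem_edges_of_not_nil hc.not_nil).1 h
    obtain ⟨⟨k, y⟩, rfl⟩ := Sym2.mem_iff_exists.1 hxe
    rcases cls _ _ he with ⟨h1, h2⟩ | ⟨h1, h2⟩
    · dsimp only at h1 h2
      subst h1
      exact c.fst_mem_support_of_mem_edges (both x y i he j)
    · dsimp only at h1 h2
      subst h2
      have : k = j := by omega
      subst this
      exact c.snd_mem_support_of_mem_edges he
  -- tree count
  have hcount : p.edges.toFinset.card + 1 = p.support.toFinset.card := by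
    have ht : p.toSubgraph.coe.IsTree :=
      ⟨p.toSubgraph_connected.coe, hT.isAcyclic.subgraph _⟩
    have h1 := ht.card_edgeFinset
    have h2 : Fintype.card p.toSubgraph.verts = p.support.toFinset.card := by
      rw [← Set.toFinset_card]
      congr 1
      ext x
      simp
    have h3 : p.toSubgraph.coe.edgeFinset.card = p.edges.toFinset.card := by
      have : p.edges.toFinset = p.toSubgraph.coe.edgeFinset.image (Sym2.map Subtype.val) := by
        ext e
        rw [List.mem_toFinset, ← Walk.mem_edges_toSubgraph, ← Subgraph.image_coe_edgeSet_coe]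
        simp
      rw [this, Finset.card_image_of_injective _ (Sym2.map.injective Subtype.val_injective)]
    omega
  -- the cycle has as many edges as vertices
  have hE : c.edges.toFinset.card = c.support.toFinset.card := by
    rw [List.toFinset_card_of_nodup hc.edges_nodup, Walk.length_edges]
    have : c.support.toFinset = c.support.tail.toFinset := by
      ext a
      simp only [List.mem_toFinset]
      refine ⟨fun h => ?_, List.mem_of_mem_tail⟩
      rcases c.mem_support_iff.1 h with rfl | h
      · exact Walk.end_mem_tail_support hc.not_nil
      · exact h
    rw [this, List.toFinset_card_of_nodup hc.support_nodup]
    simp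
  have hV : c.support.toFinset = (Finset.univ : Finset (Fin 2)) ×ˢ p.support.toFinset := by
    ext ⟨i, x⟩
    simp only [List.mem_toFinset, Finset.mem_product, Finset.mem_univ, true_and, hp2]
    exact ⟨fun h => ⟨i, h⟩, fun ⟨j, h⟩ => supp j x h i⟩
  set M : Finset (Sym2 (Fin 2 × V)) :=
    c.edges.toFinset.filter (fun e => ∃ w : V, e = s(((0 : Fin 2), w), ((1 : Fin 2), w))) with hM
  set f : Fin 2 × Sym2 V → Sym2 (Fin 2 × V) := fun z => z.2.map (fun x => (z.1, x)) with hf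
  have hfinj : Function.Injective f := by
    rintro ⟨i, e⟩ ⟨j, e'⟩
    induction e using Sym2.ind with | _ x y
    induction e' using Sym2.ind with | _ x' y'
    simp only [hf, Sym2.map_mk, Sym2.eq_iff, Prod.mk.injEq]
    tauto
  have hN : c.edges.toFinset.filter
      (fun e => ¬ ∃ w : V, e = s(((0 : Fin 2), w), ((1 : Fin 2), w))) =
      ((Finset.univ : Finset (Fin 2)) ×ˢ p.edges.toFinset).image f := by
    ext e
    simp only [Finset.mem_filter, List.mem_toFinset, Finset.mem_image, Finset.mem_product,
      Finset.mem_univ, true_and]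
    constructor
    · rintro ⟨he, hne⟩
      induction e using Sym2.ind with | _ a b
      obtain ⟨i, x⟩ := a
      obtain ⟨j, y⟩ := b
      rcases cls _ _ he with ⟨h1, h2⟩ | ⟨h1, h2⟩
      · dsimp only at h1 h2
        subst h1
        exact ⟨(i, s(x, y)), (hp1 x y).2 ⟨i, he⟩, rfl⟩
      · dsimp only at h1 h2
        subst h2
        refine absurd ⟨x, ?_⟩ hne
        have : (i = 0 ∧ j = 1) ∨ (i = 1 ∧ j = 0) := by omega
        rcases this with ⟨rfl, rfl⟩ | ⟨rfl, rfl⟩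
        · rfl
        · exact Sym2.eq_swap
    · rintro ⟨⟨i, e⟩, he, rfl⟩
      induction e using Sym2.ind with | _ x y
      obtain ⟨j, hj⟩ := (hp1 x y).1 he
      refine ⟨both x y j hj i, ?_⟩
      rintro ⟨w, hw⟩
      simp only [hf, Sym2.map_mk, Sym2.eq_iff, Prod.mk.injEq] at hw
      rcases hw with hw | hw <;> omega
  have hsplit := Finset.card_filter_add_card_filter_not (s := c.edges.toFinset)
    (fun e => ∃ w : V, e = s(((0 : Fin 2), w), ((1 : Fin 2), w)))
  rw [hN, Finset.card_image_of_injective _ hfinj, Finset.card_product, hE, hV,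
    Finset.card_product, Finset.card_univ, Fintype.card_fin, ← hcount] at hsplit
  have hset : {e : Sym2 (Fin 2 × V) | e ∈ c.edges ∧
      ∃ w : V, e = s(((0 : Fin 2), w), ((1 : Fin 2), w))} = (M : Set (Sym2 (Fin 2 × V))) := by
    ext e
    simp [hM]
  rw [hset, Set.ncard_coe_finset]
  have hMc : M.card + 2 * p.edges.toFinset.card = 2 * (p.edges.toFinset.card + 1) := by
    convert hsplit
  omega
end

section
/- Let T be a tree on n vertices, let T^e be an arbitrary orientation of T, let A(T) be the adjacency matrix of T and A(T^e) the skew adjacency matrix of T^e, both regarded as complex matrices. Then for every real number θ and natural number m, θ is an eigenvalue of A(T) with multiplicity m (as a root of the characteristic polynomial) if and only if iθ is an eigenvalue of A(T^e) with multiplicity m, where i² = −1. -/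
open SimpleGraph Polynomial

/-- Product of the weights `-i S u v` along a walk. -/
noncomputable def walkWeight {V : Type*} {T : SimpleGraph V} (S : Matrix V V ℤ) :
    {u v : V} → T.Walk u v → ℂ
  | _, _, .nil => 1
  | _, _, .cons (u := u) (v := v) _ p => (-Complex.I * (S u v : ℂ)) * walkWeight S p

lemma walkWeight_ne_zero {V : Type*} {T : SimpleGraph V} (S : Matrix V V ℤ)
    (hadj : ∀ u v, T.Adj u v → S u v = 1 ∨ S u v = -1) {u v : V} (p : T.Walk u v) :
    walkWeight S p ≠ 0 := by
  induction p with
  | nil => simp [walkWeight]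
  | cons h p ih =>
    rcases hadj _ _ h with h1 | h1 <;> simp [walkWeight, h1, ih]

lemma exists_potential {V : Type*} (T : SimpleGraph V) (hT : T.IsTree) (S : Matrix V V ℤ)
    (hskew : ∀ u v, S v u = - S u v)
    (hadj : ∀ u v, T.Adj u v → S u v = 1 ∨ S u v = -1) :
    ∃ d : V → ℂ, (∀ v, d v ≠ 0) ∧
      ∀ u v, T.Adj u v → d u * Complex.I = (S u v : ℂ) * d v := by
  classical
  obtain ⟨⟨r⟩, hex⟩ := isTree_iff_existsUnique_path.mp hT
  choose p hp hu using fun v => hex v r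
  refine ⟨fun v => walkWeight S (p v), fun v => walkWeight_ne_zero S hadj _, ?_⟩
  have key : ∀ u v, T.Adj u v → u ∉ (p v).support →
      walkWeight S (p u) = (-Complex.I * (S u v : ℂ)) * walkWeight S (p v) := by
    intro u v h hn
    rw [← hu u (.cons h (p v)) ((hp v).cons hn)]
    rfl
  intro u v h
  have hI := Complex.I_mul_I
  by_cases hn : u ∈ (p v).support
  · have hv : v ∉ (p u).support := by
      have := hT.isAcyclic.ne_mem_support_of_support_of_adj_of_isPath
        (hp v).reverse (hp u).reverse h.symm (by simpa using hn)
      simpa using this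
    have e := key v u h.symm hv
    rw [hskew u v] at e
    simp only
    rw [e]
    rcases hadj _ _ h with h1 | h1 <;> rw [h1] <;> push_cast <;> ring
  · simp only
    rw [key u v h hn]
    linear_combination (-(S u v : ℂ) * walkWeight S (p v)) * hI

lemma charpoly_I_smul {V : Type*} [Fintype V] [DecidableEq V] (A : Matrix V V ℂ) :
    (Complex.I • A).charpoly = A.charpoly.scaleRoots Complex.I := by
  apply Polynomial.funext
  intro x
  obtain ⟨y, rfl⟩ : ∃ y, x = Complex.I * y :=
    ⟨-Complex.I * x, by linear_combination x * Complex.I_mul_I⟩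
  rw [scaleRoots_eval_mul, Matrix.eval_charpoly, Matrix.eval_charpoly,
    Matrix.charpoly_natDegree_eq_dim, ← Matrix.det_smul]
  congr 1
  ext i j
  by_cases hij : i = j <;> simp [hij, mul_sub, Matrix.scalar_apply]

/-- Let `T` be a tree with adjacency matrix `A(T)` and let `S` be the skew
adjacency matrix of an arbitrary orientation of `T` (a skew-symmetric integer
matrix with entries `±1` on adjacent pairs and `0` elsewhere).  Then a real
number `θ` is an eigenvalue of `A(T)` with multiplicity `m` iff `iθ` is an
eigenvalue of `S` with multiplicity `m`. -/
theorem skew_adj_eigenvalues_of_tree {V : Type*} [Fintype V] [DecidableEq V]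
    (T : SimpleGraph V) [DecidableRel T.Adj] (hT : T.IsTree)
    (S : Matrix V V ℤ)
    (hskew : ∀ u v, S v u = - S u v)
    (hadj : ∀ u v, T.Adj u v → S u v = 1 ∨ S u v = -1)
    (hnadj : ∀ u v, ¬ T.Adj u v → S u v = 0)
    (θ : ℝ) (m : ℕ) :
    ((T.adjMatrix ℂ).charpoly.rootMultiplicity (θ : ℂ) = m) ↔
      ((S.map (fun z : ℤ => (z : ℂ))).charpoly.rootMultiplicity
        (Complex.I * θ) = m) := by
  obtain ⟨d, hd0, hd⟩ := exists_potential T hT S hskew hadj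
  have hS : S.map (fun z : ℤ => (z : ℂ)) =
      Matrix.diagonal d * ((Complex.I • T.adjMatrix ℂ) * Matrix.diagonal (fun v => (d v)⁻¹)) := by
    ext u v
    rw [Matrix.diagonal_mul, Matrix.mul_diagonal]
    by_cases h : T.Adj u v
    · have := hd u v h
      have h0 := hd0 v
      simp only [Matrix.map_apply, Matrix.smul_apply, adjMatrix_apply, h, if_true, smul_eq_mul,
        mul_one]
      field_simp
      linear_combination -this
    · simp [h, hnadj u v h]
  have hc : (S.map (fun z : ℤ => (z : ℂ))).charpoly =
      (T.adjMatrix ℂ).charpoly.scaleRoots Complex.I := by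
    rw [hS, Matrix.charpoly_mul_comm, Matrix.mul_assoc, Matrix.diagonal_mul_diagonal,
      ← charpoly_I_smul]
    simp [hd0]
  rw [hc, rootMultiplicity_scaleRoots _ (isUnit_iff_ne_zero.mpr Complex.I_ne_zero).isRegular.left]
end

section
/- Let T be a tree on n vertices and let r be the maximum number of edges in a matching of T. Then the characteristic polynomial of the adjacency matrix A(T) satisfies det(xI − A(T)) = ∑_{i=0}^{r} (−1)^i a_i x^{n−2i}, where a_0 = 1 and, for 1 ≤ i ≤ r, a_i is the number of induced subgraphs of T on 2i vertices that have a perfect matching. -/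
open SimpleGraph Polynomial

lemma acyc_sep {V : Type*} [Fintype V] [DecidableEq V] (G : SimpleGraph V) (hG : G.IsAcyclic)
    {a b : V} (hab : G.Adj a b) :
    ∃ C : Finset V, a ∈ C ∧ b ∉ C ∧ ∀ x y, G.Adj x y → x ∈ C → y ∉ C → x = a ∧ y = b := by
  classical
  have hb : ¬ (G.deleteEdges {s(a, b)}).Reachable a b :=
    isBridge_iff.mp (isAcyclic_iff_forall_isBridge.mp hG hab)
  refine ⟨Finset.univ.filter (fun x => (G.deleteEdges {s(a, b)}).Reachable a x), by simp,
    by simpa using hb, ?_⟩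
  intro x y hxy hx hy
  simp only [Finset.mem_filter, Finset.mem_univ, true_and] at hx hy
  by_cases he : s(x, y) = s(a, b)
  · rcases Sym2.eq_iff.mp he with h | ⟨rfl, rfl⟩
    · exact h
    · exact absurd hx hb
  · exfalso
    apply hy
    refine hx.trans (Adj.reachable ?_)
    rw [deleteEdges_adj]
    exact ⟨hxy, by simpa using he⟩

lemma acyc_invol {V : Type*} [Fintype V] [DecidableEq V] (G : SimpleGraph V) (hG : G.IsAcyclic)
    (σ : Equiv.Perm V) (hσ : ∀ i, G.Adj (σ i) i) (a : V) : σ (σ a) = a := by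
  obtain ⟨C, ha, hb, hC⟩ := acyc_sep G hG (hσ a).symm
  by_cases h : ∀ c ∈ C, σ.symm c ∈ C
  · exfalso
    have h1 : C.map σ.symm.toEmbedding ⊆ C := by
      intro x hx
      obtain ⟨c, hc, rfl⟩ := Finset.mem_map.mp hx
      exact h c hc
    have h2 := Finset.eq_of_subset_of_card_le h1 (by simp)
    rw [← h2] at ha
    obtain ⟨c, hc, hca⟩ := Finset.mem_map.mp ha
    have : c = σ a := by rw [← hca]; simp
    exact hb (this ▸ hc)
  · push Not at h
    obtain ⟨c, hc, hc'⟩ := h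
    have hadj : G.Adj c (σ.symm c) := by simpa using hσ (σ.symm c)
    obtain ⟨h1, h2⟩ := hC _ _ hadj hc hc'
    rw [← h2, Equiv.apply_symm_apply, h1]

lemma even_card_invol {V : Type*} (C : Finset V) (σ : V → V) (h1 : ∀ x, σ x ≠ x)
    (h2 : ∀ x, σ (σ x) = x) (h3 : ∀ x ∈ C, σ x ∈ C) : Even C.card := by
  have : ∑ x ∈ C, (1 : ZMod 2) = 0 :=
    Finset.sum_involution (fun a _ => σ a) (fun _ _ => by decide) (fun a _ _ => h1 a)
      (fun a ha => h3 a ha) (fun a _ => h2 a)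
  rw [Finset.sum_const, nsmul_eq_mul, mul_one] at this
  exact (ZMod.natCast_eq_zero_iff_even).mp this

lemma acyc_unique {V : Type*} [Fintype V] [DecidableEq V] (G : SimpleGraph V) (hG : G.IsAcyclic)
    (σ τ : Equiv.Perm V) (hσ : ∀ i, G.Adj (σ i) i) (hτ : ∀ i, G.Adj (τ i) i) : σ = τ := by
  ext a
  by_contra hne
  have iσ := acyc_invol G hG σ hσ
  have iτ := acyc_invol G hG τ hτ
  obtain ⟨C, ha, hb, hC⟩ := acyc_sep G hG (hσ a).symm
  have e1 : Even C.card := by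
    refine even_card_invol C τ (fun x => (hτ x).ne) iτ (fun x hx => ?_)
    by_contra hx'
    obtain ⟨rfl, h⟩ := hC _ _ (hτ x).symm hx hx'
    exact hne h.symm
  have e2 : Even (C.erase a).card := by
    refine even_card_invol _ σ (fun x => (hσ x).ne) iσ (fun x hx => ?_)
    obtain ⟨hxa, hx⟩ := Finset.mem_erase.mp hx
    refine Finset.mem_erase.mpr ⟨fun h => ?_, ?_⟩
    · apply hb
      rw [← h, iσ]; exact hx
    · by_contra hx'
      exact hxa (hC _ _ (hσ x).symm hx hx').1
  rw [Finset.card_erase_of_mem ha] at e2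
  have : 0 < C.card := Finset.card_pos.mpr ⟨a, ha⟩
  rcases e1 with ⟨k, hk⟩
  rcases e2 with ⟨l, hl⟩
  omega

lemma sign_invol {V : Type*} [Fintype V] [DecidableEq V] (σ : Equiv.Perm V)
    (h1 : ∀ x, σ x ≠ x) (h2 : ∀ x, σ (σ x) = x) (i : ℕ) (hi : Fintype.card V = 2 * i) :
    Equiv.Perm.sign σ = (-1) ^ i := by
  have hp : σ ^ 2 = 1 := by
    ext x
    simp [pow_two, h2]
  have hc := Equiv.Perm.cycleType_of_pow_prime_eq_one (p := 2) hp
  have hs : σ.cycleType.sum = 2 * i := by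
    rw [Equiv.Perm.sum_cycleType, ← hi, ← Finset.card_univ]
    congr 1
    ext x
    simp [h1]
  have hcard : σ.cycleType.card = i := by
    rw [hc, Multiset.sum_replicate, smul_eq_mul] at hs
    omega
  rw [Equiv.Perm.sign_of_cycleType, hs, hcard, pow_add, pow_mul]
  simp

lemma exists_pm_iff {V : Type*} [Fintype V] [DecidableEq V] (G : SimpleGraph V)
    (hG : G.IsAcyclic) :
    (∃ M : G.Subgraph, M.IsPerfectMatching) ↔ ∃ σ : Equiv.Perm V, ∀ i, G.Adj (σ i) i := by
  constructor
  · rintro ⟨M, hM⟩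
    rw [Subgraph.isPerfectMatching_iff] at hM
    choose f hf hu using hM
    have hf' : Function.Involutive f := fun x => (hu (f x) x (hf x).symm).symm
    exact ⟨hf'.toPerm, fun i => (hf i).adj_sub.symm⟩
  · rintro ⟨σ, hσ⟩
    have iσ := acyc_invol G hG σ hσ
    refine ⟨{
      verts := Set.univ
      Adj := fun x y => σ x = y
      adj_sub := ?_
      edge_vert := ?_
      symm := ?_ }, ?_⟩
    · rintro x y rfl
      exact (hσ x).symm
    · intros; trivial
    · refine ⟨?_⟩
      rintro x y rfl
      exact iσ x
    · rw [Subgraph.isPerfectMatching_iff]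
      intro v
      exact ⟨σ v, rfl, fun y h => Eq.symm h⟩

lemma det_adj_acyc {V : Type*} [Fintype V] [DecidableEq V] (G : SimpleGraph V)
    [DecidableRel G.Adj] (hG : G.IsAcyclic) (i : ℕ) (hi : Fintype.card V = 2 * i)
    (h : ∃ M : G.Subgraph, M.IsPerfectMatching) : (G.adjMatrix ℤ).det = (-1) ^ i := by
  obtain ⟨σ, hσ⟩ := (exists_pm_iff G hG).mp h
  rw [Matrix.det_apply, Finset.sum_eq_single σ]
  · rw [sign_invol σ (fun x => (hσ x).ne) (acyc_invol G hG σ hσ) i hi, Finset.prod_eq_one]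
    · simp [Units.smul_def]
    · intro x _
      simp [hσ x]
  · intro τ _ hne
    have : ∃ x, ¬ G.Adj (τ x) x := by
      by_contra! hc
      exact hne (acyc_unique G hG τ σ hc hσ)
    obtain ⟨x, hx⟩ := this
    rw [Finset.prod_eq_zero (Finset.mem_univ x) (by simp [hx]), smul_zero]
  · simp

lemma det_adj_zero {V : Type*} [Fintype V] [DecidableEq V] (G : SimpleGraph V)
    [DecidableRel G.Adj] (hG : G.IsAcyclic)
    (h : ¬ ∃ M : G.Subgraph, M.IsPerfectMatching) : (G.adjMatrix ℤ).det = 0 := by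
  rw [exists_pm_iff G hG] at h
  push Not at h
  rw [Matrix.det_apply]
  refine Finset.sum_eq_zero fun τ _ => ?_
  obtain ⟨x, hx⟩ := h τ
  rw [Finset.prod_eq_zero (Finset.mem_univ x) (by simp [hx]), smul_zero]

lemma pm_edges {V : Type*} [Fintype V] (G : SimpleGraph V) (M : G.Subgraph)
    (hM : M.IsPerfectMatching) (i : ℕ) (hi : Fintype.card V = 2 * i) :
    M.edgeSet.ncard = i := by
  classical
  have h := M.spanningCoe.sum_degrees_eq_twice_card_edges
  have hd : ∀ v, M.spanningCoe.degree v = 1 := by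
    intro v
    rw [Subgraph.degree_spanningCoe]
    exact Subgraph.isPerfectMatching_iff_forall_degree.mp hM v
  simp only [hd, Finset.sum_const, Finset.card_univ, hi, smul_eq_mul, mul_one] at h
  have : M.edgeSet = (M.spanningCoe.edgeFinset : Set (Sym2 V)) := by
    simp
  rw [this, Set.ncard_coe_finset]
  omega

theorem charpoly_adjMatrix_tree {V : Type*} [Fintype V] [DecidableEq V]
    (T : SimpleGraph V) [DecidableRel T.Adj] (hT : T.IsTree)
    (n r : ℕ) (hn : Fintype.card V = n)
    (hr : IsGreatest {k | ∃ M : T.Subgraph, M.IsMatching ∧ M.edgeSet.ncard = k} r)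
    (a : ℕ → ℕ)
    (ha : ∀ i, a i = {s : Finset V | s.card = 2 * i ∧
        ∃ M : (T.induce (s : Set V)).Subgraph, M.IsPerfectMatching}.ncard) :
    (T.adjMatrix ℤ).charpoly =
      ∑ i ∈ Finset.range (r + 1), (-1) ^ i * (a i : Polynomial ℤ) * X ^ (n - 2 * i) := by
  classical
  have hac := hT.isAcyclic
  have sub : ∀ s : Finset V, ((T.adjMatrix ℤ).submatrix (Subtype.val : s → V)
      (Subtype.val : s → V)).det = ((T.induce (s : Set V)).adjMatrix ℤ).det := by
    intro s
    rfl
  have hzero : ∀ i, r < i → a i = 0 := by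
    intro i hi
    rw [ha, Set.ncard_eq_zero, Set.eq_empty_iff_forall_notMem]
    rintro s ⟨hs, M, hM⟩
    have h1 : M.edgeSet.ncard = i := pm_edges _ M hM i (by simpa using hs)
    have h2 := hr.2 ⟨M.map (Embedding.induce (G := T) (s : Set V)).toHom,
      hM.1.map _ (Embedding.induce (G := T) (s : Set V)).injective, rfl⟩
    have hinj : Function.Injective (Embedding.induce (G := T) (s : Set V)).toHom :=
      (Embedding.induce (G := T) (s : Set V)).injective
    rw [Subgraph.edgeSet_map, Set.ncard_image_of_injective _ (Sym2.map.injective hinj)] at h2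
    omega
  have hbig : ∀ i, n < 2 * i → a i = 0 := by
    intro i hi
    rw [ha, Set.ncard_eq_zero, Set.eq_empty_iff_forall_notMem]
    rintro s ⟨hs, -⟩
    have := s.card_le_univ
    omega
  have hcoef : ∀ i, 2 * i ≤ n → (T.adjMatrix ℤ).charpoly.coeff (n - 2 * i) = (-1) ^ i * a i := by
    intro i hi
    rw [← hn, Matrix.charpoly_coeff_eq_sum_minors _ _ (hn ▸ hi), pow_mul, neg_one_sq, one_pow,
      one_mul, ha]
    have : {s : Finset V | s.card = 2 * i ∧
        ∃ M : (T.induce (s : Set V)).Subgraph, M.IsPerfectMatching} =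
        (((Finset.univ : Finset V).powersetCard (2 * i)).filter (fun s : Finset V =>
          ∃ M : (T.induce (s : Set V)).Subgraph, M.IsPerfectMatching) : Set (Finset V)) := by
      ext s
      simp [Finset.mem_powersetCard]
    rw [this, Set.ncard_coe_finset, Finset.card_filter, Nat.cast_sum, Finset.mul_sum]
    refine Finset.sum_congr rfl fun s hs => ?_
    rw [sub]
    have hsc := (Finset.mem_powersetCard.mp hs).2
    split_ifs with h
    · rw [det_adj_acyc _ (hac.induce _) i (by simpa using hsc) h]; simp
    · rw [det_adj_zero _ (hac.induce _) h]; simp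
  have hodd : ∀ k, k ≤ n → ¬ Even k → (T.adjMatrix ℤ).charpoly.coeff (n - k) = 0 := by
    intro k hk ho
    rw [← hn, Matrix.charpoly_coeff_eq_sum_minors _ _ (hn ▸ hk)]
    rw [Finset.sum_eq_zero, mul_zero]
    intro s hs
    rw [sub]
    have hsc := (Finset.mem_powersetCard.mp hs).2
    refine det_adj_zero _ (hac.induce _) ?_
    rintro ⟨M, hM⟩
    apply ho
    have := hM.even_card
    rw [← hsc]
    simpa using this
  have hterm : ∀ i j, ((-1) ^ i * (a i : Polynomial ℤ) * X ^ (n - 2 * i)).coeff j =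
      if j = n - 2 * i then (-1) ^ i * (a i : ℤ) else 0 := by
    intro i j
    have : ((-1) ^ i * (a i : Polynomial ℤ)) = C ((-1) ^ i * (a i : ℤ)) := by simp
    rw [this, coeff_C_mul_X_pow]
  ext j
  rw [finsetSum_coeff]
  simp only [hterm]
  by_cases hj : n < j
  · rw [coeff_eq_zero_of_natDegree_lt (by rw [Matrix.charpoly_natDegree_eq_dim]; omega)]
    symm
    refine Finset.sum_eq_zero fun i _ => ?_
    rw [if_neg (by omega)]
  · obtain ⟨k, hk, rfl⟩ : ∃ k, k ≤ n ∧ j = n - k := ⟨n - j, by omega, by omega⟩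
    by_cases he : Even k
    · obtain ⟨i, rfl⟩ := even_iff_exists_two_mul.mp he
      rw [hcoef i hk, Finset.sum_eq_single i]
      · simp
      · intro l _ hl
        split_ifs with h
        · rw [hbig l (by omega)]; simp
        · rfl
      · intro h
        rw [hzero i (by simpa using h)]
        simp
    · rw [hodd k hk he]
      symm
      refine Finset.sum_eq_zero fun i _ => ?_
      split_ifs with h
      · rw [hbig i (by
          by_contra hc
          exact he ⟨i, by omega⟩)]
        simp
      · rfl
end

section
/- Let T be a tree on n vertices, let r be the maximum number of edges in a matching of T, and let T^e be an arbitrary orientation of T with skew adjacency matrix A(T^e). Then det(xI − A(T^e)) = ∑_{i=0}^{r} a_i x^{n−2i}, where a_0 = 1 and, for 1 ≤ i ≤ r, a_i is the number of induced subgraphs of T on 2i vertices that have a perfect matching. -/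
open SimpleGraph Polynomial

namespace SkewTree

universe u

def HasPM {V : Type u} (T : SimpleGraph V) : Prop :=
  ∃ f : V → V, ∀ v, T.Adj v (f v) ∧ f (f v) = v

lemma hasPM_iff {V : Type u} (T : SimpleGraph V) :
    (∃ M : T.Subgraph, M.IsPerfectMatching) ↔ HasPM T := by
  constructor
  · rintro ⟨M, hM⟩
    rw [Subgraph.isPerfectMatching_iff] at hM
    choose f hf hu using hM
    exact ⟨f, fun v => ⟨(hf v).adj_sub, (hu (f v) v (hf v).symm).symm⟩⟩
  · rintro ⟨f, hf⟩
    refine ⟨{ verts := Set.univ, Adj := fun a b => b = f a, adj_sub := ?_, edge_vert := ?_,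
              symm := ?_ }, ?_⟩
    · rintro a b rfl; exact (hf a).1
    · intros; trivial
    · refine ⟨?_⟩
      rintro a b rfl; exact (hf a).2.symm
    · rw [Subgraph.isPerfectMatching_iff]
      intro v
      exact ⟨f v, rfl, fun y hy => hy⟩

lemma exists_leaf {V : Type u} [Fintype V] [Nonempty V] (T : SimpleGraph V)
    (hT : T.IsAcyclic) : ∃ v w : V, ∀ x, T.Adj v x → x = w := by
  classical
  let P : ℕ → Prop := fun k => ∃ (u v : V) (p : T.Walk u v), p.IsPath ∧ p.length = k
  have hP : P (Nat.findGreatest P (Fintype.card V)) := by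
    obtain ⟨v⟩ := ‹Nonempty V›
    exact Nat.findGreatest_spec (P := P) (m := 0) (Nat.zero_le _)
      ⟨v, v, Walk.nil, Walk.IsPath.nil, rfl⟩
  obtain ⟨u, v, p, hp, hl⟩ := hP
  refine ⟨u, p.snd, fun x hx => ?_⟩
  by_cases hs : x ∈ p.support
  · exact hT.eq_snd_of_adj_start hp hx hs
  · exfalso
    have hq : (Walk.cons hx.symm p).IsPath := hp.cons hs
    have := Nat.le_findGreatest (P := P) (le_of_lt hq.length_lt) ⟨_, _, _, hq, rfl⟩
    rw [Walk.length_cons] at this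
    omega

lemma det_leaf {V : Type u} [Fintype V] [DecidableEq V] (S : Matrix V V ℤ)
    (hskew : ∀ u v, S v u = - S u v) (v w : V) (hvw : v ≠ w)
    (h1 : S v w = 1 ∨ S v w = -1) (h0 : ∀ x, x ≠ w → S v x = 0) :
    S.det = (S.submatrix (Subtype.val : {x // ¬ (x = v ∨ x = w)} → V) Subtype.val).det := by
  let M : Matrix V V ℤ := fun i j => if j = w ∧ i ≠ v then 0 else S i j
  have hM : S.det = M.det := by
    rw [Matrix.det_apply, Matrix.det_apply, ← Equiv.sum_comp (Equiv.inv (Equiv.Perm V)),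
      ← Equiv.sum_comp (Equiv.inv (Equiv.Perm V))
        (fun σ : Equiv.Perm V => Equiv.Perm.sign σ • ∏ i, M (σ i) i)]
    refine Finset.sum_congr rfl fun σ _ => ?_
    congr 1
    simp only [Equiv.inv_apply]
    by_cases h : σ⁻¹ w = v
    · refine Finset.prod_congr rfl fun i _ => ?_
      have : ¬ (i = w ∧ σ⁻¹ i ≠ v) := by
        rintro ⟨rfl, h'⟩; exact h' h
      simp only [M, if_neg this]
    · have hz : σ v ≠ w := fun hh => h (by rw [← hh]; simp)
      rw [Finset.prod_eq_zero (Finset.mem_univ (σ v)), Finset.prod_eq_zero (Finset.mem_univ (σ v))]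
      · simp [M, h0 _ hz]
      · simp [h0 _ hz]
  rw [hM, Matrix.twoBlockTriangular_det M (fun x => x = v ∨ x = w)]
  · have h2 : (M.toSquareBlockProp (fun x => x = v ∨ x = w)).det = 1 := by
      let e : Fin 2 ≃ {x // x = v ∨ x = w} := Equiv.ofBijective
        ![⟨v, Or.inl rfl⟩, ⟨w, Or.inr rfl⟩] (by
          constructor
          · intro i j
            fin_cases i <;> fin_cases j <;> simp [hvw, hvw.symm]
          · rintro ⟨x, rfl | rfl⟩
            · exact ⟨0, rfl⟩
            · exact ⟨1, rfl⟩)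
      rw [← Matrix.det_submatrix_equiv_self e, Matrix.det_fin_two]
      have e0 : (e 0 : V) = v := rfl
      have e1 : (e 1 : V) = w := rfl
      change M (e 0) (e 0) * M (e 1) (e 1) - M (e 0) (e 1) * M (e 1) (e 0) = 1
      simp only [e0, e1, M]
      have hw := hskew v w
      rcases h1 with h | h <;> simp [h, hvw, hvw.symm, hw]
    rw [h2, one_mul]
    congr 1
    ext i j
    have hj : ¬ ((j : V) = w ∧ (i : V) ≠ v) := fun h => j.2 (Or.inr h.1)
    change M i j = S i j
    simp only [M, if_neg hj]
  · rintro i hi j hj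
    push Not at hi
    by_cases hjw : j = w
    · simp [M, hjw, hi.1]
    · have hjv : j = v := hj.resolve_right hjw
      subst hjv
      simp [M, hjw, hskew j i, h0 i hi.2]

lemma hasPM_leaf {V : Type u} (T : SimpleGraph V) (v w : V)
    (hvw : T.Adj v w) (hx : ∀ x, T.Adj v x → x = w) :
    HasPM T ↔ HasPM (T.comap (Subtype.val : {x // ¬ (x = v ∨ x = w)} → V)) := by
  classical
  constructor
  · rintro ⟨f, hf⟩
    have hv : f v = w := hx _ (hf v).1
    have hw : f w = v := by rw [← hv, (hf v).2]
    refine ⟨fun x => ⟨f x, ?_⟩, fun x => ⟨(hf x).1, Subtype.ext (hf x).2⟩⟩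
    rintro (h | h)
    · exact x.2 (Or.inr (by rw [← (hf x).2, h, hv]))
    · exact x.2 (Or.inl (by rw [← (hf x).2, h, hw]))
  · rintro ⟨f, hf⟩
    refine ⟨fun x => if h : x = v ∨ x = w then (if x = v then w else v) else f ⟨x, h⟩, fun x => ?_⟩
    have hne := hvw.ne
    by_cases h1 : x = v
    · subst h1; simp [hvw, hne.symm]
    by_cases h2 : x = w
    · subst h2; simp [hvw.symm, h1]
    have h : ¬ (x = v ∨ x = w) := by tauto
    have := hf ⟨x, h⟩
    have h3 := (f ⟨x, h⟩).2
    simp only [dif_neg h, dif_neg h3, this.2, and_true]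
    exact this.1

open Classical in
lemma det_forest (n : ℕ) : ∀ {V : Type u} [Fintype V] [DecidableEq V]
    (_ : Fintype.card V = n)
    (T : SimpleGraph V) (_ : T.IsAcyclic) (S : Matrix V V ℤ)
    (_ : ∀ u v, S v u = - S u v)
    (_ : ∀ u v, T.Adj u v → S u v = 1 ∨ S u v = -1)
    (_ : ∀ u v, ¬ T.Adj u v → S u v = 0),
    S.det = if HasPM T then 1 else 0 := by
  induction n using Nat.strong_induction_on with
  | _ n ih =>
  intro V _ _ hn T hT S hskew hadj hnadj
  rcases isEmpty_or_nonempty V with hV | hV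
  · rw [Matrix.det_isEmpty, if_pos]
    exact ⟨id, fun v => hV.elim v⟩
  obtain ⟨v, w, hx⟩ := exists_leaf T hT
  by_cases hvw : T.Adj v w
  · rw [det_leaf S hskew v w hvw.ne (hadj _ _ hvw)
      (fun x hxw => hnadj _ _ fun h => hxw (hx x h))]
    have := ih (Fintype.card {x // ¬ (x = v ∨ x = w)})
      (by rw [← hn]; exact Fintype.card_subtype_lt (x := v) (by simp)) rfl
      (T.comap (Subtype.val : {x // ¬ (x = v ∨ x = w)} → V))
      (hT.of_comap (Function.Embedding.subtype _))
      (S.submatrix Subtype.val Subtype.val)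
      (fun a b => hskew a b) (fun a b h => hadj a b h) (fun a b h => hnadj a b h)
    rw [this]
    simp only [hasPM_leaf T v w hvw hx]
  · have hno : ∀ x, ¬ T.Adj v x := fun x h => hvw (hx x h ▸ h)
    rw [Matrix.det_eq_zero_of_row_eq_zero v (fun j => hnadj _ _ (hno j)), if_neg]
    rintro ⟨f, hf⟩
    exact hno _ (hf v).1

lemma matching_of_pm {V : Type u} [Fintype V] (T : SimpleGraph V) (s : Finset V)
    (h : ∃ M : (T.induce (s : Set V)).Subgraph, M.IsPerfectMatching) :
    ∃ M : T.Subgraph, M.IsMatching ∧ 2 * M.edgeSet.ncard = s.card := by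
  classical
  obtain ⟨M, hM⟩ := h
  refine ⟨M.map (Embedding.induce (s : Set V)).toHom, hM.1.map _ Subtype.val_injective, ?_⟩
  rw [Subgraph.edgeSet_map, Set.ncard_image_of_injective _
    (Sym2.map.injective (f := (Embedding.induce (s : Set V)).toHom) Subtype.val_injective),
    ← Subgraph.edgeSet_spanningCoe]
  have h1 := M.spanningCoe.sum_degrees_eq_twice_card_edges
  rw [Subgraph.isPerfectMatching_iff_forall_degree] at hM
  rw [← coe_edgeFinset, Set.ncard_coe_finset, ← h1]
  simp [hM]

end SkewTree

/-- Let `T` be a tree on `n` vertices, `r` the maximum size of a matching of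
`T`, and `S` the skew adjacency matrix of an arbitrary orientation of `T`.
Then `det(xI − S) = ∑_{i=0}^r a_i x^{n−2i}`, where `a_i` is the number of
induced subgraphs of `T` on `2i` vertices having a perfect matching
(in particular `a_0 = 1`). -/
theorem charpoly_skew_adjMatrix_tree {V : Type*} [Fintype V] [DecidableEq V]
    (T : SimpleGraph V) [DecidableRel T.Adj] (hT : T.IsTree)
    (n r : ℕ) (hn : Fintype.card V = n)
    (hr : IsGreatest {k | ∃ M : T.Subgraph, M.IsMatching ∧ M.edgeSet.ncard = k} r)
    (S : Matrix V V ℤ)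
    (hskew : ∀ u v, S v u = - S u v)
    (hadj : ∀ u v, T.Adj u v → S u v = 1 ∨ S u v = -1)
    (hnadj : ∀ u v, ¬ T.Adj u v → S u v = 0)
    (a : ℕ → ℕ)
    (ha : ∀ i, a i = {s : Finset V | s.card = 2 * i ∧
        ∃ M : (T.induce (s : Set V)).Subgraph, M.IsPerfectMatching}.ncard) :
    S.charpoly =
      ∑ i ∈ Finset.range (r + 1), (a i : Polynomial ℤ) * X ^ (n - 2 * i) := by
  classical
  have ha' : ∀ i, a i = (((Finset.univ : Finset V).powersetCard (2 * i)).filter (fun s : Finset V =>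
      ∃ M : (T.induce (s : Set V)).Subgraph, M.IsPerfectMatching)).card := by
    intro i
    rw [ha, ← Set.ncard_coe_finset]
    congr 1
    ext s
    simp
  have hc : ∀ k ≤ n, S.charpoly.coeff (n - k) =
      (-1) ^ k * ((((Finset.univ : Finset V).powersetCard k).filter (fun s : Finset V =>
      ∃ M : (T.induce (s : Set V)).Subgraph, M.IsPerfectMatching)).card : ℤ) := by
    intro k hk
    subst hn
    rw [Matrix.charpoly_coeff_eq_sum_minors _ _ hk, Finset.card_filter, Nat.cast_sum]
    congr 1
    refine Finset.sum_congr rfl fun s _ => ?_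
    refine (SkewTree.det_forest (V := s) (Fintype.card s) rfl (T.induce (s : Set V))
      (hT.isAcyclic.induce _) (S.submatrix Subtype.val Subtype.val) (fun a b => hskew a b) (fun a b h => hadj a b h)
      (fun a b h => hnadj a b h)).trans ?_
    simp only [SkewTree.hasPM_iff]
    split_ifs <;> rfl
  have hbig : ∀ i, n < 2 * i → a i = 0 := by
    intro i hi
    rw [ha', Finset.powersetCard_eq_empty.2 (by rw [Finset.card_univ]; omega)]
    rfl
  have hrbig : ∀ i, r < i → a i = 0 := by
    intro i hi
    rw [ha', Finset.card_eq_zero, Finset.filter_eq_empty_iff]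
    intro s hs hPM
    obtain ⟨M, hM, hc⟩ := SkewTree.matching_of_pm T s hPM
    have := hr.2 ⟨M, hM, rfl⟩
    rw [(Finset.mem_powersetCard.1 hs).2] at hc
    omega
  ext m
  rw [finsetSum_coeff]
  simp only [← Polynomial.C_eq_natCast, Polynomial.coeff_C_mul_X_pow]
  by_cases hm : n < m
  · rw [Polynomial.coeff_eq_zero_of_natDegree_lt
      (by rw [Matrix.charpoly_natDegree_eq_dim, hn]; exact hm), Finset.sum_eq_zero]
    intro i _
    rw [if_neg (by omega)]
  obtain ⟨k, hk, rfl⟩ : ∃ k ≤ n, m = n - k := ⟨n - m, by omega, by omega⟩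
  rw [hc k hk]
  rcases Nat.even_or_odd' k with ⟨i, rfl | rfl⟩
  · rw [← ha', Finset.sum_eq_single i]
    · simp
    · intro j _ hj
      split_ifs with h
      · rw [hbig j (by omega)]; rfl
      · rfl
    · intro hi
      rw [hrbig i (by simpa using hi)]; simp
  · rw [Finset.filter_eq_empty_iff.2, Finset.sum_eq_zero]
    · simp
    · intro j _
      split_ifs with h
      · rw [hbig j (by omega)]; rfl
      · rfl
    · intro s hs hPM
      obtain ⟨M, hM, hc⟩ := SkewTree.matching_of_pm T s hPM
      rw [(Finset.mem_powersetCard.1 hs).2] at hc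
      omega
end

section
/- Let T be a tree on n vertices, let T^e be an arbitrary orientation of T, and let S = A(T^e) be its skew adjacency matrix (an n×n integer matrix). Then the number of perfect matchings of C_4 × T equals |det(2I − S²)|. -/
open SimpleGraph

namespace PmAux

set_option linter.unusedSectionVars false
set_option linter.unusedSimpArgs false

/-- Coefficient indicator: the empty set. -/
def cA (Y : Finset (Fin 4)) : ℤ := if Y = ∅ then 1 else 0
/-- Coefficient indicator: edges of the 4-cycle. -/
def cB (Y : Finset (Fin 4)) : ℤ :=
  if Y = {0, 1} ∨ Y = {1, 2} ∨ Y = {2, 3} ∨ Y = {0, 3} then 1 else 0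
/-- Coefficient indicator: the full fibre. -/
def cC (Y : Finset (Fin 4)) : ℤ := if Y = Finset.univ then 1 else 0

/-- The fibre weight. -/
noncomputable def W (x : ℝ) (Y : Finset (Fin 4)) : ℝ :=
  (cA Y : ℝ) + (cB Y : ℝ) * (x / √2) + (cC Y : ℝ) * x ^ 2

lemma sAA : ∀ Y : Finset (Fin 4), ∑ X ∈ Y.powerset, cA (Y \ X) * cA Xᶜ = cC Y := by decide +kernel
lemma sAB : ∀ Y : Finset (Fin 4), ∑ X ∈ Y.powerset, cA (Y \ X) * cB Xᶜ = cB Y := by decide +kernel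
lemma sAC : ∀ Y : Finset (Fin 4), ∑ X ∈ Y.powerset, cA (Y \ X) * cC Xᶜ = cA Y := by decide +kernel
lemma sBA : ∀ Y : Finset (Fin 4), ∑ X ∈ Y.powerset, cB (Y \ X) * cA Xᶜ = 0 := by decide +kernel
lemma sBB : ∀ Y : Finset (Fin 4), ∑ X ∈ Y.powerset, cB (Y \ X) * cB Xᶜ = 4 * cC Y := by
  decide +kernel
lemma sBC : ∀ Y : Finset (Fin 4), ∑ X ∈ Y.powerset, cB (Y \ X) * cC Xᶜ = cB Y := by decide +kernel
lemma sCA : ∀ Y : Finset (Fin 4), ∑ X ∈ Y.powerset, cC (Y \ X) * cA Xᶜ = 0 := by decide +kernel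
lemma sCB : ∀ Y : Finset (Fin 4), ∑ X ∈ Y.powerset, cC (Y \ X) * cB Xᶜ = 0 := by decide +kernel
lemma sCC : ∀ Y : Finset (Fin 4), ∑ X ∈ Y.powerset, cC (Y \ X) * cC Xᶜ = cC Y := by decide +kernel

lemma W_univ (x : ℝ) : W x Finset.univ = x ^ 2 := by
  have h1 : cA Finset.univ = 0 := by decide +kernel
  have h2 : cB Finset.univ = 0 := by decide +kernel
  have h3 : cC Finset.univ = 1 := by decide +kernel
  simp [W, h1, h2, h3]

lemma W_conv (x y : ℝ) (hy : 0 < y) (Y : Finset (Fin 4)) :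
    ∑ X ∈ Y.powerset, W x (Y \ X) * W y Xᶜ = W (x + 1 / y) Y * W y Finset.univ := by
  rw [W_univ]
  have e : ∀ X : Finset (Fin 4), W x (Y \ X) * W y Xᶜ =
      ((cA (Y \ X) * cA Xᶜ : ℤ) : ℝ) + ((cA (Y \ X) * cB Xᶜ : ℤ) : ℝ) * (y / √2)
      + ((cA (Y \ X) * cC Xᶜ : ℤ) : ℝ) * y ^ 2
      + ((cB (Y \ X) * cA Xᶜ : ℤ) : ℝ) * (x / √2)
      + ((cB (Y \ X) * cB Xᶜ : ℤ) : ℝ) * ((x / √2) * (y / √2))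
      + ((cB (Y \ X) * cC Xᶜ : ℤ) : ℝ) * ((x / √2) * y ^ 2)
      + ((cC (Y \ X) * cA Xᶜ : ℤ) : ℝ) * (x ^ 2)
      + ((cC (Y \ X) * cB Xᶜ : ℤ) : ℝ) * (x ^ 2 * (y / √2))
      + ((cC (Y \ X) * cC Xᶜ : ℤ) : ℝ) * (x ^ 2 * y ^ 2) := by
    intro X; simp only [W]; push_cast; ring
  simp only [e, Finset.sum_add_distrib, ← Finset.sum_mul, ← Int.cast_sum]
  rw [sAA, sAB, sAC, sBA, sBB, sBC, sCA, sCB, sCC]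
  have h2 : (x / √2) * (y / √2) = x * y / 2 := by
    rw [div_mul_div_comm, Real.mul_self_sqrt (by norm_num)]
  rw [h2]
  have h3 : (0:ℝ) < √2 := by positivity
  simp only [W]
  push_cast
  field_simp
  ring

variable {V : Type*} [Fintype V] [DecidableEq V]

/-- Involutions moving vertices only along edges, i.e. matchings. -/
def IsMt {α : Type*} (F : SimpleGraph α) (f : α → α) : Prop :=
  (∀ u, f (f u) = u) ∧ ∀ u, f u ≠ u → F.Adj u (f u)

open Classical in
/-- The finset of matchings. -/
noncomputable def Mt (F : SimpleGraph V) : Finset (V → V) := Finset.univ.filter (IsMt F)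

lemma mem_Mt (F : SimpleGraph V) (f : V → V) : f ∈ Mt F ↔ IsMt F f := by simp [Mt]

/-- Set of layers in which `u` is unmatched. -/
def fixset (σ : Fin 4 → V → V) (u : V) : Finset (Fin 4) := Finset.univ.filter fun i => σ i u = u

/-- The partition function. -/
noncomputable def Z (F : SimpleGraph V) (x : V → ℝ) : ℝ :=
  ∑ σ ∈ Fintype.piFinset (fun _ : Fin 4 => Mt F), ∏ u, W (x u) (fixset σ u)

lemma Z_bot (x : V → ℝ) : Z ⊥ x = ∏ u, x u ^ 2 := by
  have h : Mt (⊥ : SimpleGraph V) = {id} := by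
    ext f
    rw [mem_Mt, Finset.mem_singleton]
    constructor
    · intro h
      funext u
      by_contra hu
      exact h.2 u hu
    · rintro rfl
      exact ⟨fun _ => rfl, fun u hu => absurd rfl hu⟩
  unfold Z
  rw [h, Fintype.piFinset_singleton, Finset.sum_singleton]
  refine Finset.prod_congr rfl fun u _ => ?_
  have : fixset (fun _ : Fin 4 => (id : V → V)) u = Finset.univ := by simp [fixset]
  rw [this, W_univ]

section leaf
variable (F : SimpleGraph V) (v w : V)

/-- Toggle the edge `vw`. -/
def tog (v w : V) (f : V → V) : V → V := fun u => f (Equiv.swap v w u)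

lemma isMt_del {F : SimpleGraph V} {v w : V} (hvw : F.Adj v w) (hleaf : ∀ u, F.Adj w u → u = v)
    (f : V → V) : IsMt (F.deleteEdges {s(v, w)}) f ↔ IsMt F f ∧ f w = w := by
  constructor
  · rintro ⟨h1, h2⟩
    refine ⟨⟨h1, fun u hu => (deleteEdges_adj.1 (h2 u hu)).1⟩, ?_⟩
    by_contra h
    have := deleteEdges_adj.1 (h2 w h)
    have h3 := hleaf _ this.1
    apply this.2
    rw [h3]
    simp [Sym2.eq_swap]
  · rintro ⟨⟨h1, h2⟩, h3⟩
    refine ⟨h1, fun u hu => deleteEdges_adj.2 ⟨h2 u hu, ?_⟩⟩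
    intro h
    simp only [Set.mem_singleton_iff, Sym2.eq_iff] at h
    rcases h with ⟨a, b⟩ | ⟨a, b⟩
    · have := h1 u
      rw [b, h3] at this
      exact hvw.ne (a.symm.trans this.symm)
    · rw [a, h3] at b
      exact hvw.ne b.symm

lemma leaf_val {F : SimpleGraph V} {v w : V} (hleaf : ∀ u, F.Adj w u → u = v)
    {f : V → V} (hf : IsMt F f) (h : f w ≠ w) : f w = v ∧ f v = w := by
  have h1 := hleaf _ (hf.2 w h)
  refine ⟨h1, ?_⟩
  rw [← h1]; exact hf.1 w

lemma tog_apply_v (f : V → V) : tog v w f v = f w := by simp [tog]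
lemma tog_apply_w (f : V → V) : tog v w f w = f v := by simp [tog]
lemma tog_apply_ne (f : V → V) {u : V} (h1 : u ≠ v) (h2 : u ≠ w) : tog v w f u = f u := by
  simp [tog, Equiv.swap_apply_of_ne_of_ne h1 h2]
lemma tog_tog (f : V → V) : tog v w (tog v w f) = f := by
  funext u; simp [tog]

lemma isMt_tog_down {F : SimpleGraph V} {v w : V} (hvw : F.Adj v w)
    {f : V → V} (hf : IsMt F f) (h1 : f w = v) (h2 : f v = w) : IsMt F (tog v w f) := by
  have key : ∀ u, u ≠ v → u ≠ w → f u ≠ v ∧ f u ≠ w := by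
    intro u hu hw
    refine ⟨fun h => hw ?_, fun h => hu ?_⟩
    · rw [← hf.1 u, h, h2]
    · rw [← hf.1 u, h, h1]
  refine ⟨fun u => ?_, fun u hu => ?_⟩
  · by_cases a : u = v
    · subst a; rw [tog_apply_v, h1, tog_apply_v, h1]
    by_cases b : u = w
    · subst b; rw [tog_apply_w, h2, tog_apply_w, h2]
    rw [tog_apply_ne _ _ _ a b, tog_apply_ne _ _ _ (key u a b).1 (key u a b).2, hf.1]
  · by_cases a : u = v
    · subst a; rw [tog_apply_v, h1] at hu; exact absurd rfl hu
    by_cases b : u = w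
    · subst b; rw [tog_apply_w, h2] at hu; exact absurd rfl hu
    rw [tog_apply_ne _ _ _ a b] at hu ⊢
    exact hf.2 u hu

lemma isMt_tog_up {F : SimpleGraph V} {v w : V} (hvw : F.Adj v w)
    {f : V → V} (hf : IsMt F f) (h1 : f w = w) (h2 : f v = v) : IsMt F (tog v w f) := by
  have key : ∀ u, u ≠ v → u ≠ w → f u ≠ v ∧ f u ≠ w := by
    intro u hu hw
    refine ⟨fun h => hu ?_, fun h => hw ?_⟩
    · rw [← hf.1 u, h, h2]
    · rw [← hf.1 u, h, h1]
  refine ⟨fun u => ?_, fun u hu => ?_⟩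
  · by_cases a : u = v
    · subst a; rw [tog_apply_v, h1, tog_apply_w, h2]
    by_cases b : u = w
    · subst b; rw [tog_apply_w, h2, tog_apply_v, h1]
    rw [tog_apply_ne _ _ _ a b, tog_apply_ne _ _ _ (key u a b).1 (key u a b).2, hf.1]
  · by_cases a : u = v
    · subst a; rw [tog_apply_v, h1]; exact hvw
    by_cases b : u = w
    · subst b; rw [tog_apply_w, h2]; exact hvw.symm
    rw [tog_apply_ne _ _ _ a b] at hu ⊢
    exact hf.2 u hu

lemma Z_leaf {F : SimpleGraph V} {v w : V} (hvw : F.Adj v w) (hleaf : ∀ u, F.Adj w u → u = v)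
    (x : V → ℝ) (hx : 0 < x w) :
    Z F x = Z (F.deleteEdges {s(v, w)}) (Function.update x v (x v + 1 / x w)) := by
  have hne : v ≠ w := hvw.ne
  have hdel := fun f => isMt_del (F := F) hvw hleaf f
  have step1 : Z F x = ∑ p ∈ (Fintype.piFinset
      (fun _ : Fin 4 => Mt (F.deleteEdges {s(v, w)}))).sigma (fun τ => (fixset τ v).powerset),
      ∏ u, W (x u) (fixset (fun i => if i ∈ p.2 then tog v w (p.1 i) else p.1 i) u) := by
    unfold Z
    refine Finset.sum_bij'
      (i := fun σ _ => ⟨fun i => if σ i w = w then σ i else tog v w (σ i),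
        Finset.univ.filter fun i => σ i w ≠ w⟩)
      (j := fun p _ => fun i => if i ∈ p.2 then tog v w (p.1 i) else p.1 i) ?_ ?_ ?_ ?_ ?_
    · intro σ hσ
      simp only [Fintype.mem_piFinset, mem_Mt, Finset.mem_sigma, Finset.mem_powerset] at hσ ⊢
      refine ⟨fun i => ?_, fun i hi => ?_⟩
      · rw [hdel]
        split_ifs with h
        · exact ⟨hσ i, h⟩
        · obtain ⟨a, b⟩ := leaf_val hleaf (hσ i) h
          exact ⟨isMt_tog_down hvw (hσ i) a b, by rw [tog_apply_w, b]⟩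
      · simp only [Finset.mem_filter, Finset.mem_univ, true_and, fixset] at hi ⊢
        rw [if_neg hi, tog_apply_v]
        exact (leaf_val hleaf (hσ i) hi).1
    · rintro ⟨τ, X⟩ hp
      simp only [Fintype.mem_piFinset, mem_Mt, Finset.mem_sigma, Finset.mem_powerset, hdel] at hp ⊢
      intro i
      split_ifs with h
      · have := hp.2 h
        simp only [Finset.mem_filter, Finset.mem_univ, true_and, fixset] at this
        exact isMt_tog_up hvw (hp.1 i).1 (hp.1 i).2 this
      · exact (hp.1 i).1
    · intro σ hσ
      funext i
      by_cases h : σ i w = w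
      · simp [h]
      · simp [h, tog_tog]
    · rintro ⟨τ, X⟩ hp
      simp only [Fintype.mem_piFinset, mem_Mt, Finset.mem_sigma, Finset.mem_powerset, hdel] at hp
      have hX : ∀ i ∈ X, τ i v = v := by
        intro i hi
        have := hp.2 hi
        simpa only [Finset.mem_filter, Finset.mem_univ, true_and, fixset] using this
      have e1 : (fun i => if (if i ∈ X then tog v w (τ i) else τ i) w = w then
          (if i ∈ X then tog v w (τ i) else τ i) else
          tog v w (if i ∈ X then tog v w (τ i) else τ i)) = τ := by
        funext i
        by_cases h : i ∈ X
        · simp [h, tog_apply_w, hX i h, hne, tog_tog]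
        · simp [h, (hp.1 i).2]
      have e2 : (Finset.univ.filter fun i =>
          (if i ∈ X then tog v w (τ i) else τ i) w ≠ w) = X := by
        ext i
        by_cases h : i ∈ X
        · simp [h, tog_apply_w, hX i h, hne]
        · simp [h, (hp.1 i).2]
      simp only [e1, e2]
    · intro σ hσ
      refine Finset.prod_congr rfl fun u _ => ?_
      congr 2
      funext i
      by_cases h : σ i w = w
      · simp [h]
      · simp [h, tog_tog]
  rw [step1, Finset.sum_sigma]
  unfold Z
  refine Finset.sum_congr rfl fun τ hτ => ?_
  simp only [Fintype.mem_piFinset, mem_Mt, hdel] at hτ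
  have hw : w ∈ Finset.univ.erase v := by simp [hne.symm]
  have split : ∀ g : V → ℝ, ∏ u, g u = g v * g w * ∏ u ∈ (Finset.univ.erase v).erase w, g u := by
    intro g
    rw [← Finset.mul_prod_erase _ _ (Finset.mem_univ v), ← Finset.mul_prod_erase _ _ hw, mul_assoc]
  have hfw : fixset τ w = Finset.univ := by
    ext i; simp [fixset, (hτ i).2]
  rw [split]
  simp only [Function.update_self, Function.update_of_ne hne.symm, hfw]
  rw [← W_conv _ _ hx, Finset.sum_mul]
  refine Finset.sum_congr rfl fun X hX => ?_
  have hX : ∀ i ∈ X, τ i v = v := by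
    intro i hi
    have := Finset.mem_powerset.1 hX hi
    simpa only [Finset.mem_filter, Finset.mem_univ, true_and, fixset] using this
  rw [split]
  congr 1
  · congr 2
    · ext i
      by_cases h : i ∈ X
      · simp [fixset, h, tog_apply_v, (hτ i).2, hne.symm]
      · simp [fixset, h]
    · ext i
      by_cases h : i ∈ X
      · simp [fixset, h, tog_apply_w, hX i h, hne]
      · simp [fixset, h, (hτ i).2]
  · refine Finset.prod_congr rfl fun u hu => ?_
    simp only [Finset.mem_erase, Finset.mem_univ, and_true] at hu
    rw [Function.update_of_ne hu.2]
    congr 1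
    ext i
    by_cases h : i ∈ X
    · simp [fixset, h, tog_apply_ne v w _ hu.2 hu.1]
    · simp [fixset, h]

end leaf

/-- Skew weights adapted to a graph. -/
structure Fit (F : SimpleGraph V) (S : Matrix V V ℝ) : Prop where
  skew : ∀ u v, S v u = - S u v
  adj : ∀ u v, F.Adj u v → S u v = 1 ∨ S u v = -1
  nadj : ∀ u v, ¬ F.Adj u v → S u v = 0

/-- Remove the edge from the matrix. -/
def delS (S : Matrix V V ℝ) (v w : V) : Matrix V V ℝ :=
  fun a b => if s(a, b) = s(v, w) then 0 else S a b

lemma Fit.del {F : SimpleGraph V} {S : Matrix V V ℝ} (h : Fit F S) (v w : V) :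
    Fit (F.deleteEdges {s(v, w)}) (delS S v w) := by
  refine ⟨fun a b => ?_, fun a b hab => ?_, fun a b hab => ?_⟩
  · simp only [delS]
    rw [Sym2.eq_swap]
    split_ifs
    · simp
    · exact h.skew a b
  · rw [deleteEdges_adj] at hab
    have : s(a, b) ≠ s(v, w) := hab.2
    simp only [delS, this, if_false]
    exact h.adj a b hab.1
  · simp only [delS]
    split_ifs with e
    · rfl
    · apply h.nadj
      intro h'
      exact hab (deleteEdges_adj.2 ⟨h', e⟩)

lemma det_leaf {F : SimpleGraph V} {v w : V} (hvw : F.Adj v w) (hleaf : ∀ u, F.Adj w u → u = v)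
    (x : V → ℝ) (hx : 0 < x w) {S : Matrix V V ℝ} (hS : Fit F S) :
    (Matrix.diagonal x + S).det =
      (Matrix.diagonal (Function.update x v (x v + 1 / x w)) + delS S v w).det := by
  have hne : v ≠ w := hvw.ne
  have hself : ∀ u, S u u = 0 := fun u => hS.nadj u u (F.irrefl)
  have hw1 : ∀ u, u ≠ v → S w u = 0 := fun u hu => hS.nadj _ _ fun h => hu (hleaf u h)
  have hw2 : ∀ u, u ≠ v → S u w = 0 := fun u hu => by rw [hS.skew w u, hw1 u hu, neg_zero]
  set A := Matrix.diagonal x + S with hA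
  have hsq : S v w * S w v = -1 := by
    rw [hS.skew v w]
    rcases hS.adj v w hvw with h | h <;> rw [h] <;> norm_num
  rw [← Matrix.det_updateRow_add_smul_self A hne (-(S v w) / x w)]
  set B := A.updateRow v (A v + (-(S v w) / x w) • A w) with hB
  rw [← Matrix.det_updateCol_add_smul_self B hne (-(S w v) / x w)]
  congr 1
  have Bv : ∀ b, B v b = A v b + (-(S v w) / x w) * A w b := by
    intro b; simp [hB]
  have Bn : ∀ a b, a ≠ v → B a b = A a b := by
    intro a b h; simp [hB, h]
  have Aw : ∀ b, b ≠ v → b ≠ w → A w b = 0 := by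
    intro b h1 h2
    simp [hA, hw1 b h1, Matrix.diagonal_apply, h2.symm]
  have Aww : A w w = x w := by simp [hA, hself]
  have Awv : A w v = S w v := by simp [hA, Matrix.diagonal_apply, hne.symm]
  have Avw : A v w = S v w := by simp [hA, Matrix.diagonal_apply, hne]
  have Avv : A v v = x v := by simp [hA, hself]
  have Bvw : B v w = 0 := by rw [Bv, Aww, Avw]; field_simp; ring
  have Bvv : B v v = x v + 1 / x w := by
    rw [Bv, Avv, Awv]; field_simp; linarith
  have Bw : ∀ a, a ≠ w → B a w = 0 := by
    intro a ha
    by_cases h : a = v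
    · rw [h, Bvw]
    · rw [Bn _ _ h]; simp [hA, Matrix.diagonal_apply, ha, hw2 a h]
  ext a b
  by_cases hb : b = v
  · subst hb
    rw [Matrix.updateCol_self]
    by_cases ha : a = b
    · subst ha
      rw [Bvv, Bvw]
      simp [delS, hself]
    · by_cases ha' : a = w
      · subst ha'
        rw [Bn _ _ ha, Bn _ _ ha, Aww, Awv]
        simp [delS, Sym2.eq_swap, Matrix.diagonal_apply, ha]
        field_simp; ring
      · rw [Bw a ha', Bn _ _ ha]
        simp [delS, hA, Matrix.diagonal_apply, ha, ha']
  · rw [Matrix.updateCol_ne hb]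
    by_cases ha : a = v
    · subst ha
      by_cases hb' : b = w
      · subst hb'
        rw [Bvw]; simp [delS, Matrix.diagonal_apply, hne]
      · rw [Bv, Aw b hb hb']
        simp [hA, delS, Matrix.diagonal_apply, Ne.symm hb, hb', hb]
    · rw [Bn _ _ ha]
      simp [hA, delS, Matrix.diagonal_apply, ha, hb, Function.update_of_ne]

lemma exists_leaf {F : SimpleGraph V} (hF : F.IsAcyclic) (hne : F ≠ ⊥) :
    ∃ v w, F.Adj v w ∧ ∀ u, F.Adj w u → u = v := by
  classical
  obtain ⟨a, b, hab⟩ := SimpleGraph.ne_bot_iff_exists_adj.1 hne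
  let c := F.connectedComponentMk a
  have ht := hF.isTree_connectedComponent c
  have ha : a ∈ c.supp := rfl
  have hb : b ∈ c.supp := (SimpleGraph.ConnectedComponent.mem_supp_congr_adj c hab).1 ha
  have : Nontrivial c := ⟨⟨⟨a, ha⟩, ⟨b, hb⟩, fun h => hab.ne (congrArg Subtype.val h)⟩⟩
  obtain ⟨w, hw⟩ := ht.exists_vert_degree_one_of_nontrivial
  obtain ⟨v, hv, huniq⟩ := degree_eq_one_iff_existsUnique_adj.1 hw
  refine ⟨v, w, ?_, ?_⟩
  · exact (show F.Adj w v from hv).symm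
  · intro u hu
    have hu' : u ∈ c.supp := (SimpleGraph.ConnectedComponent.mem_supp_congr_adj c hu).1 w.2
    exact congrArg Subtype.val (huniq ⟨u, hu'⟩ hu)

theorem Z_eq_det (F : SimpleGraph V) : F.IsAcyclic → ∀ (x : V → ℝ), (∀ u, 0 < x u) →
    ∀ S : Matrix V V ℝ, Fit F S → Z F x = (Matrix.diagonal x + S).det ^ 2 := by
  induction F using WellFoundedLT.induction with
  | _ F ih =>
  intro hF x hx S hS
  by_cases h0 : F = ⊥
  · subst h0
    have : S = 0 := by
      ext a b; exact hS.nadj a b (by simp)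
    rw [this, add_zero, Matrix.det_diagonal, Z_bot, Finset.prod_pow]
  · obtain ⟨v, w, hvw, hleaf⟩ := exists_leaf hF h0
    rw [Z_leaf hvw hleaf x (hx w), det_leaf hvw hleaf x (hx w) hS]
    have hle : F.deleteEdges {s(v, w)} ≤ F := deleteEdges_le _
    refine ih _ ?_ (hF.anti hle) _ ?_ _ (hS.del v w)
    · refine lt_of_le_of_ne hle fun h => ?_
      rw [← h, deleteEdges_adj] at hvw
      exact hvw.2 rfl
    · intro u
      by_cases hu : u = v
      · subst hu
        rw [Function.update_self]
        have := hx u; have := hx w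
        positivity
      · rw [Function.update_of_ne hu]; exact hx u

lemma W_count : ∀ Y : Finset (Fin 4),
    (((Finset.univ : Finset (Fin 4 → Fin 4)).filter fun κ =>
      ((∀ u, κ (κ u) = u) ∧ ∀ u, κ u ≠ u → (cycleGraph 4).Adj u (κ u)) ∧
        ∀ i, κ i ≠ i ↔ i ∈ Y).card : ℤ) = cA Y + cB Y + 2 * cC Y := by
  decide +kernel

lemma W_sqrt (Y : Finset (Fin 4)) : W (√2) Y = ((cA Y + cB Y + 2 * cC Y : ℤ) : ℝ) := by
  have h3 : √2 / √2 = 1 := div_self (by positivity)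
  have h4 : √2 ^ 2 = 2 := Real.sq_sqrt (by norm_num)
  simp only [W, h3, h4]
  push_cast; ring

lemma Pm_eq {α : Type*} [Fintype α] [DecidableEq α] (G : SimpleGraph α) :
    Pm G = Set.ncard {f : α → α | IsMt G f ∧ ∀ u, f u ≠ u} := by
  symm
  unfold Pm
  refine Set.ncard_congr (fun f hf =>
    { verts := Set.univ
      Adj := fun a b => f a = b
      adj_sub := by
        rintro a b rfl
        exact hf.1.2 a (hf.2 a)
      edge_vert := fun _ => Set.mem_univ _
      symm := ⟨by
        rintro a b rfl
        exact hf.1.1 a⟩ }) ?_ ?_ ?_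
  · intro f hf
    rw [Set.mem_ofPred_eq, Subgraph.isPerfectMatching_iff]
    intro v
    exact ⟨f v, rfl, fun y hy => (show f v = y from hy).symm⟩
  · intro f g hf hg h
    funext u
    have := congrArg (fun M : G.Subgraph => M.Adj u (f u)) h
    simp only [eq_iff_iff, true_iff] at this
    exact this.symm
  · intro M hM
    have hM' := Subgraph.isPerfectMatching_iff.1 hM
    choose f hf huniq using hM'
    refine ⟨f, ⟨⟨fun u => ?_, fun u _ => M.adj_sub (hf u)⟩, fun u h => ?_⟩, ?_⟩
    · exact (huniq (f u) u (hf u).symm).symm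
    · have := M.adj_sub (hf u)
      rw [h] at this
      exact G.irrefl this
    · ext a b
      · simp [hM.2 a]
      · constructor
        · rintro rfl; exact hf a
        · intro h; exact (huniq a b h).symm

lemma Pm_eq_Z (T : SimpleGraph V) : (Pm (cycleGraph 4 □ T) : ℝ) = Z T (fun _ => √2) := by
  classical
  let K : Finset (Fin 4) → Finset (Fin 4 → Fin 4) := fun Y =>
    (Finset.univ : Finset (Fin 4 → Fin 4)).filter fun κ =>
      ((∀ u, κ (κ u) = u) ∧ ∀ u, κ u ≠ u → (cycleGraph 4).Adj u (κ u)) ∧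
        ∀ i, κ i ≠ i ↔ i ∈ Y
  have hZ : Z T (fun _ => √2) = (((Fintype.piFinset (fun _ : Fin 4 => Mt T)).sigma
      (fun σ => Fintype.piFinset fun u => K (fixset σ u))).card : ℝ) := by
    rw [Finset.card_sigma]
    push_cast
    unfold Z
    refine Finset.sum_congr rfl fun σ _ => ?_
    rw [Fintype.card_piFinset]
    push_cast
    refine Finset.prod_congr rfl fun u _ => ?_
    rw [W_sqrt, ← W_count]
    rfl
  rw [hZ, Pm_eq, ← Set.ncard_coe_finset]
  congr 1
  refine Set.ncard_congr (fun f _ => ⟨fun i v => (f (i, v)).2, fun v i => (f (i, v)).1⟩) ?_ ?_ ?_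
  · rintro f ⟨⟨h1, h2⟩, h3⟩
    have h4 : ∀ i v, ((cycleGraph 4).Adj i (f (i, v)).1 ∧ v = (f (i, v)).2) ∨
        (T.Adj v (f (i, v)).2 ∧ i = (f (i, v)).1) := fun i v => h2 (i, v) (h3 (i, v))
    have h5 : ∀ i v, (f (i, v)).2 = v → f (i, v) = ((f (i, v)).1, v) := fun i v h =>
      Prod.ext rfl h
    have h6 : ∀ i v, (f (i, v)).1 = i → f (i, v) = (i, (f (i, v)).2) := fun i v h =>
      Prod.ext h rfl
    simp only [Finset.coe_sigma, Set.mem_sigma_iff, Finset.mem_coe, Fintype.mem_piFinset, mem_Mt, K,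
      Finset.mem_filter, Finset.mem_univ, true_and]
    refine ⟨fun i => ⟨fun v => ?_, fun v hv => ?_⟩, fun v => ⟨⟨fun i => ?_, fun i hi => ?_⟩,
      fun i => ?_⟩⟩
    · beta_reduce
      rcases h4 i v with ⟨a, b⟩ | ⟨a, b⟩
      · rw [← b, ← b]
      · rw [← h6 i v b.symm, h1]
    · rcases h4 i v with ⟨a, b⟩ | ⟨a, b⟩
      · exact absurd b.symm hv
      · exact a
    · rcases h4 i v with ⟨a, b⟩ | ⟨a, b⟩
      · rw [← h5 i v b.symm, h1]
      · rw [← b, ← b]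
    · rcases h4 i v with ⟨a, b⟩ | ⟨a, b⟩
      · exact a
      · exact absurd b.symm hi
    · simp only [fixset, Finset.mem_filter, Finset.mem_univ, true_and]
      rcases h4 i v with ⟨a, b⟩ | ⟨a, b⟩
      · exact ⟨fun _ => b.symm, fun _ => a.ne'⟩
      · exact ⟨fun h => absurd b.symm h, fun h => absurd h a.ne'⟩
  · intro f g _ _ h
    simp only [Sigma.mk.injEq, heq_eq_eq] at h
    funext ⟨i, v⟩
    exact Prod.ext (congrFun (congrFun h.2 v) i) (congrFun (congrFun h.1 i) v)
  · rintro ⟨σ, κ⟩ h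
    simp only [Finset.coe_sigma, Set.mem_sigma_iff, Finset.mem_coe, Fintype.mem_piFinset, mem_Mt, K,
      Finset.mem_filter, Finset.mem_univ, true_and, fixset] at h
    obtain ⟨hσ, hκ⟩ := h
    refine ⟨fun p => (κ p.2 p.1, σ p.1 p.2), ⟨⟨?_, ?_⟩, ?_⟩, rfl⟩
    · rintro ⟨i, v⟩
      by_cases h : σ i v = v
      · have h' := ((hκ v).2 i).2 h
        have h'' : σ (κ v i) v = v := by
          apply ((hκ v).2 (κ v i)).1
          rw [(hκ v).1.1]; exact h'.symm
        simp [h, (hκ v).1.1, h'']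
      · have h' : κ v i = i := by
          by_contra h'
          exact h (((hκ v).2 i).1 h')
        have h'' : κ (σ i v) i = i := by
          by_contra h''
          have := ((hκ (σ i v)).2 i).1 h''
          rw [(hσ i).1] at this
          exact h this.symm
        simp [h', (hσ i).1, h'']
    · rintro ⟨i, v⟩ _
      rw [boxProd_adj]
      by_cases h : σ i v = v
      · left
        exact ⟨(hκ v).1.2 i (((hκ v).2 i).2 h), h.symm⟩
      · right
        refine ⟨(hσ i).2 v h, ?_⟩
        by_contra h'
        exact h (((hκ v).2 i).1 (Ne.symm h'))
    · rintro ⟨i, v⟩ h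
      simp only [Prod.mk.injEq] at h
      exact ((hκ v).2 i).2 h.2 h.1

end PmAux

/-- Let `T` be a tree and `S` the skew adjacency matrix of an arbitrary
orientation of `T`.  Then `Pm(C_4 × T) = |det(2I − S²)|`. -/
theorem pm_c4_boxProd_tree_eq_det {V : Type*} [Fintype V] [DecidableEq V]
    (T : SimpleGraph V) (hT : T.IsTree)
    (S : Matrix V V ℤ)
    (hskew : ∀ u v, S v u = - S u v)
    (hadj : ∀ u v, T.Adj u v → S u v = 1 ∨ S u v = -1)
    (hnadj : ∀ u v, ¬ T.Adj u v → S u v = 0) :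
    (Pm (cycleGraph 4 □ T) : ℤ) =
      |Matrix.det ((2 : ℤ) • (1 : Matrix V V ℤ) - S ^ 2)| := by
  have hreal : (Pm (cycleGraph 4 □ T) : ℝ) =
      ((Matrix.det ((2 : ℤ) • (1 : Matrix V V ℤ) - S ^ 2) : ℤ) : ℝ) ∧
      (0 : ℝ) ≤ ((Matrix.det ((2 : ℤ) • (1 : Matrix V V ℤ) - S ^ 2) : ℤ) : ℝ) := by
    let R : Matrix V V ℝ := S.map (Int.castRingHom ℝ)
    have hfit : PmAux.Fit T R := by
      refine ⟨fun u v => ?_, fun u v h => ?_, fun u v h => ?_⟩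
      · simp [R, hskew u v]
      · rcases hadj u v h with h | h <;> simp [R, h]
      · simp [R, hnadj u v h]
    have hZ := PmAux.Z_eq_det T hT.isAcyclic (fun _ => √2) (fun _ => by positivity) R hfit
    have hRt : R.transpose = -R := by
      ext a b; exact hfit.skew a b
    have hdet : ((Matrix.det ((2 : ℤ) • (1 : Matrix V V ℤ) - S ^ 2) : ℤ) : ℝ) =
        (Matrix.diagonal (fun _ : V => √2) + R).det ^ 2 := by
      have e1 : ((Matrix.det ((2 : ℤ) • (1 : Matrix V V ℤ) - S ^ 2) : ℤ) : ℝ) =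
          ((2 : ℝ) • (1 : Matrix V V ℝ) - R ^ 2).det := by
        change (Int.castRingHom ℝ) _ = _
        rw [RingHom.map_det]
        congr 1
        change (Int.castRingHom ℝ).mapMatrix _ = _ - ((Int.castRingHom ℝ).mapMatrix S) ^ 2
        rw [map_sub, map_pow, map_zsmul, map_one]
        congr 1
        ext a b
        simp
      have e2 : (Matrix.diagonal (fun _ : V => √2) + R).det =
          (Matrix.diagonal (fun _ : V => √2) - R).det := by
        rw [← Matrix.det_transpose, Matrix.transpose_add, hRt, Matrix.diagonal_transpose,
          sub_eq_add_neg]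
      rw [e1, pow_two (Matrix.det _)]
      nth_rewrite 2 [e2]
      rw [← Matrix.det_mul]
      congr 1
      have e3 : Matrix.diagonal (fun _ : V => √2) = (√2) • (1 : Matrix V V ℝ) := by
        rw [Matrix.smul_one_eq_diagonal]
      rw [e3]
      have h4 : √2 * √2 = 2 := Real.mul_self_sqrt (by norm_num)
      simp only [add_mul, mul_sub, smul_add, smul_mul_assoc, mul_smul_comm, one_mul, mul_one, smul_smul, h4,
        pow_two]
      abel
    rw [hdet, PmAux.Pm_eq_Z, hZ]
    exact ⟨rfl, sq_nonneg _⟩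
  have h0 : 0 ≤ Matrix.det ((2 : ℤ) • (1 : Matrix V V ℤ) - S ^ 2) := by exact_mod_cast hreal.2
  rw [abs_of_nonneg h0]
  exact_mod_cast hreal.1
end

section
/- Let F be a forest (an acyclic simple graph) and let F^e be an arbitrary orientation of F with skew adjacency matrix A(F^e). Then det A(F^e) = 1 if F has a perfect matching, and det A(F^e) = 0 otherwise. -/
open SimpleGraph

/-- Perfect matchings as fixed-point-free involutions along edges. -/
lemma pm_iff_invol {V : Type*} (F : SimpleGraph V) :
    (∃ M : F.Subgraph, M.IsPerfectMatching) ↔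
      ∃ f : V → V, (∀ x, F.Adj x (f x)) ∧ ∀ x, f (f x) = x := by
  constructor
  · rintro ⟨M, hM⟩
    rw [Subgraph.isPerfectMatching_iff] at hM
    choose f hf hu using hM
    refine ⟨f, fun x => (hf x).adj_sub, fun x => ?_⟩
    exact (hu (f x) x (hf x).symm).symm
  · rintro ⟨f, hf, hi⟩
    refine ⟨{ verts := Set.univ, Adj := fun a b => f a = b, adj_sub := ?_,
              edge_vert := fun _ => Set.mem_univ _, symm := ?_ }, ?_⟩
    · rintro a b rfl
      exact hf a
    · first
      | (rintro a b rfl; exact hi a)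
      | (constructor; rintro a b rfl; exact hi a)
    · rw [Subgraph.isPerfectMatching_iff]
      intro v
      exact ⟨f v, rfl, fun y hy => Eq.symm (show f v = y from hy)⟩

/-- A finite forest without isolated vertices has a leaf. -/
lemma forest_leaf {V : Type*} [Fintype V] (F : SimpleGraph V) (hF : F.IsAcyclic)
    (x : V) (hx : ∀ y, ∃ z, F.Adj y z) :
    ∃ v u, F.Adj v u ∧ ∀ w, F.Adj v w → w = u := by
  classical
  let c := F.connectedComponentMk x
  have ht : c.toSimpleGraph.IsTree := hF.isTree_connectedComponent c
  obtain ⟨y, hy⟩ := hx x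
  have hyc : F.connectedComponentMk y = c := (ConnectedComponent.connectedComponentMk_eq_of_adj hy).symm
  have : Nontrivial c :=
    ⟨⟨x, rfl⟩, ⟨y, hyc⟩, fun h => hy.ne (congrArg Subtype.val h)⟩
  obtain ⟨v, hv⟩ := ht.exists_vert_degree_one_of_nontrivial
  rw [degree_eq_one_iff_existsUnique_adj] at hv
  obtain ⟨u, hu, huu⟩ := hv
  refine ⟨v.1, u.1, hu, fun w hw => ?_⟩
  have hwc : F.connectedComponentMk w = c :=
    (ConnectedComponent.connectedComponentMk_eq_of_adj hw).symm.trans v.2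
  exact congrArg Subtype.val (huu ⟨w, hwc⟩ hw)

lemma det_leaf {V : Type*} [Fintype V] [DecidableEq V] (S : Matrix V V ℤ) (v u : V) (hvu : v ≠ u)
    (hskew : ∀ u v, S v u = - S u v) (h1 : S v u = 1 ∨ S v u = -1)
    (hv : ∀ w, w ≠ u → S v w = 0) :
    S.det = (S.submatrix (Subtype.val : {x // ¬ (x = v ∨ x = u)} → V) Subtype.val).det := by
  let T : Matrix V V ℤ := fun i j => if ¬ (i = v ∨ i = u) ∧ j = u then 0 else S i j
  have hT : ∀ i j, (j ≠ u ∨ i = v ∨ i = u) → T i j = S i j := by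
    intro i j h
    refine if_neg ?_
    rintro ⟨h1, h2⟩
    exact h.elim (fun h => h h2) h1
  have hST : S.det = T.det := by
    rw [Matrix.det_apply, Matrix.det_apply]
    refine Finset.sum_congr rfl fun σ _ => ?_
    congr 1
    by_cases hσ : σ u = v
    · refine Finset.prod_congr rfl fun i _ => ?_
      by_cases hi : i = u
      · subst hi; simp [T, hσ]
      · simp [T, hi]
    · have hne : σ.symm v ≠ u := by
        rintro h; apply hσ; rw [← h]; simp
      rw [Finset.prod_eq_zero (Finset.mem_univ (σ.symm v)),
        Finset.prod_eq_zero (Finset.mem_univ (σ.symm v))]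
      · simp [T, hv _ hne]
      · simp [hv _ hne]
  rw [hST, Matrix.twoBlockTriangular_det T (fun x => x = v ∨ x = u)]
  · have e2 : (T.toSquareBlockProp (fun x => x = v ∨ x = u)).det = 1 := by
      let g : Fin 2 → {x // x = v ∨ x = u} := ![⟨v, Or.inl rfl⟩, ⟨u, Or.inr rfl⟩]
      have hg : Function.Bijective g := by
        constructor
        · intro i j h
          have h' := congrArg Subtype.val h
          fin_cases i <;> fin_cases j
          · rfl
          · exact (hvu h').elim
          · exact (hvu h'.symm).elim
          · rfl
        · rintro ⟨x, rfl | rfl⟩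
          · exact ⟨0, rfl⟩
          · exact ⟨1, rfl⟩
      rw [← Matrix.det_submatrix_equiv_self (Equiv.ofBijective g hg), Matrix.det_fin_two]
      have a := hv v hvu
      have b := hskew v u
      change T v v * T u u - T v u * T u v = 1
      rw [hT v v (by simp), hT u u (by simp), hT v u (by simp), hT u v (by simp), a, b]
      rcases h1 with h | h <;> simp [h]
    rw [e2, one_mul]
    congr 1
    ext i j
    have hj := j.2
    have : j.1 ≠ u := fun h => hj (Or.inr h)
    exact hT _ _ (Or.inl this)
  · intro i hi j hj
    rcases hj with rfl | rfl
    · have : i ≠ u := fun h => hi (Or.inr h)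
      rw [hT _ _ (Or.inl hvu), hskew j i, hv i this, neg_zero]
    · exact if_pos ⟨hi, rfl⟩

lemma pm_leaf {V : Type*} [DecidableEq V] (F : SimpleGraph V) (v u : V) (hvu : F.Adj v u)
    (hv : ∀ w, F.Adj v w → w = u) :
    (∃ M : F.Subgraph, M.IsPerfectMatching) ↔
      ∃ M : (F.comap (Subtype.val : {x // ¬ (x = v ∨ x = u)} → V)).Subgraph,
        M.IsPerfectMatching := by
  rw [pm_iff_invol, pm_iff_invol]
  constructor
  · rintro ⟨f, hf, hi⟩
    have fv : f v = u := hv _ (hf v)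
    have fu : f u = v := by rw [← fv, hi]
    refine ⟨fun x => ⟨f x.1, ?_⟩, fun x => hf x.1, fun x => Subtype.ext (hi x.1)⟩
    rintro (h | h)
    · exact x.2 (Or.inr (by rw [← hi x.1, h, fv]))
    · exact x.2 (Or.inl (by rw [← hi x.1, h, fu]))
  · rintro ⟨f, hf, hi⟩
    let g : V → V := fun x => if h : x = v ∨ x = u then (if x = v then u else v) else (f ⟨x, h⟩).1
    have gv : g v = u := by simp [g]
    have gu : g u = v := by simp [g, hvu.ne']
    have go : ∀ x : {x // ¬ (x = v ∨ x = u)}, g x.1 = (f x).1 := fun x => dif_neg x.2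
    refine ⟨g, fun x => ?_, fun x => ?_⟩
    · by_cases h : x = v ∨ x = u
      · rcases h with rfl | rfl
        · rw [gv]; exact hvu
        · rw [gu]; exact hvu.symm
      · rw [go ⟨x, h⟩]; exact hf ⟨x, h⟩
    · by_cases h : x = v ∨ x = u
      · rcases h with rfl | rfl
        · rw [gv, gu]
        · rw [gu, gv]
      · rw [go ⟨x, h⟩, go, hi]

/-- Let `F` be a forest and `S` the skew adjacency matrix of an arbitrary
orientation of `F`.  Then `det S = 1` if `F` has a perfect matching and
`det S = 0` otherwise. -/
theorem det_skew_adjMatrix_forest {V : Type*} [Fintype V] [DecidableEq V]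
    (F : SimpleGraph V) (hF : F.IsAcyclic)
    (S : Matrix V V ℤ)
    (hskew : ∀ u v, S v u = - S u v)
    (hadj : ∀ u v, F.Adj u v → S u v = 1 ∨ S u v = -1)
    (hnadj : ∀ u v, ¬ F.Adj u v → S u v = 0) :
    ((∃ M : F.Subgraph, M.IsPerfectMatching) → S.det = 1) ∧
      ((¬ ∃ M : F.Subgraph, M.IsPerfectMatching) → S.det = 0) := by
  induction hn : Fintype.card V using Nat.strong_induction_on generalizing V with
  | _ n ih =>
  rcases isEmpty_or_nonempty V with hV | ⟨⟨x⟩⟩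
  · refine ⟨fun _ => Matrix.det_isEmpty, fun h => (h ?_).elim⟩
    rw [pm_iff_invol]
    exact ⟨id, fun x => hV.elim x, fun x => hV.elim x⟩
  by_cases hiso : ∀ y, ∃ z, F.Adj y z
  · obtain ⟨v, u, hvu, hv⟩ := forest_leaf F hF x hiso
    rw [det_leaf S v u hvu.ne hskew (hadj _ _ hvu) (fun w hw => hnadj _ _ fun h => hw (hv w h)),
      pm_leaf F v u hvu hv]
    refine ih _ ?_ _ (hF.of_comap (Function.Embedding.subtype _)) _ (fun a b => hskew a b)
      (fun a b h => hadj _ _ h) (fun a b h => hnadj _ _ h) rfl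
    rw [← hn]
    exact Fintype.card_subtype_lt (x := v) (by simp)
  · push Not at hiso
    obtain ⟨y, hy⟩ := hiso
    refine ⟨fun h => ?_, fun _ => Matrix.det_eq_zero_of_row_eq_zero y fun j => hnadj _ _ (hy j)⟩
    rw [pm_iff_invol] at h
    obtain ⟨f, hf, -⟩ := h
    exact (hy _ (hf y)).elim
end

section
/- Let F be a forest (an acyclic simple graph) with adjacency matrix A(F). If F has a perfect matching and has 2k vertices, then det A(F) = (−1)^k; if F has no perfect matching, then det A(F) = 0. -/
open SimpleGraph

/-- Perfect matchings as fixed-point-free involutions along edges. -/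
def HasInvol {V : Type*} (F : SimpleGraph V) : Prop :=
  ∃ f : V → V, (∀ x, f (f x) = x) ∧ ∀ x, F.Adj x (f x)

lemma hasInvol_iff {V : Type*} (F : SimpleGraph V) :
    (∃ M : F.Subgraph, M.IsPerfectMatching) ↔ HasInvol F := by
  constructor
  · rintro ⟨M, hM⟩
    rw [Subgraph.isPerfectMatching_iff] at hM
    choose f hf hu using hM
    exact ⟨f, fun x => (hu (f x) x (hf x).symm).symm, fun x => (hf x).adj_sub⟩
  · rintro ⟨f, hf, ha⟩
    refine ⟨{ verts := Set.univ, Adj := fun x y => y = f x, adj_sub := ?_, edge_vert := ?_,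
              symm := ?_ }, ?_⟩
    · rintro x y rfl; exact ha x
    · intros; trivial
    · refine ⟨?_⟩
      rintro x y rfl
      exact (hf x).symm
    · rw [Subgraph.isPerfectMatching_iff]
      intro v
      exact ⟨f v, rfl, fun y hy => hy⟩

lemma exists_leaf {V : Type*} [Fintype V] [Nonempty V] (F : SimpleGraph V)
    (hF : F.IsAcyclic) : ∃ v, ∀ x y, F.Adj v x → F.Adj v y → x = y := by
  classical
  let P : ℕ → Prop := fun n => ∃ (u v : V) (p : F.Walk u v), p.IsPath ∧ p.length = n
  have h0 : P 0 := ⟨Classical.arbitrary V, _, Walk.nil, Walk.IsPath.nil, rfl⟩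
  obtain ⟨u, v, p, hp, hl⟩ : P (Nat.findGreatest P (Fintype.card V)) :=
    Nat.findGreatest_spec (Nat.zero_le _) h0
  have key : ∀ x, F.Adj u x → x = p.snd := by
    intro x hx
    refine hF.eq_snd_of_adj_start hp hx ?_
    by_contra hn
    have hq : (Walk.cons hx.symm p).IsPath := hp.cons hn
    have h1 : P (p.length + 1) := ⟨_, _, _, hq, by simp⟩
    have h2 := Nat.le_findGreatest (P := P) (n := Fintype.card V)
      (by have := hq.length_lt; simp at this; omega) h1
    omega
  exact ⟨u, fun x y hx hy => (key x hx).trans (key y hy).symm⟩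

/-- Block index: the leaf first, its neighbour last. -/
def blk {V : Type*} [DecidableEq V] (v w : V) (x : V) : Fin 3 :=
  if x = v then 0 else if x = w then 2 else 1

lemma blk0 {V : Type*} [DecidableEq V] {v w x : V} : blk v w x = 0 ↔ x = v := by
  unfold blk; split_ifs <;> simp_all
lemma blk1 {V : Type*} [DecidableEq V] {v w x : V} : blk v w x = 1 ↔ x ≠ v ∧ x ≠ w := by
  unfold blk; split_ifs <;> simp_all
lemma blk2 {V : Type*} [DecidableEq V] {v w x : V} (h : v ≠ w) :
    blk v w x = 2 ↔ x = w := by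
  unfold blk; split_ifs <;> simp_all

lemma det_leaf_s15 {V : Type*} [Fintype V] [DecidableEq V]
    (F : SimpleGraph V) [DecidableRel F.Adj] (v w : V) (hvw : F.Adj v w)
    (hl : ∀ x, F.Adj v x → x = w) :
    (F.adjMatrix ℤ).det =
      - ((F.comap (Subtype.val : {x // blk v w x = 1} → V)).adjMatrix ℤ).det := by
  have hne : v ≠ w := hvw.ne
  set N := (F.adjMatrix ℤ).submatrix (Equiv.swap v w) id with hN
  have hdet : N.det = - (F.adjMatrix ℤ).det := by
    rw [hN, Matrix.det_permute, Equiv.Perm.sign_swap hne]; simp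
  have hNv : ∀ j, N v j = if F.Adj w j then 1 else 0 := by
    intro j; simp [hN, adjMatrix_apply]
  have hNw : ∀ j, N w j = if F.Adj v j then 1 else 0 := by
    intro j; simp [hN, adjMatrix_apply]
  have hNx : ∀ i j, i ≠ v → i ≠ w → N i j = if F.Adj i j then 1 else 0 := by
    intro i j h1 h2; simp [hN, adjMatrix_apply, Equiv.swap_apply_of_ne_of_ne h1 h2]
  have hT : N.BlockTriangular (blk v w) := by
    intro i j hij
    by_cases hiw : i = w
    · subst hiw
      rw [hNw, if_neg]
      intro h
      rw [hl j h] at hij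
      exact lt_irrefl _ hij
    · by_cases hiv : i = v
      · rw [blk0.2 hiv] at hij
        exact absurd hij (by simp)
      · rw [blk1.2 ⟨hiv, hiw⟩] at hij
        have : blk v w j = 0 := by omega
        rw [blk0] at this
        subst this
        rw [hNx i j hiv hiw, if_neg]
        intro h
        exact hiw (hl i h.symm)
  have h3 := hT.det_fintype
  rw [Fin.prod_univ_three] at h3
  have e0 : (N.toSquareBlock (blk v w) 0).det = 1 := by
    letI : Unique {x // blk v w x = 0} := ⟨⟨⟨v, blk0.2 rfl⟩⟩, fun x => Subtype.ext (blk0.1 x.2)⟩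
    rw [Matrix.det_unique]
    change N v v = 1
    rw [hNv, if_pos hvw.symm]
  have e2 : (N.toSquareBlock (blk v w) 2).det = 1 := by
    letI : Unique {x // blk v w x = 2} :=
      ⟨⟨⟨w, (blk2 hne).2 rfl⟩⟩, fun x => Subtype.ext ((blk2 hne).1 x.2)⟩
    rw [Matrix.det_unique]
    change N w w = 1
    rw [hNw, if_pos hvw]
  have e1 : N.toSquareBlock (blk v w) 1 =
      (F.comap (Subtype.val : {x // blk v w x = 1} → V)).adjMatrix ℤ := by
    ext i j
    have := blk1.1 i.2
    change N i j = _
    rw [hNx _ _ this.1 this.2]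
    simp [adjMatrix_apply]
  rw [e0, e2, e1] at h3
  linarith

lemma invol_leaf {V : Type*} [DecidableEq V]
    (F : SimpleGraph V) (v w : V) (hvw : F.Adj v w)
    (hl : ∀ x, F.Adj v x → x = w) :
    HasInvol F ↔ HasInvol (F.comap (Subtype.val : {x // blk v w x = 1} → V)) := by
  have hne : v ≠ w := hvw.ne
  constructor
  · rintro ⟨f, hf, ha⟩
    have hv : f v = w := hl _ (ha v)
    have hw : f w = v := by rw [← hv, hf]
    refine ⟨fun x => ⟨f x, ?_⟩, fun x => Subtype.ext (hf x), fun x => ha x⟩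
    have := blk1.1 x.2
    refine blk1.2 ⟨fun h => this.2 ?_, fun h => this.1 ?_⟩
    · rw [← hf x, h, hv]
    · rw [← hf x, h, hw]
  · rintro ⟨f, hf, ha⟩
    have hS : ∀ x : {x // blk v w x = 1}, x.1 ≠ v ∧ x.1 ≠ w := fun x => blk1.1 x.2
    refine ⟨fun x => if h : blk v w x = 1 then (f ⟨x, h⟩).1 else if x = v then w else v, ?_, ?_⟩
    · intro x
      by_cases h : blk v w x = 1
      · have h' := (f ⟨x, h⟩).2
        simp [h, h', hf]
      · have hv1 : ¬ blk v w v = 1 := by simp [blk1]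
        have hw1 : ¬ blk v w w = 1 := by simp [blk1]
        by_cases hx : x = v
        · subst hx; simp [hv1, hw1, hne.symm]
        · have : x = w := by
            by_contra h2
            exact h (blk1.2 ⟨hx, h2⟩)
          subst this
          simp [hv1, hw1, hne.symm]
    · intro x
      by_cases h : blk v w x = 1
      · simpa [h] using ha ⟨x, h⟩
      · by_cases hx : x = v
        · subst hx; simpa [h] using hvw
        · have : x = w := by
            by_contra h2
            exact h (blk1.2 ⟨hx, h2⟩)
          subst this
          simpa [h, hx] using hvw.symm

lemma forest_aux (n : ℕ) : ∀ {V : Type*} [Fintype V] [DecidableEq V]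
    (F : SimpleGraph V) [DecidableRel F.Adj] (_ : F.IsAcyclic) (_ : Fintype.card V = n),
    (∀ k : ℕ, n = 2 * k → HasInvol F → (F.adjMatrix ℤ).det = (-1) ^ k) ∧
      (¬ HasInvol F → (F.adjMatrix ℤ).det = 0) := by
  induction n using Nat.strong_induction_on with
  | _ n ih =>
    intro V _ _ F _ hF hn
    rcases isEmpty_or_nonempty V with hV | hV
    · have : n = 0 := by rw [← hn]; exact Fintype.card_eq_zero
      refine ⟨fun k hk _ => ?_, fun h => absurd ⟨id, fun x => rfl, fun x => hV.elim x⟩ h⟩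
      have : k = 0 := by omega
      subst this
      simp
    · obtain ⟨v, hv⟩ := exists_leaf F hF
      by_cases hw : ∃ w, F.Adj v w
      · obtain ⟨w, hvw⟩ := hw
        have hl : ∀ x, F.Adj v x → x = w := fun x hx => hv x w hx hvw
        have hcard : Fintype.card {x // blk v w x = 1} + 2 = n := by
          have h1 : Fintype.card {x // blk v w x = 1} = (Finset.univ \ {v, w} : Finset V).card := by
            rw [Fintype.card_subtype]
            congr 1
            ext x
            simp [blk1]
          have h2 := Finset.card_sdiff_add_card_eq_card (Finset.subset_univ ({v, w} : Finset V))
          rw [Finset.card_pair hvw.ne, Finset.card_univ] at h2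
          omega
        have := ih _ (by omega) (F.comap (Subtype.val : {x // blk v w x = 1} → V))
          (hF.of_comap ⟨_, Subtype.val_injective⟩) rfl
        rw [det_leaf_s15 F v w hvw hl, invol_leaf F v w hvw hl]
        refine ⟨fun k hk h => ?_, fun h => by rw [this.2 h, neg_zero]⟩
        obtain ⟨k, rfl⟩ : ∃ m, k = m + 1 := ⟨k - 1, by omega⟩
        rw [this.1 k (by omega) h, pow_succ]
        ring
      · have hd : (F.adjMatrix ℤ).det = 0 := by
          apply Matrix.det_eq_zero_of_row_eq_zero v
          intro j
          rw [adjMatrix_apply, if_neg (fun h => hw ⟨j, h⟩)]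
        exact ⟨fun k _ ⟨f, _, ha⟩ => absurd ⟨_, ha v⟩ hw, fun _ => hd⟩

/-- Let `F` be a forest with adjacency matrix `A(F)`.  If `F` has a perfect
matching and `2k` vertices then `det A(F) = (−1)^k`; if `F` has no perfect
matching then `det A(F) = 0`. -/
theorem det_adjMatrix_forest {V : Type*} [Fintype V] [DecidableEq V]
    (F : SimpleGraph V) [DecidableRel F.Adj] (hF : F.IsAcyclic) :
    (∀ k : ℕ, Fintype.card V = 2 * k → (∃ M : F.Subgraph, M.IsPerfectMatching) →
      (F.adjMatrix ℤ).det = (-1) ^ k) ∧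
      ((¬ ∃ M : F.Subgraph, M.IsPerfectMatching) → (F.adjMatrix ℤ).det = 0) := by
  rw [hasInvol_iff]
  exact forest_aux _ F hF rfl
end

section
/- Let T be a tree. Then the number of perfect matchings of the Cartesian product P_2 × T equals the product of (1 + θ²) taken over all non-negative eigenvalues θ (with multiplicity) of the adjacency matrix of T, where P_2 is the path on 2 vertices. -/
open SimpleGraph

/-- A permutation which moves every vertex along an edge or fixes it. -/
def PermOK {V : Type*} (T : SimpleGraph V) (σ : Equiv.Perm V) : Prop :=
  ∀ v, σ v = v ∨ T.Adj v (σ v)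

theorem PermOK.invol {V : Type*} [Finite V] {T : SimpleGraph V} (hT : T.IsAcyclic)
    {σ : Equiv.Perm V} (h : PermOK T σ) (v : V) : σ (σ v) = v := by
  rcases h v with h1 | hadj
  · rw [h1, h1]
  have hb : T.IsBridge s(v, σ v) := isAcyclic_iff_forall_adj_isBridge.mp hT hadj
  rw [isBridge_iff] at hb
  set G := T.deleteEdges {s(v, σ v)} with hG
  let C : Set V := {x | G.Reachable (σ v) x}
  have hvC : v ∉ C := fun hx => hb (Reachable.symm hx)
  have hex : ∃ x ∈ C, σ x ∉ C := by
    by_contra! hcon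
    have hm : Set.MapsTo σ C C := hcon
    have hs : Set.SurjOn σ C C := by
      intro y hy
      obtain ⟨x, hx⟩ := (Finite.injective_iff_surjective.mp
        ((hm.restrict_inj).mpr σ.injective.injOn)) ⟨y, hy⟩
      exact ⟨x, x.2, congrArg Subtype.val hx⟩
    have hσ : σ v ∈ C := Reachable.refl _
    obtain ⟨y, hy, hyv⟩ := hs hσ
    exact hvC (σ.injective hyv ▸ hy)
  obtain ⟨x, hx, hsx⟩ := hex
  have hxa : T.Adj x (σ x) := by
    rcases h x with h1 | h1
    · rw [h1] at hsx; exact absurd hx hsx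
    · exact h1
  have hna : ¬ G.Adj x (σ x) := fun ha => hsx (Reachable.trans hx ha.reachable)
  have he : s(x, σ x) = s(v, σ v) := by
    by_contra hne
    exact hna (by rw [hG, deleteEdges_adj]; exact ⟨hxa, hne⟩)
  rw [Sym2.eq_iff] at he
  rcases he with ⟨rfl, -⟩ | ⟨h1, h2⟩
  · exact absurd hx hvC
  · rw [← h1]; exact h2

theorem PermOK.term {V : Type*} [Fintype V] [DecidableEq V] {T : SimpleGraph V}
    [DecidableRel T.Adj] (hT : T.IsAcyclic)
    {σ : Equiv.Perm V} (h : PermOK T σ) :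
    ((Equiv.Perm.sign σ : ℤ) : ℂ) * ∏ v, (1 + Complex.I • T.adjMatrix ℂ) (σ v) v = 1 := by
  have h2 : σ ^ 2 = 1 := by
    ext v; simpa [pow_two] using h.invol hT v
  have hc := Equiv.Perm.cycleType_of_pow_prime_eq_one h2
  have hsum := σ.sum_cycleType
  have hprod : ∏ v, (1 + Complex.I • T.adjMatrix ℂ) (σ v) v = Complex.I ^ σ.support.card := by
    rw [← Finset.prod_const, ← Finset.prod_subset (Finset.subset_univ σ.support)]
    · refine Finset.prod_congr rfl fun v hv => ?_
      have hv' : σ v ≠ v := by simpa using hv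
      have ha : T.Adj (σ v) v := ((h v).resolve_left hv').symm
      simp [Matrix.one_apply, hv', ha]
    · intro v _ hv
      have hv' : σ v = v := by simpa using hv
      simp [hv']
  rw [hprod, Equiv.Perm.sign_of_cycleType, ← hsum, hc]
  simp only [Multiset.sum_replicate, Multiset.card_replicate, smul_eq_mul]
  generalize σ.cycleType.card = k
  push_cast
  rw [pow_add, mul_comm k 2, pow_mul, pow_mul, Complex.I_sq]
  simp [← mul_pow]

theorem det_eq_card {V : Type*} [Fintype V] [DecidableEq V] {T : SimpleGraph V}
    [DecidableRel T.Adj] (hT : T.IsAcyclic) :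
    (1 + Complex.I • T.adjMatrix ℂ).det = ((Set.ncard {σ : Equiv.Perm V | PermOK T σ} : ℕ) : ℂ) := by
  classical
  rw [Matrix.det_apply', Set.ncard_eq_toFinset_card', Finset.card_eq_sum_ones,
    Set.toFinset_ofPred, Finset.sum_filter]
  push_cast
  refine Finset.sum_congr rfl fun σ _ => ?_
  split_ifs with h
  · simpa using h.term hT
  · have : ∃ v, ¬ (σ v = v ∨ T.Adj v (σ v)) := by simpa [PermOK] using h
    obtain ⟨v, hv⟩ := this
    push Not at hv
    rw [Finset.prod_eq_zero (Finset.mem_univ v)]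
    · simp
    · have : ¬ T.Adj (σ v) v := fun h => hv.2 h.symm
      simp [Matrix.one_apply, hv.1, this]

/-- The matching attached to an admissible permutation. -/
def permSub {V : Type*} {T : SimpleGraph V} (σ : Equiv.Perm V) (hσ : ∀ v, σ (σ v) = v) :
    (pathGraph 2 □ T).Subgraph where
  verts := Set.univ
  Adj p q := (pathGraph 2 □ T).Adj p q ∧ σ p.2 = q.2
  adj_sub h := h.1
  edge_vert _ := trivial
  symm := ⟨fun p q h => ⟨h.1.symm, by rw [← h.2, hσ]⟩⟩

theorem box_adj {V : Type*} {T : SimpleGraph V} (p q : Fin 2 × V) :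
    (pathGraph 2 □ T).Adj p q ↔ (p.1 ≠ q.1 ∧ p.2 = q.2) ∨ (T.Adj p.2 q.2 ∧ p.1 = q.1) := by
  rw [boxProd_adj, pathGraph_two_eq_top, top_adj]

theorem pm_eq_card {V : Type*} [Finite V] {T : SimpleGraph V} (hT : T.IsAcyclic) :
    Pm (pathGraph 2 □ T) = Set.ncard {σ : Equiv.Perm V | PermOK T σ} := by
  symm
  have c := hT.coloringTwo
  have hcol : ∀ {x y}, T.Adj x y → c x ≠ c y := fun h => c.valid h
  have f2 : ∀ {a b d : Fin 2}, a ≠ b → d ≠ b → a = d := by decide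
  have hbox : ∀ x b y, (pathGraph 2 □ T).Adj (c x, x) (b, y) → b ≠ c y := by
    intro x b y h
    rw [box_adj] at h
    rcases h with ⟨h1, h2⟩ | ⟨h1, h2⟩
    · simp only at h1 h2; subst h2; exact h1.symm
    · simp only at h1 h2; subst h2; exact hcol h1
  refine Set.ncard_congr (fun σ h => permSub (T := T) σ (PermOK.invol hT h)) ?_ ?_ ?_
  · intro σ h
    rw [Set.mem_ofPred_eq, Subgraph.isPerfectMatching_iff]
    rintro ⟨a, v⟩
    rcases h v with h1 | h1
    · refine ⟨(1 - a, v), ⟨?_, h1⟩, ?_⟩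
      · rw [box_adj]; left; exact ⟨(by decide : ∀ a : Fin 2, a ≠ 1 - a) a, rfl⟩
      · rintro ⟨b, w⟩ ⟨h3, h4⟩
        simp only [h1] at h4
        subst h4
        rw [box_adj] at h3
        simp only [and_true, SimpleGraph.irrefl, false_and, or_false] at h3
        ext1
        · simp only; revert a b; decide
        · rfl
    · refine ⟨(a, σ v), ⟨?_, rfl⟩, ?_⟩
      · rw [box_adj]; right; exact ⟨h1, rfl⟩
      · rintro ⟨b, w⟩ ⟨h3, h4⟩
        simp only at h4
        subst h4
        rw [box_adj] at h3
        rcases h3 with ⟨_, h3⟩ | ⟨_, h3⟩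
        · exact absurd h3 h1.ne
        · simp only at h3; rw [h3]
  · intro σ τ h h' heq
    ext v
    have key : ∃ b, (permSub (T := T) σ (PermOK.invol hT h)).Adj (0, v) (b, σ v) := by
      rcases h v with h1 | h1
      · exact ⟨1, by rw [box_adj]; left; exact ⟨(by decide : (0 : Fin 2) ≠ 1), h1.symm⟩, rfl⟩
      · exact ⟨0, by rw [box_adj]; right; exact ⟨h1, rfl⟩, rfl⟩
    obtain ⟨b, hb⟩ := key
    rw [heq] at hb
    exact hb.2.symm
  · intro M hM
    rw [Set.mem_ofPred_eq, Subgraph.isPerfectMatching_iff] at hM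
    choose p hp hpu using fun v => hM (c v, v)
    have hne : ∀ v, (p v).1 ≠ c (p v).2 := fun v => hbox v _ _ (M.adj_sub (hp v))
    have hinj : Function.Injective fun v => (p v).2 := by
      intro v w hvw
      simp only at hvw
      have h1 : p v = p w := by
        ext1
        · exact f2 (hne v) (by rw [hvw]; exact hne w)
        · exact hvw
      have h3 := (hM (p v)).unique (hp v).symm (by rw [h1]; exact (hp w).symm)
      exact congrArg Prod.snd h3
    let σ : Equiv.Perm V := Equiv.ofBijective _ (Finite.injective_iff_bijective.mp hinj)
    have hσ : ∀ v, σ v = (p v).2 := fun v => rfl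
    have hok : PermOK T σ := by
      intro v
      have := M.adj_sub (hp v)
      rw [box_adj] at this
      rw [hσ]
      rcases this with h | h
      · exact Or.inl h.2.symm
      · exact Or.inr h.1
    have hinv := PermOK.invol hT hok
    have key : ∀ x b y, M.Adj (c x, x) (b, y) ↔ (pathGraph 2 □ T).Adj (c x, x) (b, y) ∧ σ x = y := by
      intro x b y
      constructor
      · intro h
        refine ⟨M.adj_sub h, ?_⟩
        rw [hσ, ← hpu x _ h]
      · rintro ⟨h1, h2⟩
        have : (b, y) = p x := by
          ext1
          · exact f2 (hbox _ _ _ h1) (by rw [← h2, hσ]; exact hne x)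
          · exact h2.symm
        rw [this]; exact hp x
    refine ⟨σ, hok, ?_⟩
    apply Subgraph.ext
    · ext q
      obtain ⟨w, hw, -⟩ := hM q
      simp [permSub, M.edge_vert hw]
    · ext ⟨a, x⟩ ⟨b, y⟩
      change ((pathGraph 2 □ T).Adj (a, x) (b, y) ∧ σ x = y) ↔ M.Adj (a, x) (b, y)
      by_cases ha : a = c x
      · subst ha; exact (key x b y).symm
      · have hby : (pathGraph 2 □ T).Adj (a, x) (b, y) → b = c y := by
          intro h
          rw [box_adj] at h
          rcases h with ⟨h1, h2⟩ | ⟨h1, h2⟩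
          · simp only at h1 h2; subst h2; exact f2 h1.symm (Ne.symm ha)
          · simp only at h1 h2; subst h2; exact f2 ha (hcol h1).symm
        constructor
        · rintro ⟨h1, h2⟩
          have := hby h1
          subst this
          exact ((key y a x).mpr ⟨h1.symm, by rw [← h2, hinv]⟩).symm
        · intro h
          have := hby (M.adj_sub h)
          subst this
          have h3 := (key y a x).mp h.symm
          exact ⟨h3.1.symm, by rw [← h3.2, hinv]⟩

theorem det_conj {V : Type*} [Fintype V] [DecidableEq V] {T : SimpleGraph V}
    [DecidableRel T.Adj] (c : T.Coloring (Fin 2)) (t : ℝ) :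
    (Matrix.scalar V t - T.adjMatrix ℝ).det = (Matrix.scalar V t + T.adjMatrix ℝ).det := by
  let D : Matrix V V ℝ := Matrix.diagonal fun v => if c v = 0 then 1 else -1
  have hDD : D * D = 1 := by
    rw [Matrix.diagonal_mul_diagonal, ← Matrix.diagonal_one]
    congr 1
    ext v
    split_ifs <;> simp
  have hD : D * (Matrix.scalar V t - T.adjMatrix ℝ) * D = Matrix.scalar V t + T.adjMatrix ℝ := by
    ext x y
    rw [Matrix.mul_diagonal, Matrix.diagonal_mul]
    by_cases hxy : x = y
    · subst hxy
      simp
      split_ifs <;> simp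
    · by_cases ha : T.Adj x y
      · have h1 := c.valid ha
        have : ∀ a b : Fin 2, a ≠ b → ((a = 0 ∧ b ≠ 0) ∨ (a ≠ 0 ∧ b = 0)) := by decide
        rcases this _ _ h1 with ⟨h2, h3⟩ | ⟨h2, h3⟩ <;> simp [hxy, ha, h2, h3]
      · simp [hxy, ha]
  rw [← hD, Matrix.det_mul, Matrix.det_mul, mul_comm, ← mul_assoc, ← Matrix.det_mul, hDD]
  simp

theorem roots_neg {V : Type*} [Fintype V] [DecidableEq V] {T : SimpleGraph V}
    [DecidableRel T.Adj] (c : T.Coloring (Fin 2)) :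
    (T.adjMatrix ℝ).charpoly.roots.map (fun x => -x) = (T.adjMatrix ℝ).charpoly.roots := by
  rw [← Polynomial.roots_comp_neg_X]
  have : (T.adjMatrix ℝ).charpoly.comp (-Polynomial.X) =
      Polynomial.C ((-1) ^ Fintype.card V) * (T.adjMatrix ℝ).charpoly := by
    apply Polynomial.funext
    intro t
    simp only [Polynomial.eval_comp, Polynomial.eval_neg, Polynomial.eval_X, Polynomial.eval_mul,
      Polynomial.eval_C, Matrix.eval_charpoly]
    rw [det_conj c, ← Matrix.det_neg]
    congr 1
    rw [map_neg]; abel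
  rw [this, Polynomial.roots_C_mul]
  exact pow_ne_zero _ (by norm_num)

theorem filter_prod {α M : Type*} [CommMonoid M] (s : Multiset α) (p : α → Prop) [DecidablePred p]
    (g : α → M) : ((s.filter p).map g).prod = (s.map fun x => if p x then g x else 1).prod := by
  induction s using Multiset.induction_on with
  | empty => simp
  | cons a s ih => by_cases h : p a <;> simp [h, ih]

theorem prod_sym (s : Multiset ℝ) (hs : s.map (fun x => -x) = s) :
    (s.map fun x : ℝ => 1 + Complex.I * (x : ℂ)).prod =
      ((((s.filter (fun θ => 0 ≤ θ)).map (fun θ => 1 + θ ^ 2)).prod : ℝ) : ℂ) := by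
  have h1 : (s.map fun x : ℝ => if x < 0 then 1 + Complex.I * (x : ℂ) else 1).prod =
      (s.map fun x : ℝ => if 0 < x then 1 - Complex.I * (x : ℂ) else 1).prod := by
    conv_lhs => rw [← hs]
    rw [Multiset.map_map]
    congr 2
    ext x
    simp [sub_eq_add_neg]
  have h2 : (s.map fun x : ℝ => 1 + Complex.I * (x : ℂ)).prod =
      (s.map fun x : ℝ => if 0 ≤ x then 1 + Complex.I * (x : ℂ) else 1).prod *
      (s.map fun x : ℝ => if x < 0 then 1 + Complex.I * (x : ℂ) else 1).prod := by
    rw [← Multiset.prod_map_mul]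
    congr 2
    ext x
    by_cases h : 0 ≤ x
    · simp [h, not_lt.mpr h]
    · simp [h, not_le.mp h]
  rw [h2, h1, ← Multiset.prod_map_mul, filter_prod, ← Complex.ofRealHom_eq_coe, map_multiset_prod,
    Multiset.map_map]
  congr 2
  ext1 x
  rcases lt_trichotomy x 0 with h | h | h
  · simp [not_le.mpr h, not_lt.mpr h.le]
  · simp [h]
  · simp only [h, h.le, if_true, Function.comp, Complex.ofRealHom_eq_coe]
    push_cast
    linear_combination (-(x : ℂ) ^ 2) * Complex.I_sq

theorem det_roots {V : Type*} [Fintype V] [DecidableEq V] (T : SimpleGraph V)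
    [DecidableRel T.Adj] : (1 + Complex.I • T.adjMatrix ℂ).det =
    ((T.adjMatrix ℝ).charpoly.roots.map fun x : ℝ => 1 + Complex.I * (x : ℂ)).prod := by
  have hA : (T.adjMatrix ℝ).IsHermitian := by
    ext i j; simp [T.adj_comm]
  have hm : T.adjMatrix ℂ = (T.adjMatrix ℝ).map Complex.ofRealHom := by
    ext i j; simp [adjMatrix_apply, apply_ite]
  have h1 : (T.adjMatrix ℂ).charpoly.eval Complex.I =
      ∏ i, (Complex.I - (hA.eigenvalues i : ℂ)) := by
    rw [hm, Matrix.charpoly_map, hA.charpoly_eq]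
    simp [Polynomial.map_prod, Polynomial.eval_prod]
  rw [Matrix.eval_charpoly] at h1
  have h2 : (1 + Complex.I • T.adjMatrix ℂ) =
      (-Complex.I) • (Matrix.scalar V Complex.I - T.adjMatrix ℂ) := by
    ext i j
    by_cases h : i = j
    · simp [h]
    · by_cases ha : T.Adj i j <;> simp [h, ha]
  rw [h2, Matrix.det_smul, h1, hA.roots_charpoly_eq_eigenvalues, Multiset.map_map,
    ← Finset.card_univ, ← Finset.prod_const, ← Finset.prod_mul_distrib, Finset.prod]
  congr 2
  ext i
  simp only [Function.comp, RCLike.ofReal_real_eq_id, id]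
  linear_combination -Complex.I_sq

/-- For a tree `T`, `Pm(P_2 × T) = ∏ (1 + θ²)`, the product ranging over all
non-negative eigenvalues `θ` (with multiplicity) of `T`. -/
theorem pm_p2_boxProd_tree {V : Type*} [Fintype V] [DecidableEq V]
    (T : SimpleGraph V) [DecidableRel T.Adj] (hT : T.IsTree) :
    (Pm (pathGraph 2 □ T) : ℝ) =
      ((((T.adjMatrix ℝ).charpoly.roots).filter (fun θ => 0 ≤ θ)).map
        (fun θ => 1 + θ ^ 2)).prod := by
  have hac : T.IsAcyclic := hT.isAcyclic
  have h1 := prod_sym _ (roots_neg hac.coloringTwo)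
  rw [← det_roots, det_eq_card hac, ← pm_eq_card hac] at h1
  exact_mod_cast h1
end

section
/- Let T be a tree on n vertices, let r be the maximum number of edges in a matching of T, and set s = n − 2r. Let ±θ_1, ±θ_2, …, ±θ_r be the nonzero eigenvalues (with multiplicity) of the adjacency matrix of T (so that 0 is an eigenvalue with multiplicity s). Then the number of perfect matchings of C_4 × T equals 2^s · ∏_{j=1}^{r} (2 + θ_j²)². -/
open SimpleGraph

section Haf
variable {α : Type*} [Fintype α] [DecidableEq α]

def IsPMOn (S : Finset α) (M : Finset (Sym2 α)) : Prop :=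
  (∀ a b, s(a, b) ∈ M → a ≠ b ∧ a ∈ S) ∧ ∀ v ∈ S, ∃! u, s(v, u) ∈ M

open Classical in
noncomputable def haf (f : Sym2 α → ℝ) (S : Finset α) : ℝ :=
  ∑ M ∈ Finset.univ.filter (IsPMOn S), ∏ e ∈ M, f e

lemma IsPMOn.snd {S : Finset α} {M : Finset (Sym2 α)} (h : IsPMOn S M) {a b : α}
    (hab : s(a, b) ∈ M) : b ∈ S := (h.1 b a (by rwa [Sym2.eq_swap])).2

lemma haf_empty (f : Sym2 α → ℝ) : haf f ∅ = 1 := by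
  classical
  have : (Finset.univ.filter (IsPMOn (∅ : Finset α))) = {∅} := by
    ext M
    simp only [Finset.mem_filter, Finset.mem_univ, true_and, Finset.mem_singleton]
    constructor
    · intro h
      rw [Finset.eq_empty_iff_forall_notMem]
      intro e
      induction e with
      | h a b => intro he; simpa using (h.1 a b he).2
    · rintro rfl
      constructor <;> simp
  simp [haf, this]

lemma haf_congr {f g : Sym2 α → ℝ} {S : Finset α}
    (h : ∀ a ∈ S, ∀ b ∈ S, f s(a, b) = g s(a, b)) : haf f S = haf g S := by
  classical
  unfold haf
  refine Finset.sum_congr rfl fun M hM => Finset.prod_congr rfl fun e he => ?_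
  simp only [Finset.mem_filter, Finset.mem_univ, true_and] at hM
  induction e with
  | h a b => exact h a (hM.1 a b he).2 b (hM.snd he)

lemma isPMOn_erase {S : Finset α} {M : Finset (Sym2 α)} {v x : α} (h : IsPMOn S M)
    (hx : s(v, x) ∈ M) : IsPMOn ((S.erase v).erase x) (M.erase s(v, x)) := by
  have hv := (h.1 _ _ hx)
  have hxS := h.snd hx
  have hx' : s(x, v) ∈ M := by rwa [Sym2.eq_swap]
  constructor
  · intro a b hab
    rw [Finset.mem_erase] at hab
    obtain ⟨h1, h2⟩ := hab
    refine ⟨(h.1 _ _ h2).1, ?_⟩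
    simp only [Finset.mem_erase]
    refine ⟨?_, ?_, (h.1 _ _ h2).2⟩
    · rintro rfl
      obtain rfl := (h.2 a hxS).unique h2 hx'
      exact h1 Sym2.eq_swap
    · rintro rfl
      obtain rfl := (h.2 a hv.2).unique h2 hx
      exact h1 rfl
  · intro a ha
    simp only [Finset.mem_erase] at ha
    obtain ⟨u, hu, huu⟩ := h.2 a ha.2.2
    refine ⟨u, ?_, ?_⟩
    · simp only [Finset.mem_erase]
      refine ⟨?_, hu⟩
      intro h'
      rw [Sym2.eq_iff] at h'
      grind
    · intro y hy
      exact huu y (Finset.mem_of_mem_erase hy)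

lemma isPMOn_insert {S : Finset α} {M : Finset (Sym2 α)} {v x : α} (hv : v ∈ S) (hx : x ∈ S)
    (hvx : v ≠ x) (h : IsPMOn ((S.erase v).erase x) M) :
    s(v, x) ∉ M ∧ IsPMOn S (insert s(v, x) M) := by
  have key : ∀ a b, s(a, b) ∈ M → a ≠ v ∧ a ≠ x ∧ b ≠ v ∧ b ≠ x := by
    intro a b hab
    have h1 := (h.1 _ _ hab).2
    have h2 := h.snd hab
    simp only [Finset.mem_erase] at h1 h2
    tauto
  refine ⟨fun h' => (key _ _ h').1 rfl, ?_, ?_⟩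
  · intro a b hab
    rw [Finset.mem_insert] at hab
    rcases hab with hab | hab
    · rw [Sym2.eq_iff] at hab
      grind
    · have := h.1 _ _ hab
      simp only [Finset.mem_erase] at this
      tauto
  · intro a ha
    by_cases hav : a = v
    · subst hav
      refine ⟨x, by simp, ?_⟩
      intro y hy
      rw [Finset.mem_insert, Sym2.eq_iff] at hy
      grind
    · by_cases hax : a = x
      · subst hax
        refine ⟨v, by simp [Sym2.eq_swap], ?_⟩
        intro y hy
        rw [Finset.mem_insert, Sym2.eq_iff] at hy
        grind
      · obtain ⟨u, hu, huu⟩ := h.2 a (by simp [*])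
        refine ⟨u, by simp [hu], ?_⟩
        intro y hy
        rw [Finset.mem_insert, Sym2.eq_iff] at hy
        grind

lemma haf_expand (f : Sym2 α → ℝ) {S : Finset α} {v : α} (hv : v ∈ S) :
    haf f S = ∑ x ∈ S.erase v, f s(v, x) * haf f ((S.erase v).erase x) := by
  classical
  have h1 : haf f S = ∑ M ∈ Finset.univ.filter (IsPMOn S), ∑ x ∈ S.erase v,
      if s(v, x) ∈ M then ∏ e ∈ M, f e else 0 := by
    refine Finset.sum_congr rfl fun M hM => ?_
    simp only [Finset.mem_filter, Finset.mem_univ, true_and] at hM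
    obtain ⟨u, hu, huu⟩ := hM.2 v hv
    rw [Finset.sum_eq_single u]
    · simp [hu]
    · intro b _ hb
      rw [if_neg]
      intro h; exact hb (huu b h)
    · intro h
      exact absurd (Finset.mem_erase.2 ⟨(hM.1 _ _ hu).1.symm, hM.snd hu⟩) h
  rw [h1, Finset.sum_comm]
  refine Finset.sum_congr rfl fun x hx => ?_
  rw [Finset.mem_erase] at hx
  rw [← Finset.sum_filter, haf, Finset.mul_sum]
  refine Finset.sum_nbij' (fun M => M.erase s(v, x)) (fun M => insert s(v, x) M) ?_ ?_ ?_ ?_ ?_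
  · intro M hM
    simp only [Finset.mem_filter, Finset.mem_univ, true_and] at hM ⊢
    exact isPMOn_erase hM.1 hM.2
  · intro M hM
    simp only [Finset.mem_filter, Finset.mem_univ, true_and] at hM ⊢
    exact ⟨(isPMOn_insert hv hx.2 hx.1.symm hM).2, by simp⟩
  · intro M hM
    simp only [Finset.mem_filter, Finset.mem_univ, true_and] at hM ⊢
    exact Finset.insert_erase hM.2
  · intro M hM
    simp only [Finset.mem_filter, Finset.mem_univ, true_and] at hM ⊢
    exact Finset.erase_insert (isPMOn_insert hv hx.2 hx.1.symm hM).1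
  · intro M hM
    simp only [Finset.mem_filter, Finset.mem_univ, true_and] at hM ⊢
    exact (Finset.mul_prod_erase M f hM.2).symm

lemma haf_add_edge (f : Sym2 α → ℝ) (c : ℝ) {a b : α} (hab : a ≠ b) (S : Finset α) :
    haf (fun e => f e + if e = s(a, b) then c else 0) S =
      haf f S + if a ∈ S ∧ b ∈ S then c * haf f ((S.erase a).erase b) else 0 := by
  by_cases ha : a ∈ S
  · rw [haf_expand _ ha, haf_expand f ha]
    have h : ∀ x, haf (fun e => f e + if e = s(a, b) then c else 0) ((S.erase a).erase x)
        = haf f ((S.erase a).erase x) := by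
      intro x
      apply haf_congr
      intro y hy z hz
      rw [if_neg, add_zero]
      simp only [Finset.mem_erase] at hy hz
      rw [Sym2.eq_iff]
      tauto
    simp only [h, add_mul, Finset.sum_add_distrib]
    congr 1
    by_cases hb : b ∈ S
    · rw [Finset.sum_eq_single b]
      · simp [ha, hb]
      · intro x hx hxb
        rw [if_neg, zero_mul]
        rw [Sym2.eq_iff]; grind
      · intro h; simp [hb, hab.symm] at h
    · rw [if_neg (by tauto)]
      apply Finset.sum_eq_zero
      intro x hx
      rw [if_neg, zero_mul]
      rw [Sym2.eq_iff]; grind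
  · rw [if_neg (by tauto), add_zero]
    apply haf_congr
    intro y hy z hz
    rw [if_neg, add_zero]
    rw [Sym2.eq_iff]
    grind
end Haf

open Classical in
lemma pm_eq_haf {α : Type*} [Fintype α] [DecidableEq α] (G : SimpleGraph α) :
    (Set.ncard {M : G.Subgraph | M.IsPerfectMatching} : ℝ) =
      haf (fun e => if e ∈ G.edgeSet then 1 else 0) (Finset.univ : Finset α) := by
  have h1 : haf (fun e => if e ∈ G.edgeSet then (1:ℝ) else 0) (Finset.univ : Finset α) =
      ((Finset.univ.filter (fun M : Finset (Sym2 α) => IsPMOn Finset.univ M ∧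
        ∀ e ∈ M, e ∈ G.edgeSet)).card : ℝ) := by
    rw [haf, Finset.card_filter, Finset.sum_filter]
    push_cast
    refine Finset.sum_congr rfl fun M _ => ?_
    by_cases h : IsPMOn Finset.univ M <;> simp only [h, if_true, if_false, true_and, false_and]
    rw [Finset.prod_ite_zero]
    simp
  rw [h1]
  norm_cast
  rw [← Set.ncard_coe_finset]
  refine Set.ncard_congr (fun M _ => Finset.univ.filter (· ∈ M.edgeSet)) ?_ ?_ ?_
  · intro M hM
    rw [Set.mem_ofPred_eq, Subgraph.isPerfectMatching_iff] at hM
    simp only [Finset.coe_filter, Finset.mem_univ, true_and, Set.mem_ofPred_eq, IsPMOn,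
      Finset.mem_filter]
    refine ⟨⟨?_, ?_⟩, ?_⟩
    · intro a b h
      exact ⟨(M.adj_sub h).ne, trivial⟩
    · intro v _
      exact hM v
    · intro e he
      exact M.edgeSet_subset he
  · intro M N hM hN h
    apply Subgraph.IsMatching.injOn_edgeSet hM.1 hN.1
    ext e
    simpa using congrArg (e ∈ ·) h
  · intro M hM
    simp only [Finset.coe_filter, Finset.mem_univ, true_and, Set.mem_ofPred_eq] at hM
    refine ⟨{ verts := Set.univ, Adj := fun a b => s(a, b) ∈ M, adj_sub := fun h => hM.2 _ h,
              edge_vert := fun _ => trivial,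
              symm := ⟨fun a b h => by rwa [Sym2.eq_swap]⟩ }, ?_, ?_⟩
    · rw [Set.mem_ofPred_eq, Subgraph.isPerfectMatching_iff]
      intro v
      exact hM.1.2 v (Finset.mem_univ _)
    · ext e
      induction e with
      | h a b => simp

lemma leaf_calc (c : ℝ) (G : Finset (Fin 4) → Finset (Fin 4) → ℝ)
    (hrec : ∀ L U i, i ∈ L → G L U =
      (if i + 1 ∈ L then c * G ((L.erase i).erase (i + 1)) U else 0)
      + (if i + 3 ∈ L then c * G ((L.erase i).erase (i + 3)) U else 0)
      + (if i ∈ U then G (L.erase i) (U.erase i) else 0)) :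
    G {0, 1, 2, 3} {0, 1, 2, 3} = 2 * c ^ 2 * G ∅ {0, 1, 2, 3}
      + c * (G ∅ {0, 1} + G ∅ {1, 2} + G ∅ {2, 3} + G ∅ {0, 3}) + G ∅ ∅ := by
  have a1 := hrec {0, 1, 2, 3} {0, 1, 2, 3} 0 (by decide)
  have a2 := hrec {2, 3} {0, 1, 2, 3} 2 (by decide)
  have a3 := hrec {1, 2} {0, 1, 2, 3} 1 (by decide)
  have a4 := hrec {1, 2, 3} {1, 2, 3} 1 (by decide)
  have a5 := hrec {2, 3} {2, 3} 2 (by decide)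
  have b1 := hrec {3} {0, 1, 3} 3 (by decide)
  have b2 := hrec {2} {0, 2, 3} 2 (by decide)
  have b3 := hrec {3} {1, 2, 3} 3 (by decide)
  have b4 := hrec {3} {3} 3 (by decide)
  rw [if_pos (by decide), if_pos (by decide), if_pos (by decide),
    show ((({0, 1, 2, 3} : Finset (Fin 4)).erase 0).erase (0 + 1)) = {2, 3} by decide,
    show ((({0, 1, 2, 3} : Finset (Fin 4)).erase 0).erase (0 + 3)) = {1, 2} by decide,
    show (({0, 1, 2, 3} : Finset (Fin 4)).erase 0) = {1, 2, 3} by decide] at a1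
  rw [if_pos (by decide), if_neg (by decide), if_pos (by decide),
    show ((({2, 3} : Finset (Fin 4)).erase 2).erase (2 + 1)) = ∅ by decide,
    show (({2, 3} : Finset (Fin 4)).erase 2) = {3} by decide,
    show (({0, 1, 2, 3} : Finset (Fin 4)).erase 2) = {0, 1, 3} by decide] at a2
  rw [if_pos (by decide), if_neg (by decide), if_pos (by decide),
    show ((({1, 2} : Finset (Fin 4)).erase 1).erase (1 + 1)) = ∅ by decide,
    show (({1, 2} : Finset (Fin 4)).erase 1) = {2} by decide,
    show (({0, 1, 2, 3} : Finset (Fin 4)).erase 1) = {0, 2, 3} by decide] at a3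
  rw [if_pos (by decide), if_neg (by decide), if_pos (by decide),
    show ((({1, 2, 3} : Finset (Fin 4)).erase 1).erase (1 + 1)) = {3} by decide,
    show (({1, 2, 3} : Finset (Fin 4)).erase 1) = {2, 3} by decide] at a4
  rw [if_pos (by decide), if_neg (by decide), if_pos (by decide),
    show ((({2, 3} : Finset (Fin 4)).erase 2).erase (2 + 1)) = ∅ by decide,
    show (({2, 3} : Finset (Fin 4)).erase 2) = {3} by decide] at a5
  rw [if_neg (by decide), if_neg (by decide), if_pos (by decide),
    show (({3} : Finset (Fin 4)).erase 3) = ∅ by decide,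
    show (({0, 1, 3} : Finset (Fin 4)).erase 3) = {0, 1} by decide] at b1
  rw [if_neg (by decide), if_neg (by decide), if_pos (by decide),
    show (({2} : Finset (Fin 4)).erase 2) = ∅ by decide,
    show (({0, 2, 3} : Finset (Fin 4)).erase 2) = {0, 3} by decide] at b2
  rw [if_neg (by decide), if_neg (by decide), if_pos (by decide),
    show (({3} : Finset (Fin 4)).erase 3) = ∅ by decide,
    show (({1, 2, 3} : Finset (Fin 4)).erase 3) = {1, 2} by decide] at b3
  rw [if_neg (by decide), if_neg (by decide), if_pos (by decide),
    show (({3} : Finset (Fin 4)).erase 3) = ∅ by decide] at b4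
  rw [a1, a2, a3, a4, a5, b1, b2, b3, b4]
  ring

lemma iso_calc (c : ℝ) (G : Finset (Fin 4) → ℝ)
    (hrec : ∀ L i, i ∈ L → G L =
      (if i + 1 ∈ L then c * G ((L.erase i).erase (i + 1)) else 0)
      + (if i + 3 ∈ L then c * G ((L.erase i).erase (i + 3)) else 0)) :
    G {0, 1, 2, 3} = 2 * c ^ 2 * G ∅ := by
  have a1 := hrec {0, 1, 2, 3} 0 (by decide)
  have a2 := hrec {2, 3} 2 (by decide)
  have a3 := hrec {1, 2} 1 (by decide)
  rw [if_pos (by decide), if_pos (by decide),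
    show ((({0, 1, 2, 3} : Finset (Fin 4)).erase 0).erase (0 + 1)) = {2, 3} by decide,
    show ((({0, 1, 2, 3} : Finset (Fin 4)).erase 0).erase (0 + 3)) = {1, 2} by decide] at a1
  rw [if_pos (by decide), if_neg (by decide),
    show ((({2, 3} : Finset (Fin 4)).erase 2).erase (2 + 1)) = ∅ by decide] at a2
  rw [if_pos (by decide), if_neg (by decide),
    show ((({1, 2} : Finset (Fin 4)).erase 1).erase (1 + 1)) = ∅ by decide] at a3
  rw [a1, a2, a3]
  ring

section Layers
variable {V : Type*} [Fintype V] [DecidableEq V]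

def lay (L : Finset (Fin 4)) (v : V) (R : Finset (Fin 4 × V)) : Finset (Fin 4 × V) :=
  L.image (fun i => (i, v)) ∪ R

lemma mem_lay {L : Finset (Fin 4)} {v : V} {R : Finset (Fin 4 × V)} {x : Fin 4 × V} :
    x ∈ lay L v R ↔ (x.1 ∈ L ∧ x.2 = v) ∨ x ∈ R := by
  obtain ⟨i, w⟩ := x
  simp only [lay, Finset.mem_union, Finset.mem_image, Prod.mk.injEq]
  constructor
  · rintro (⟨a, h, rfl, rfl⟩ | h)
    · exact Or.inl ⟨h, rfl⟩
    · exact Or.inr h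
  · rintro (⟨h, rfl⟩ | h)
    · exact Or.inl ⟨i, h, rfl, rfl⟩
    · exact Or.inr h

lemma lay_empty (v : V) (R : Finset (Fin 4 × V)) : lay ∅ v R = R := by simp [lay]

lemma lay_erase {L : Finset (Fin 4)} {v : V} {R : Finset (Fin 4 × V)} (i : Fin 4)
    (hR : ∀ x ∈ R, x.2 ≠ v) : (lay L v R).erase (i, v) = lay (L.erase i) v R := by
  ext ⟨j, w⟩
  have := hR (j, w)
  simp only [Finset.mem_erase, mem_lay, ne_eq, Prod.mk.injEq]
  grind

lemma lay_erase_right {L : Finset (Fin 4)} {v : V} {R : Finset (Fin 4 × V)} (x : Fin 4 × V)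
    (hx : x.2 ≠ v) : (lay L v R).erase x = lay L v (R.erase x) := by
  obtain ⟨i, u⟩ := x
  ext ⟨j, w⟩
  simp only [Finset.mem_erase, mem_lay, ne_eq, Prod.mk.injEq] at hx ⊢
  grind

lemma haf_lay (f : Sym2 (Fin 4 × V) → ℝ) {c : ℝ} {v : V}
    (hc : ∀ i j, f s((i, v), (j, v)) = if j = i + 1 ∨ i = j + 1 then c else 0)
    {L : Finset (Fin 4)} {R : Finset (Fin 4 × V)} (hR : ∀ x ∈ R, x.2 ≠ v) {i : Fin 4}
    (hi : i ∈ L) :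
    haf f (lay L v R) =
      (if i + 1 ∈ L then c * haf f (lay ((L.erase i).erase (i + 1)) v R) else 0)
      + (if i + 3 ∈ L then c * haf f (lay ((L.erase i).erase (i + 3)) v R) else 0)
      + ∑ x ∈ R, f s((i, v), x) * haf f (lay (L.erase i) v (R.erase x)) := by
  rw [haf_expand f (v := (i, v)) (by simp [mem_lay, hi]), lay_erase i hR]
  have hdisj : Disjoint ((L.erase i).image (fun i => (i, v))) R := by
    rw [Finset.disjoint_left]
    intro x hx hx'
    rw [Finset.mem_image] at hx
    obtain ⟨j, _, rfl⟩ := hx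
    exact hR _ hx' rfl
  have hs : ∀ g : Fin 4 × V → ℝ, ∑ x ∈ lay (L.erase i) v R, g x =
      ∑ j ∈ L.erase i, g (j, v) + ∑ x ∈ R, g x := by
    intro g
    rw [lay, Finset.sum_union hdisj, Finset.sum_image]
    intro a _ b _ h
    exact (Prod.mk.inj h).1
  rw [hs]
  congr 1
  · have : ∀ j ∈ L.erase i, f s((i, v), (j, v)) * haf f ((lay (L.erase i) v R).erase (j, v)) =
        (if j = i + 1 then c * haf f (lay ((L.erase i).erase (i + 1)) v R) else 0)
        + (if j = i + 3 then c * haf f (lay ((L.erase i).erase (i + 3)) v R) else 0) := by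
      intro j _
      rw [lay_erase j hR, hc]
      have key : ∀ i j : Fin 4, i = j + 1 ↔ j = i + 3 := by decide
      have hij := key i j
      simp only [hij]
      have key2 : ∀ i : Fin 4, i + 1 ≠ i + 3 := by decide
      have hne := key2 i
      by_cases h1 : j = i + 1
      · subst h1; simp [hne]
      · by_cases h2 : j = i + 3
        · subst h2; simp [hne.symm]
        · simp [h1, h2]
    rw [Finset.sum_congr rfl this, Finset.sum_add_distrib, Finset.sum_ite_eq',
      Finset.sum_ite_eq']
    have h1 : i + 1 ∈ L.erase i ↔ i + 1 ∈ L := by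
      rw [Finset.mem_erase]; simp
    have h3 : i + 3 ∈ L.erase i ↔ i + 3 ∈ L := by
      rw [Finset.mem_erase]; simp
    simp only [h1, h3]
  · refine Finset.sum_congr rfl fun x hx => ?_
    rw [lay_erase_right x (hR x hx)]

lemma haf_iso (f : Sym2 (Fin 4 × V) → ℝ) {c : ℝ} {v : V}
    (hc : ∀ i j, f s((i, v), (j, v)) = if j = i + 1 ∨ i = j + 1 then c else 0)
    {R : Finset (Fin 4 × V)} (hR : ∀ x ∈ R, x.2 ≠ v) (h0 : ∀ i, ∀ x ∈ R, f s((i, v), x) = 0) :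
    haf f (lay {0, 1, 2, 3} v R) = 2 * c ^ 2 * haf f R := by
  have := iso_calc c (fun L => haf f (lay L v R)) (fun L i hi => by
    rw [haf_lay f hc hR hi, Finset.sum_eq_zero (s := R), add_zero]
    intro x hx
    rw [h0 i x hx, zero_mul])
  simpa only [lay_empty] using this

lemma haf_leaf (f : Sym2 (Fin 4 × V) → ℝ) {c : ℝ} {v u : V} (huv : u ≠ v)
    (hc : ∀ i j, f s((i, v), (j, v)) = if j = i + 1 ∨ i = j + 1 then c else 0)
    {R : Finset (Fin 4 × V)} (hR : ∀ x ∈ R, x.2 ≠ v ∧ x.2 ≠ u)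
    (h0 : ∀ i x, x.2 ≠ v → f s((i, v), x) = if x = (i, u) then 1 else 0) :
    haf f (lay {0, 1, 2, 3} v (lay {0, 1, 2, 3} u R)) =
      2 * c ^ 2 * haf f (lay {0, 1, 2, 3} u R)
      + c * (haf f (lay {0, 1} u R) + haf f (lay {1, 2} u R) + haf f (lay {2, 3} u R)
        + haf f (lay {0, 3} u R)) + haf f R := by
  have hR' : ∀ U : Finset (Fin 4), ∀ x ∈ lay U u R, x.2 ≠ v := by
    intro U x hx
    rw [mem_lay] at hx
    rcases hx with hx | hx
    · rw [hx.2]; exact huv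
    · exact (hR x hx).1
  have := leaf_calc c (fun L U => haf f (lay L v (lay U u R))) (fun L U i hi => by
    rw [haf_lay f hc (hR' U) hi]
    congr 1
    have : ∀ x ∈ lay U u R, f s((i, v), x) * haf f (lay (L.erase i) v ((lay U u R).erase x)) =
        if x = (i, u) then haf f (lay (L.erase i) v (lay (U.erase i) u R)) else 0 := by
      intro x hx
      rw [h0 i x (hR' U x hx)]
      by_cases h : x = (i, u)
      · subst h
        rw [if_pos rfl, if_pos rfl, one_mul, lay_erase i (fun x hx => (hR x hx).2)]
      · rw [if_neg h, if_neg h, zero_mul]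
    rw [Finset.sum_congr rfl this, Finset.sum_ite_eq']
    have h2 : (i, u) ∈ lay U u R ↔ i ∈ U := by
      rw [mem_lay]
      have := hR (i, u)
      simp only at this ⊢
      tauto
    simp only [h2])
  simpa only [lay_empty] using this

lemma haf_add (f g : Sym2 (Fin 4 × V) → ℝ) {ε : ℝ} {u : V}
    {R : Finset (Fin 4 × V)} (hR : ∀ x ∈ R, x.2 ≠ u)
    (h : ∀ x ∈ lay {0, 1, 2, 3} u R, ∀ y ∈ lay {0, 1, 2, 3} u R,
      g s(x, y) = f s(x, y) + if x.2 = u ∧ y.2 = u ∧ (y.1 = x.1 + 1 ∨ x.1 = y.1 + 1)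
        then ε else 0) :
    haf g (lay {0, 1, 2, 3} u R) = haf f (lay {0, 1, 2, 3} u R)
      + ε * (haf f (lay {0, 1} u R) + haf f (lay {1, 2} u R) + haf f (lay {2, 3} u R)
        + haf f (lay {0, 3} u R)) + 2 * ε ^ 2 * haf f R := by
  let f1 : Sym2 (Fin 4 × V) → ℝ := fun e => f e + if e = s((0, u), (1, u)) then ε else 0
  let f2 : Sym2 (Fin 4 × V) → ℝ := fun e => f1 e + if e = s((1, u), (2, u)) then ε else 0
  let f3 : Sym2 (Fin 4 × V) → ℝ := fun e => f2 e + if e = s((2, u), (3, u)) then ε else 0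
  let f4 : Sym2 (Fin 4 × V) → ℝ := fun e => f3 e + if e = s((3, u), (0, u)) then ε else 0
  have hg : haf g (lay {0, 1, 2, 3} u R) = haf f4 (lay {0, 1, 2, 3} u R) := by
    apply haf_congr
    intro x hx y hy
    rw [h x hx y hy]
    obtain ⟨i, a⟩ := x
    obtain ⟨j, b⟩ := y
    simp only [f4, f3, f2, f1, add_assoc, add_right_inj, Sym2.eq_iff, Prod.mk.injEq]
    by_cases ha : a = u
    · by_cases hb : b = u
      · simp only [ha, hb, true_and, and_true]
        clear h hx hy
        fin_cases i <;> fin_cases j <;> simp +decide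
      · simp [hb]
    · simp [ha]
  have hmem : ∀ (U : Finset (Fin 4)) (i : Fin 4), (i, u) ∈ lay U u R ↔ i ∈ U := by
    intro U i
    rw [mem_lay]
    have := hR (i, u)
    simp only at this ⊢
    tauto
  have step : ∀ (f : Sym2 (Fin 4 × V) → ℝ) (i j : Fin 4), i ≠ j → ∀ U : Finset (Fin 4),
      haf (fun e => f e + if e = s((i, u), (j, u)) then ε else 0) (lay U u R) =
      haf f (lay U u R) + if i ∈ U ∧ j ∈ U then ε * haf f (lay ((U.erase i).erase j) u R)
        else 0 := by
    intro f i j hij U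
    rw [haf_add_edge f ε (by simpa using hij), lay_erase i hR, lay_erase j hR]
    simp only [hmem]
  have s1 : ∀ U, haf f1 (lay U u R) = _ := step f 0 1 (by decide)
  have s2 : ∀ U, haf f2 (lay U u R) = _ := step f1 1 2 (by decide)
  have s3 : ∀ U, haf f3 (lay U u R) = _ := step f2 2 3 (by decide)
  have s4 : ∀ U, haf f4 (lay U u R) = _ := step f3 3 0 (by decide)
  rw [hg, s4, if_pos (by decide),
    show ((({0, 1, 2, 3} : Finset (Fin 4)).erase 3).erase 0) = {1, 2} by decide,
    s3 {0, 1, 2, 3}, s3 {1, 2}, if_pos (by decide), if_neg (by decide),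
    show ((({0, 1, 2, 3} : Finset (Fin 4)).erase 2).erase 3) = {0, 1} by decide,
    s2 {0, 1, 2, 3}, s2 {0, 1}, s2 {1, 2}, if_pos (by decide), if_neg (by decide),
    if_pos (by decide),
    show ((({0, 1, 2, 3} : Finset (Fin 4)).erase 1).erase 2) = {0, 3} by decide,
    show ((({1, 2} : Finset (Fin 4)).erase 1).erase 2) = ∅ by decide,
    s1 {0, 1, 2, 3}, s1 {0, 1}, s1 {1, 2}, s1 {0, 3}, s1 ∅, if_pos (by decide),
    if_neg (by decide), if_pos (by decide), if_neg (by decide), if_neg (by decide),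
    show ((({0, 1, 2, 3} : Finset (Fin 4)).erase 0).erase 1) = {2, 3} by decide,
    show ((({0, 1} : Finset (Fin 4)).erase 0).erase 1) = ∅ by decide, lay_empty]
  ring
end Layers

section Main
variable {V : Type*} [Fintype V] [DecidableEq V]

open Classical in
noncomputable def wt (T : SimpleGraph V) (w : V → ℝ) : Sym2 (Fin 4 × V) → ℝ :=
  Sym2.lift ⟨fun x y => if x.2 = y.2 then (if y.1 = x.1 + 1 ∨ x.1 = y.1 + 1 then w x.2 else 0)
    else if x.1 = y.1 ∧ T.Adj x.2 y.2 then 1 else 0, by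
      rintro ⟨i, a⟩ ⟨j, b⟩
      by_cases h : a = b
      · subst h
        simp [or_comm]
      · simp [h, Ne.symm h, eq_comm, T.adj_comm]⟩

open Classical in
lemma wt_mk (T : SimpleGraph V) (w : V → ℝ) (x y : Fin 4 × V) :
    wt T w s(x, y) = if x.2 = y.2 then (if y.1 = x.1 + 1 ∨ x.1 = y.1 + 1 then w x.2 else 0)
    else if x.1 = y.1 ∧ T.Adj x.2 y.2 then 1 else 0 := rfl

open Classical in
noncomputable def Nm (T : SimpleGraph V) (w : V → ℝ) : Matrix V V ℂ :=
  Matrix.of fun a b => if a = b then (Real.sqrt 2 : ℂ) * (w a : ℂ) else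
    if T.Adj a b then Complex.I else 0

lemma exists_leaf_s17 (T : SimpleGraph V) (h : T.IsAcyclic) {a b : V} (hab : T.Adj a b) :
    ∃ v u, T.Adj v u ∧ ∀ x, T.Adj v x → x = u := by
  have : Nonempty V := ⟨a⟩
  have ⟨u, v, p, hp, hmax⟩ := Walk.exists_isPath_forall_isPath_length_le_length T
  have hnil : ¬p.Nil := by
    intro hn
    have h1 := hmax _ _ (Path.singleton hab).1 (Path.singleton hab).2
    have h2 : p.length = 0 := by simpa [Walk.length_eq_zero_iff] using hn
    simp [h2, Path.singleton] at h1
  refine ⟨u, p.snd, p.adj_snd hnil, fun w hadj ↦ ?_⟩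
  apply h.eq_snd_of_adj_start hp hadj
  have : ¬(p.cons hadj.symm).IsPath := by
    intro h'
    have := hmax _ _ _ h'
    simp at this
  grind [hp.cons]

open Classical in
lemma haf_step (T : SimpleGraph V) (w : V → ℝ) (hw : ∀ x, 0 < w x) {v u : V} (hvu : T.Adj v u)
    (hl : ∀ x, T.Adj v x → x = u) :
    haf (wt T w) Finset.univ =
      haf (wt (T.deleteEdges {s(v, u)}) (Function.update w u (w u + 1 / (2 * w v)))) Finset.univ := by
  have huv : u ≠ v := hvu.ne'
  set R : Finset (Fin 4 × V) := Finset.univ.filter (fun x => x.2 ≠ v ∧ x.2 ≠ u) with hRdef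
  have hR : ∀ x ∈ R, x.2 ≠ v ∧ x.2 ≠ u := by simp [hRdef]
  have hfull : ∀ i : Fin 4, i ∈ ({0, 1, 2, 3} : Finset (Fin 4)) := by decide
  have huniv : (Finset.univ : Finset (Fin 4 × V)) =
      lay {0, 1, 2, 3} v (lay {0, 1, 2, 3} u R) := by
    ext x
    have := hfull x.1
    simp only [mem_lay, hRdef, Finset.mem_filter, Finset.mem_univ, true_and]
    tauto
  have hmemR : ∀ x ∈ lay {0, 1, 2, 3} u R, x.2 ≠ v := by
    intro x hx
    rw [mem_lay] at hx
    rcases hx with hx | hx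
    · rw [hx.2]; exact huv
    · exact (hR x hx).1
  rw [huniv, haf_leaf (c := w v) (wt T w) huv ?_ hR ?_, haf_iso (c := w v) _ ?_ hmemR ?_,
    haf_add (wt T w)
      (wt (T.deleteEdges {s(v, u)}) (Function.update w u (w u + 1 / (2 * w v)))) (ε := 1 / (2 * w v)) (fun x hx => (hR x hx).2) ?_]
  · have := (hw v).ne'
    field_simp
  · intro x hx y hy
    have hx := hmemR x hx
    have hy := hmemR y hy
    obtain ⟨i, a⟩ := x
    obtain ⟨j, b⟩ := y
    simp only at hx hy
    simp only [wt_mk, deleteEdges_adj, Set.mem_singleton_iff, Sym2.eq_iff]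
    by_cases hab : a = b
    · subst hab
      by_cases hau : a = u
      · subst hau
        simp only [if_true, Function.update_self, true_and]
        split_ifs <;> simp
      · simp [hau]
    · have : ¬ ((a = v ∧ b = u) ∨ (a = u ∧ b = v)) := by tauto
      have h2 : ¬ (a = u ∧ b = u ∧ (j = i + 1 ∨ i = j + 1)) := by
        rintro ⟨rfl, rfl, _⟩; exact hab rfl
      rw [if_neg hab, if_neg hab, if_neg h2, add_zero]
      refine if_congr (and_congr_right fun _ => ?_) rfl rfl
      exact and_iff_left this
  · intro i j
    simp [wt_mk, huv.symm]
  · intro i x hx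
    have hx := hmemR x hx
    obtain ⟨j, b⟩ := x
    simp only at hx
    simp only [wt_mk, deleteEdges_adj, Set.mem_singleton_iff, Sym2.eq_iff]
    rw [if_neg (Ne.symm hx), if_neg]
    rintro ⟨_, h1, h2⟩
    exact h2 (Or.inl ⟨trivial, hl _ h1⟩)
  · intro i j
    simp [wt_mk]
  · rintro i ⟨j, b⟩ hx
    simp only at hx
    simp only [wt_mk, Prod.mk.injEq]
    rw [if_neg (Ne.symm hx)]
    congr 1
    rw [eq_iff_iff]
    constructor
    · rintro ⟨rfl, h⟩; exact ⟨rfl, hl _ h⟩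
    · rintro ⟨rfl, rfl⟩; exact ⟨rfl, hvu⟩

open Classical in
lemma det_step (T : SimpleGraph V) (w : V → ℝ) (hw : ∀ x, 0 < w x) {v u : V} (hvu : T.Adj v u)
    (hl : ∀ x, T.Adj v x → x = u) :
    (Nm T w).det =
      (Nm (T.deleteEdges {s(v, u)}) (Function.update w u (w u + 1 / (2 * w v)))).det := by
  have huv : u ≠ v := hvu.ne'
  have hw0 : (w v : ℂ) ≠ 0 := by exact_mod_cast (hw v).ne'
  have hs0 : (Real.sqrt 2 : ℂ) ≠ 0 := by
    have : Real.sqrt 2 ≠ 0 := by positivity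
    exact_mod_cast this
  have hs2 : (Real.sqrt 2 : ℂ) ^ 2 = 2 := by
    have : Real.sqrt 2 ^ 2 = 2 := Real.sq_sqrt (by norm_num)
    exact_mod_cast this
  set c : ℂ := - (Complex.I / (Real.sqrt 2 * w v)) with hc
  rw [← Matrix.det_updateRow_add_smul_self (Nm T w) huv c,
    ← Matrix.det_updateCol_add_smul_self _ huv c]
  congr 1
  have hlv : ∀ x, T.Adj v x ↔ x = u := fun x => ⟨hl x, fun h => h ▸ hvu⟩
  have hlv' : ∀ x, T.Adj x v ↔ x = u := fun x => by rw [T.adj_comm, hlv]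
  have e1 : Complex.I + c * ((Real.sqrt 2 : ℂ) * w v) = 0 := by
    rw [hc]; field_simp; ring
  have e2 : (Real.sqrt 2 : ℂ) * w u + c * Complex.I =
      Real.sqrt 2 * (w u + 1 / (2 * w v)) := by
    rw [hc]; field_simp; rw [hs2, Complex.I_sq]; ring
  have hd : ∀ a b, ¬ ((a = v ∧ b = u) ∨ (a = u ∧ b = v)) →
      ((if T.Adj a b then Complex.I else 0) =
        if (T.deleteEdges {s(v, u)}).Adj a b then Complex.I else 0) := by
    intro a b h
    refine if_congr ?_ rfl rfl
    rw [deleteEdges_adj, Set.mem_singleton_iff, Sym2.eq_iff]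
    tauto
  ext a b
  simp only [Matrix.updateCol_apply, Matrix.updateRow_apply, Nm, Matrix.of_apply, Pi.add_apply,
    Pi.smul_apply, smul_eq_mul, Matrix.add_apply, Matrix.smul_apply, deleteEdges_adj,
    Set.mem_singleton_iff, Sym2.eq_iff, Function.update_apply]
  by_cases hau : a = u
  · by_cases hbu : b = u
    · subst hau; subst hbu
      simp [huv, huv.symm, hvu, hvu.symm, e1, e2]
    · by_cases hbv : b = v
      · subst hau; subst hbv
        simp [huv, huv.symm, hvu, hvu.symm, e1]
      · subst hau
        simpa [hbu, hbv, Ne.symm hbu, Ne.symm hbv, hlv, huv] using hd a b (by tauto)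
  · by_cases hbu : b = u
    · subst hbu
      by_cases hav : a = v
      · subst hav
        simp [huv, huv.symm, hvu, e1]
      · simpa [hau, hav, hlv', huv] using hd a b (by tauto)
    · have h' : ¬ ((a = v ∧ b = u) ∨ (a = u ∧ b = v)) := by tauto
      have := hd a b h'
      by_cases hab : a = b
      · subst hab; simp [hau]
      · simpa [hau, hbu, hab] using this

lemma haf_eq_det_sq (k : ℕ) : ∀ (T : SimpleGraph V) (w : V → ℝ), T.IsAcyclic → (∀ x, 0 < w x) →
    T.edgeSet.ncard = k → (haf (wt T w) Finset.univ : ℂ) = (Nm T w).det ^ 2 := by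
  induction k with
  | zero =>
    intro T w _ _ hk
    have hT : ∀ a b, ¬ T.Adj a b := by
      rw [Set.ncard_eq_zero] at hk
      intro a b h
      have : s(a, b) ∈ T.edgeSet := h
      rw [hk] at this
      exact this
    have h1 : ∀ A : Finset V, haf (wt T w) (Finset.univ ×ˢ A) = ∏ v ∈ A, 2 * w v ^ 2 := by
      intro A
      induction A using Finset.induction_on with
      | empty => simp [haf_empty]
      | insert v A hv ih =>
        rw [Finset.prod_insert hv, ← ih]
        have : Finset.univ ×ˢ insert v A = lay {0, 1, 2, 3} v (Finset.univ ×ˢ A) := by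
          have hfull : ∀ i : Fin 4, i ∈ ({0, 1, 2, 3} : Finset (Fin 4)) := by decide
          ext x
          have := hfull x.1
          simp only [mem_lay, Finset.mem_product, Finset.mem_univ, true_and, this]
          exact Finset.mem_insert
        rw [this, haf_iso]
        · intro i j; simp [wt_mk]
        · intro x hx h
          simp only [Finset.mem_product, Finset.mem_univ, true_and] at hx
          exact hv (h ▸ hx)
        · intro i x hx
          simp only [Finset.mem_product, Finset.mem_univ, true_and] at hx
          have : v ≠ x.2 := by rintro rfl; exact hv hx
          simp [wt_mk, this, hT]
    have h2 : Nm T w = Matrix.diagonal (fun v => (Real.sqrt 2 : ℂ) * w v) := by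
      ext a b
      simp [Nm, hT, Matrix.diagonal_apply]
    rw [h2, Matrix.det_diagonal, ← Finset.univ_product_univ, h1, ← Finset.prod_pow]
    push_cast
    refine Finset.prod_congr rfl fun v _ => ?_
    have hs2 : (Real.sqrt 2 : ℂ) ^ 2 = 2 := by
      have : Real.sqrt 2 ^ 2 = 2 := Real.sq_sqrt (by norm_num)
      exact_mod_cast this
    rw [mul_pow, hs2]
  | succ k ih =>
    intro T w hT hw hk
    have hne : T.edgeSet.Nonempty := by
      rw [← Set.ncard_pos]; omega
    obtain ⟨e, he⟩ := hne
    induction e with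
    | h a b =>
      obtain ⟨v, u, hvu, hl⟩ := exists_leaf_s17 T hT he
      rw [haf_step T w hw hvu hl, det_step T w hw hvu hl]
      apply ih
      · exact hT.anti (T.deleteEdges_le _)
      · intro x
        rw [Function.update_apply]
        have := hw v
        have := hw u
        split_ifs
        · positivity
        · exact hw x
      · rw [edgeSet_deleteEdges, Set.ncard_sdiff_singleton_of_mem (show s(v, u) ∈ T.edgeSet from hvu), hk]
        rfl

open Classical in
lemma pm_eq_det (T : SimpleGraph V) (hT : T.IsAcyclic) :
    ((Set.ncard {M : (cycleGraph 4 □ T).Subgraph | M.IsPerfectMatching} : ℝ) : ℂ) =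
      (Nm T (fun _ => 1)).det ^ 2 := by
  rw [← haf_eq_det_sq _ T _ hT (by simp) rfl, pm_eq_haf]
  congr 1
  apply haf_congr
  rintro ⟨i, a⟩ _ ⟨j, b⟩ _
  have key : ∀ i j : Fin 4, (cycleGraph 4).Adj i j ↔ (j = i + 1 ∨ i = j + 1) := by decide
  have hadj := key i j
  have he : s((i, a), (j, b)) ∈ (cycleGraph 4 □ T).edgeSet ↔
      (j = i + 1 ∨ i = j + 1) ∧ a = b ∨ T.Adj a b ∧ i = j := by
    rw [mem_edgeSet, boxProd_adj, hadj]
  rw [wt_mk]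
  by_cases hab : a = b
  · subst hab
    rw [if_pos rfl]
    refine if_congr (he.trans ?_) rfl rfl
    simp
  · rw [if_neg hab]
    refine if_congr (he.trans ?_) rfl rfl
    simp [hab, and_comm]

lemma det_eq (T : SimpleGraph V) [DecidableRel T.Adj] (s r : ℕ) (θ : Fin r → ℝ)
    (hroots : (T.adjMatrix ℝ).charpoly.roots =
      Multiset.replicate s 0 + Finset.univ.val.map θ +
        Finset.univ.val.map (fun j => - θ j)) :
    (Nm T (fun _ => 1)).det = (Real.sqrt 2 : ℂ) ^ s * ∏ j, (2 + (θ j : ℂ) ^ 2) := by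
  have hH : (T.adjMatrix ℝ).IsHermitian := by
    rw [Matrix.IsHermitian, Matrix.conjTranspose_eq_transpose_of_trivial]
    exact T.isSymm_adjMatrix
  have hsp : (T.adjMatrix ℝ).charpoly.Splits := hH.splits_charpoly
  have hcard : Fintype.card V = s + 2 * r := by
    rw [← Matrix.charpoly_natDegree_eq_dim (T.adjMatrix ℝ), hsp.natDegree_eq_card_roots, hroots]
    simp; ring
  have hs2 : (Real.sqrt 2 : ℂ) ^ 2 = 2 := by
    have : Real.sqrt 2 ^ 2 = 2 := Real.sq_sqrt (by norm_num)
    exact_mod_cast this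
  set z : ℂ := Complex.I * Real.sqrt 2 with hz
  have hN : Nm T (fun _ => 1) = (-Complex.I) •
      (Matrix.scalar V z - (T.adjMatrix ℝ).map Complex.ofRealHom) := by
    ext a b
    by_cases hab : a = b
    · subst hab
      simp [Nm, hz, ← mul_assoc]
    · by_cases h : T.Adj a b <;> simp [Nm, hab, h]
  rw [hN, Matrix.det_smul, ← Matrix.eval_charpoly, Matrix.charpoly_map, Polynomial.eval_map,
    hsp.eq_prod_roots_of_monic (Matrix.charpoly_monic _), hroots, hcard]
  simp only [Multiset.map_add, Multiset.prod_add, Polynomial.eval₂_mul, Multiset.map_replicate,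
    Multiset.prod_replicate, Multiset.map_map, Polynomial.eval₂_pow]
  have hp : ∀ g : Fin r → Polynomial ℝ, (Multiset.map g Finset.univ.val).prod = ∏ j, g j :=
    fun g => rfl
  rw [hp, hp, Polynomial.eval₂_finsetProd, Polynomial.eval₂_finsetProd, mul_assoc,
    ← Finset.prod_mul_distrib, pow_add, pow_mul]
  have : ((-Complex.I) ^ 2) ^ r = ∏ _j : Fin r, (-Complex.I) ^ 2 := by simp
  rw [this, mul_mul_mul_comm, ← mul_pow, ← Finset.prod_mul_distrib]
  congr 1
  · congr 1
    simp [hz, ← mul_assoc]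
  · refine Finset.prod_congr rfl fun j _ => ?_
    have hI := Complex.I_sq
    simp [hz]
    ring_nf
    rw [hs2]
    simp
end Main

/-- Let `T` be a tree on `n` vertices whose maximum matching has `r` edges, let
`s = n − 2r`, and let `±θ_1, …, ±θ_r` be the nonzero eigenvalues of `T` (with
multiplicity), so `0` is an eigenvalue with multiplicity `s`.  Then
`Pm(C_4 × T) = 2^s ∏_{j=1}^r (2 + θ_j²)²`. -/
theorem pm_c4_boxProd_tree_formula {V : Type*} [Fintype V] [DecidableEq V]
    (T : SimpleGraph V) [DecidableRel T.Adj] (hT : T.IsTree)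
    (n r s : ℕ) (hn : Fintype.card V = n)
    (hr : IsGreatest {k | ∃ M : T.Subgraph, M.IsMatching ∧ M.edgeSet.ncard = k} r)
    (hs : s = n - 2 * r)
    (θ : Fin r → ℝ) (hθ : ∀ j, θ j ≠ 0)
    (hroots : (T.adjMatrix ℝ).charpoly.roots =
      Multiset.replicate s 0 + Finset.univ.val.map θ +
        Finset.univ.val.map (fun j => - θ j)) :
    (Pm (cycleGraph 4 □ T) : ℝ) = 2 ^ s * ∏ j, (2 + θ j ^ 2) ^ 2 := by
  have h := pm_eq_det T hT.isAcyclic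
  rw [det_eq T s r θ hroots, mul_pow, ← pow_mul, mul_comm s 2, pow_mul] at h
  have hs2 : (Real.sqrt 2 : ℂ) ^ 2 = 2 := by
    have : Real.sqrt 2 ^ 2 = 2 := Real.sq_sqrt (by norm_num)
    exact_mod_cast this
  rw [hs2, ← Finset.prod_pow] at h
  rw [Pm]
  exact_mod_cast h
end
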